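/- arXiv:2301.10803 — 14 statements merged into one kernel-verified Lean document; each statement's English description precedes it below -/
import Mathlib

section
/- Let (Ω, 𝓕, ℙ) be a probability space, Y : Ω → {0,1} a random variable, and X : Ω → [0,1] a random variable that is calibrated for Y, i.e., E[Y | σ(X)] = X almost surely. Let F(t) = ℙ(X ≤ t) denote the cumulative distribution function of X. Then for every θ ∈ (0,1), the expected elementary score satisfies E[S_θ(X,Y)] = 2θ·ℙ(Y = 0) − 2·∫₀^θ F(x) dx. -/
open MeasureTheory

/-- The elementary scoring rule `S_θ(x,y)` for a probability forecast `x ∈ [0,1]`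
and binary outcome `y ∈ {0,1}`. -/
noncomputable def elemScore (θ x y : ℝ) : ℝ :=
  2 * θ * (if θ < x ∧ y = 0 then 1 else 0)
    + 2 * (1 - θ) * (if x < θ ∧ y = 1 then 1 else 0)
    + 2 * θ * (1 - θ) * (if x = θ then 1 else 0)

/-- For a calibrated probability forecast `X` of the binary outcome `Y`, the expected
elementary score at cost-loss parameter `θ ∈ (0,1)` equals
`2θ·ℙ(Y = 0) − 2·∫₀^θ F(x) dx`, where `F` is the CDF of `X`. -/
theorem expected_elementary_score_of_calibrated
    {Ω : Type*} [MeasurableSpace Ω] (μ : Measure Ω) [IsProbabilityMeasure μ]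
    (X Y : Ω → ℝ) (hX : Measurable X) (hY : Measurable Y)
    (hXr : ∀ ω, X ω ∈ Set.Icc (0:ℝ) 1) (hYr : ∀ ω, Y ω = 0 ∨ Y ω = 1)
    (hcal : μ[Y | MeasurableSpace.comap X inferInstance] =ᵐ[μ] X)
    (F : ℝ → ℝ) (hF : ∀ t, F t = (μ {ω | X ω ≤ t}).toReal)
    (θ : ℝ) (hθ : θ ∈ Set.Ioo (0:ℝ) 1) :
    ∫ ω, elemScore θ (X ω) (Y ω) ∂μ
      = 2 * θ * (μ {ω | Y ω = 0}).toReal - 2 * ∫ x in (0:ℝ)..θ, F x := by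
  have hm : MeasurableSpace.comap X inferInstance ≤ (inferInstance : MeasurableSpace Ω) :=
    hX.comap_le
  have hXi : Integrable X μ := by
    refine Integrable.of_bound hX.aestronglyMeasurable 1 (Filter.Eventually.of_forall fun ω => ?_)
    rw [Real.norm_eq_abs, abs_le]
    have := hXr ω
    constructor <;> linarith [this.1, this.2]
  have hYi : Integrable Y μ := by
    refine Integrable.of_bound hY.aestronglyMeasurable 1 (Filter.Eventually.of_forall fun ω => ?_)
    rcases hYr ω with h | h <;> simp [h]
  have key : ∀ s : Set ℝ, MeasurableSet s →
      ∫ ω, (X ⁻¹' s).indicator (fun ω => Y ω - X ω) ω ∂μ = 0 := by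
    intro s hs
    rw [integral_indicator (hX hs), integral_sub hYi.integrableOn hXi.integrableOn,
      ← setIntegral_condExp hm hYi (s := X ⁻¹' s) ⟨s, hs, rfl⟩,
      integral_congr_ae (ae_restrict_of_ae hcal), sub_self]
  have keyi : ∀ s : Set ℝ, MeasurableSet s →
      Integrable ((X ⁻¹' s).indicator (fun ω => Y ω - X ω)) μ :=
    fun s hs => (hYi.sub hXi).indicator (hX hs)
  have hmi : Integrable (fun ω => max (θ - X ω) 0) μ :=
    ((integrable_const θ).sub hXi).pos_part
  have hY0 : (μ {ω | Y ω = 0}).toReal = ∫ ω, (1 - Y ω) ∂μ := by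
    have h0 : MeasurableSet {ω | Y ω = 0} := hY (measurableSet_singleton 0)
    have : (fun ω => 1 - Y ω) = {ω | Y ω = 0}.indicator (fun _ => (1:ℝ)) := by
      funext ω
      rcases hYr ω with h | h <;> simp [Set.indicator, h]
    rw [this, integral_indicator h0]
    simp [Measure.real]
  have hFub : ∫ x in (0:ℝ)..θ, F x = ∫ ω, max (θ - X ω) 0 ∂μ := by
    have hS : MeasurableSet {p : ℝ × Ω | X p.2 ≤ p.1} :=
      measurableSet_le (hX.comp measurable_snd) measurable_fst
    have h1 : ∀ x, F x = ∫ ω, {p : ℝ × Ω | X p.2 ≤ p.1}.indicator (fun _ => (1:ℝ)) (x, ω) ∂μ := by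
      intro x
      have : (fun ω => {p : ℝ × Ω | X p.2 ≤ p.1}.indicator (fun _ => (1:ℝ)) (x, ω))
          = {ω | X ω ≤ x}.indicator (fun _ => (1:ℝ)) := by
        funext ω
        simp [Set.indicator]
      rw [this, integral_indicator (measurableSet_le hX measurable_const), hF]
      simp [Measure.real]
    simp_rw [h1]
    rw [intervalIntegral.integral_of_le hθ.1.le, integral_integral_swap]
    · refine integral_congr_ae (Filter.Eventually.of_forall fun ω => ?_)
      have : (fun x => {p : ℝ × Ω | X p.2 ≤ p.1}.indicator (fun _ => (1:ℝ)) (x, ω))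
          = (Set.Ici (X ω)).indicator (fun _ => (1:ℝ)) := by
        funext x
        simp [Set.indicator]
      simp only [this]
      rw [integral_Ioc_eq_integral_Ioo, ← integral_Icc_eq_integral_Ioo,
        integral_indicator measurableSet_Ici, Measure.restrict_restrict measurableSet_Ici]
      have h2 : Set.Ici (X ω) ∩ Set.Icc 0 θ = Set.Icc (X ω) θ := by
        ext x
        have := (hXr ω).1
        simp only [Set.mem_inter_iff, Set.mem_Ici, Set.mem_Icc]
        constructor
        · rintro ⟨a, b, c⟩; exact ⟨a, c⟩
        · rintro ⟨a, c⟩; exact ⟨a, by linarith, c⟩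
      rw [h2]
      simp [Measure.real, ENNReal.toReal_ofReal']
    · exact (integrable_const (1:ℝ)).indicator hS
  have hpt : ∀ ω, elemScore θ (X ω) (Y ω) = 2 * θ * (1 - Y ω) - 2 * max (θ - X ω) 0
      + 2 * (X ⁻¹' (Set.Iio θ)).indicator (fun ω => Y ω - X ω) ω
      + 2 * θ * (X ⁻¹' {θ}).indicator (fun ω => Y ω - X ω) ω := by
    intro ω
    simp only [elemScore, Set.indicator, Set.mem_preimage, Set.mem_Iio, Set.mem_singleton_iff]
    rcases lt_trichotomy (X ω) θ with h | h | h
    · rw [max_eq_left (by linarith)]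
      rcases hYr ω with hy | hy <;> simp [hy, h, h.not_gt, h.ne] <;> ring
    · rcases hYr ω with hy | hy <;> simp [hy, h] <;> ring
    · rw [max_eq_right (by linarith)]
      rcases hYr ω with hy | hy <;> simp [hy, h, h.not_gt, h.ne']
  have i1 : Integrable (fun ω => 2 * θ * (1 - Y ω)) μ :=
    ((integrable_const 1).sub hYi).const_mul _
  have i2 : Integrable (fun ω => 2 * max (θ - X ω) 0) μ := hmi.const_mul _
  have i3 := (keyi _ (measurableSet_Iio (a := θ))).const_mul 2
  have i4 := (keyi _ (measurableSet_singleton θ)).const_mul (2 * θ)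
  simp_rw [hpt]
  rw [integral_add (by exact (i1.sub i2).add i3) i4, integral_add (by exact i1.sub i2) i3,
    integral_sub i1 i2]
  simp only [integral_const_mul]
  rw [key _ measurableSet_Iio, key _ (measurableSet_singleton θ), hFub, hY0]
  ring
end

section
/- Let (Ω, 𝓕, ℙ) be a probability space, Y : Ω → {0,1} a random variable with 0 < ℙ(Y=0) < 1, and X₁, X₂ : Ω → [0,1] random variables that are each calibrated for Y. Let F₁, F₂ denote the cumulative distribution functions of X₁ and X₂. Then for every θ ∈ (0,1), the Murphy curve difference satisfies D^MC(θ) := (1/2)·(E[S_θ(X₁,Y)] − E[S_θ(X₂,Y)]) = ∫₀^θ (F₂(x) − F₁(x)) dx. -/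
open MeasureTheory

lemma aux_swap {Ω : Type*} [MeasurableSpace Ω] (μ : Measure Ω) [IsProbabilityMeasure μ]
    (X : Ω → ℝ) (hX : Measurable X) (hXr : ∀ ω, X ω ∈ Set.Icc (0:ℝ) 1)
    (θ : ℝ) (hθ : θ ∈ Set.Ioo (0:ℝ) 1) :
    ∫ x in (0:ℝ)..θ, (μ {ω | X ω ≤ x}).toReal = ∫ ω, max (θ - X ω) 0 ∂μ := by
  have h1 : ∀ x : ℝ, (μ {ω | X ω ≤ x}).toReal = ∫ ω, (if X ω ≤ x then (1:ℝ) else 0) ∂μ := by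
    intro x
    have hm : MeasurableSet {ω | X ω ≤ x} := measurableSet_le hX measurable_const
    have := integral_indicator_one (μ := μ) hm
    rw [← Measure.real, ← this]
    congr 1
  have h2 : ∀ ω, max (θ - X ω) 0 = ∫ x in Set.Ioc 0 θ, (if X ω ≤ x then (1:ℝ) else 0) := by
    intro ω
    have hm : MeasurableSet (Set.Ici (X ω)) := measurableSet_Ici
    have e : (fun x => (if X ω ≤ x then (1:ℝ) else 0)) = (Set.Ici (X ω)).indicator 1 := by
      ext x; simp [Set.indicator]
    rw [e, integral_indicator_one hm, measureReal_restrict_apply hm]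
    have h0 := (hXr ω).1
    have : volume.real (Set.Ici (X ω) ∩ Set.Ioc 0 θ) = volume.real (Set.Icc (X ω) θ) := by
      apply measureReal_congr
      have h3 : (Set.Ioc (X ω) θ : Set ℝ) ⊆ Set.Ici (X ω) ∩ Set.Ioc 0 θ := by
        intro x hx; exact ⟨hx.1.le, h0.trans_lt hx.1, hx.2⟩
      have h4 : Set.Ici (X ω) ∩ Set.Ioc 0 θ ⊆ (Set.Icc (X ω) θ : Set ℝ) := by
        intro x hx; exact ⟨hx.1, hx.2.2⟩
      have h5 : (Set.Ioc (X ω) θ : Set ℝ) =ᵐ[volume] Set.Icc (X ω) θ := Ioc_ae_eq_Icc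
      exact h4.eventuallyLE.antisymm (h5.symm.le.trans h3.eventuallyLE)
    rw [this, Real.volume_real_Icc]
  simp_rw [h1, h2]
  rw [intervalIntegral.integral_of_le hθ.1.le]
  apply integral_integral_swap
  have hm : Measurable (Function.uncurry fun (x : ℝ) ω => if X ω ≤ x then (1:ℝ) else 0) := by
    apply Measurable.ite _ measurable_const measurable_const
    exact measurableSet_le (hX.comp measurable_snd) measurable_fst
  refine Integrable.of_bound hm.aestronglyMeasurable 1 (Filter.Eventually.of_forall ?_)
  rintro ⟨x, ω⟩
  simp only [Function.uncurry]
  split_ifs <;> simp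

lemma aux_score {Ω : Type*} [MeasurableSpace Ω] (μ : Measure Ω) [IsProbabilityMeasure μ]
    (X Y : Ω → ℝ) (hX : Measurable X) (hY : Measurable Y)
    (hXr : ∀ ω, X ω ∈ Set.Icc (0:ℝ) 1) (hYr : ∀ ω, Y ω = 0 ∨ Y ω = 1)
    (hcal : μ[Y | MeasurableSpace.comap X inferInstance] =ᵐ[μ] X)
    (θ : ℝ) (hθ : θ ∈ Set.Ioo (0:ℝ) 1) :
    ∫ ω, elemScore θ (X ω) (Y ω) ∂μ
      = 2 * (θ - θ * ∫ ω, Y ω ∂μ) - 2 * ∫ ω, max (θ - X ω) 0 ∂μ := by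
  obtain ⟨t0, t1⟩ := hθ
  have hYi : Integrable Y μ := by
    refine Integrable.of_bound hY.aestronglyMeasurable 1 (Filter.Eventually.of_forall ?_)
    intro ω; rcases hYr ω with h | h <;> simp [h]
  have hXi : Integrable X μ := by
    refine Integrable.of_bound hX.aestronglyMeasurable 1 (Filter.Eventually.of_forall ?_)
    intro ω; rw [Real.norm_eq_abs, abs_le]; have := hXr ω
    constructor <;> linarith [this.1, this.2]
  have hle : MeasurableSpace.comap X inferInstance ≤ (inferInstance : MeasurableSpace Ω) :=
    hX.comap_le
  have hEX : ∫ ω, Y ω ∂μ = ∫ ω, X ω ∂μ := by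
    rw [← integral_condExp hle]; exact integral_congr_ae hcal
  let a : ℝ → ℝ := fun x => 2 * θ * (if θ < x then 1 else 0) +
    2 * θ * (1 - θ) * (if x = θ then 1 else 0)
  let b : ℝ → ℝ := fun x => 2 * (1 - θ) * (if x < θ then 1 else 0) -
    2 * θ * (if θ < x then 1 else 0)
  have ha : Measurable a := by
    apply Measurable.add
    · exact (Measurable.ite measurableSet_Ioi measurable_const measurable_const).const_mul _
    · exact (Measurable.ite (measurableSet_singleton θ)
        measurable_const measurable_const).const_mul _
  have hb : Measurable b := by
    apply Measurable.sub
    · exact (Measurable.ite measurableSet_Iio measurable_const measurable_const).const_mul _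
    · exact (Measurable.ite measurableSet_Ioi measurable_const measurable_const).const_mul _
  have hab : ∀ x, ‖b x‖ ≤ 2 := by
    intro x; simp only [b]; rw [Real.norm_eq_abs, abs_le]
    split_ifs <;> constructor <;> linarith
  have haa : ∀ x, ‖a x‖ ≤ 4 := by
    intro x; simp only [a]; rw [Real.norm_eq_abs, abs_le]
    split_ifs <;> constructor <;> nlinarith
  have hai : Integrable (fun ω => a (X ω)) μ :=
    Integrable.of_bound (ha.comp hX).aestronglyMeasurable 4 (Filter.Eventually.of_forall fun _ => haa _)
  have hbY : Integrable (fun ω => b (X ω) * Y ω) μ :=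
    hYi.bdd_mul (hb.comp hX).aestronglyMeasurable (Filter.Eventually.of_forall fun _ => hab _)
  have hbX : Integrable (fun ω => b (X ω) * X ω) μ :=
    hXi.bdd_mul (hb.comp hX).aestronglyMeasurable (Filter.Eventually.of_forall fun _ => hab _)
  have hkey : ∫ ω, b (X ω) * Y ω ∂μ = ∫ ω, b (X ω) * X ω ∂μ := by
    rw [← integral_condExp hle]
    have hsm : StronglyMeasurable[MeasurableSpace.comap X inferInstance] (fun ω => b (X ω)) :=
      (hb.comp (comap_measurable X)).stronglyMeasurable
    have := condExp_mul_of_stronglyMeasurable_left (μ := μ) hsm hbY hYi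
    refine integral_congr_ae (this.trans ?_)
    filter_upwards [hcal] with ω h
    simp [h]
  have hmi : Integrable (fun ω => max (θ - X ω) 0) μ :=
    ((integrable_const θ).sub hXi).pos_part
  have e1 : ∀ ω, elemScore θ (X ω) (Y ω) = a (X ω) + b (X ω) * Y ω := by
    intro ω
    simp only [elemScore, a, b]
    rcases hYr ω with h | h <;> simp [h]
    ring
  have e2 : ∀ ω, a (X ω) + b (X ω) * X ω = (2 * θ - 2 * θ * X ω) - 2 * max (θ - X ω) 0 := by
    intro ω
    simp only [a, b]
    rcases lt_trichotomy (X ω) θ with h | h | h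
    · rw [max_eq_left (by linarith), if_neg h.not_gt, if_neg h.ne, if_pos h]; ring
    · simp [h]; ring
    · rw [max_eq_right (by linarith), if_pos h, if_neg h.ne', if_neg h.not_gt]; ring
  simp_rw [e1]
  rw [integral_add hai hbY, hkey, ← integral_add hai hbX]
  simp_rw [e2]
  rw [integral_sub (by fun_prop) (hmi.const_mul 2), integral_sub (by fun_prop) (by fun_prop),
    integral_const_mul (2 * θ) X, integral_const_mul 2 (fun ω => max (θ - X ω) 0), hEX]
  simp
  ring

lemma aux_int {Ω : Type*} [MeasurableSpace Ω] (μ : Measure Ω) [IsProbabilityMeasure μ]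
    (X : Ω → ℝ) (a b : ℝ) :
    IntervalIntegrable (fun x => (μ {ω | X ω ≤ x}).toReal) volume a b := by
  apply Monotone.intervalIntegrable
  intro x y h
  exact ENNReal.toReal_mono (measure_ne_top _ _) (measure_mono fun ω hω => le_trans hω h)

/-- For calibrated probability forecasts `X₁, X₂` of the binary outcome `Y`, the Murphy
curve difference at `θ ∈ (0,1)` equals `∫₀^θ (F₂(x) − F₁(x)) dx`. -/
theorem murphy_curve_difference_of_calibrated
    {Ω : Type*} [MeasurableSpace Ω] (μ : Measure Ω) [IsProbabilityMeasure μ]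
    (X₁ X₂ Y : Ω → ℝ) (hX₁ : Measurable X₁) (hX₂ : Measurable X₂) (hY : Measurable Y)
    (hX₁r : ∀ ω, X₁ ω ∈ Set.Icc (0:ℝ) 1) (hX₂r : ∀ ω, X₂ ω ∈ Set.Icc (0:ℝ) 1)
    (hYr : ∀ ω, Y ω = 0 ∨ Y ω = 1)
    (hY0 : 0 < μ {ω | Y ω = 0}) (hY0' : μ {ω | Y ω = 0} < 1)
    (hcal₁ : μ[Y | MeasurableSpace.comap X₁ inferInstance] =ᵐ[μ] X₁)
    (hcal₂ : μ[Y | MeasurableSpace.comap X₂ inferInstance] =ᵐ[μ] X₂)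
    (F₁ F₂ : ℝ → ℝ)
    (hF₁ : ∀ t, F₁ t = (μ {ω | X₁ ω ≤ t}).toReal)
    (hF₂ : ∀ t, F₂ t = (μ {ω | X₂ ω ≤ t}).toReal)
    (θ : ℝ) (hθ : θ ∈ Set.Ioo (0:ℝ) 1) :
    (1 / 2) * ((∫ ω, elemScore θ (X₁ ω) (Y ω) ∂μ) - ∫ ω, elemScore θ (X₂ ω) (Y ω) ∂μ)
      = ∫ x in (0:ℝ)..θ, (F₂ x - F₁ x) := by
  simp_rw [hF₁, hF₂]
  rw [intervalIntegral.integral_sub (aux_int μ X₂ 0 θ) (aux_int μ X₁ 0 θ),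
    aux_swap μ X₁ hX₁ hX₁r θ hθ, aux_swap μ X₂ hX₂ hX₂r θ hθ,
    aux_score μ X₁ Y hX₁ hY hX₁r hYr hcal₁ θ hθ, aux_score μ X₂ Y hX₂ hY hX₂r hYr hcal₂ θ hθ]
  ring
end

section
/- Let X be a random variable with values in [0,1], with cumulative distribution function F(t) = ℙ(X ≤ t) and left-continuous generalized inverse Q(α) = inf{x ∈ [0,1] : F(x) ≥ α} for α ∈ (0,1]. Then for every t ∈ [0,1], E[X·1(X ≤ t)] = ∫₀^{F(t)} Q(α) dα, where the right-hand side is the Lebesgue integral of Q over the interval (0, F(t)]. -/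
open MeasureTheory

/-- For a random variable `X` with values in `[0,1]`, CDF `F` and left-continuous
generalized inverse (quantile function) `Q`, it holds for every `t ∈ [0,1]` that
`E[X·1(X ≤ t)] = ∫₀^{F(t)} Q(α) dα`, the latter being the Lebesgue integral of `Q`
over the interval `(0, F(t)]`. -/
theorem integral_restrict_eq_integral_quantile
    {Ω : Type*} [MeasurableSpace Ω] (μ : Measure Ω) [IsProbabilityMeasure μ]
    (X : Ω → ℝ) (hX : Measurable X) (hXr : ∀ ω, X ω ∈ Set.Icc (0:ℝ) 1)
    (F : ℝ → ℝ) (hF : ∀ t, F t = (μ {ω | X ω ≤ t}).toReal)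
    (Q : ℝ → ℝ)
    (hQ : ∀ α ∈ Set.Ioc (0:ℝ) 1, Q α = sInf {x | x ∈ Set.Icc (0:ℝ) 1 ∧ α ≤ F x}) :
    ∀ t ∈ Set.Icc (0:ℝ) 1,
      ∫ ω in {ω | X ω ≤ t}, X ω ∂μ = ∫ α in Set.Ioc (0:ℝ) (F t), Q α := by
  intro t ht
  haveI : IsProbabilityMeasure (μ.map X) := Measure.isProbabilityMeasure_map hX.aemeasurable
  have hFc : ∀ x, F x = ProbabilityTheory.cdf (μ.map X) x := by
    intro x
    rw [hF, ProbabilityTheory.cdf_eq_real, Measure.real, Measure.map_apply hX measurableSet_Iic]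
    rfl
  have hmono : Monotone F := by
    intro a b hab
    rw [hFc, hFc]
    exact ProbabilityTheory.monotone_cdf _ hab
  have hF1 : F 1 = 1 := by
    have : {ω | X ω ≤ 1} = Set.univ := by
      ext ω; simpa using (hXr ω).2
    rw [hF, this]; simp
  have hFneg : ∀ x < 0, F x = 0 := by
    intro x hx
    have : {ω | X ω ≤ x} = ∅ := by
      ext ω; simpa using lt_of_lt_of_le hx (hXr ω).1
    rw [hF, this]; simp
  have hF0 : ∀ x, 0 ≤ F x := fun x => by rw [hF]; exact ENNReal.toReal_nonneg
  have hFle : ∀ x, F x ≤ 1 := fun x => by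
    rw [hFc]; exact ProbabilityTheory.cdf_le_one _ _
  have hbdd : ∀ α, BddBelow {x | x ∈ Set.Icc (0:ℝ) 1 ∧ α ≤ F x} :=
    fun α => ⟨0, fun x hx => hx.1.1⟩
  have hmem1 : ∀ α ∈ Set.Ioc (0:ℝ) 1, (1:ℝ) ∈ {x | x ∈ Set.Icc (0:ℝ) 1 ∧ α ≤ F x} :=
    fun α hα => ⟨by simp, by rw [hF1]; exact hα.2⟩
  have gal : ∀ α ∈ Set.Ioc (0:ℝ) 1, ∀ x, Q α ≤ x ↔ α ≤ F x := by
    intro α hα x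
    rw [hQ α hα]
    constructor
    · intro h
      have hc : Filter.Tendsto F (nhdsWithin x (Set.Ioi x)) (nhds (F x)) := by
        have h1 := (ProbabilityTheory.cdf (μ.map X)).right_continuous x
        have h2 : F = fun y => ProbabilityTheory.cdf (μ.map X) y := funext hFc
        rw [h2]
        exact h1.tendsto.mono_left (nhdsWithin_mono _ Set.Ioi_subset_Ici_self)
      refine ge_of_tendsto hc ?_
      filter_upwards [self_mem_nhdsWithin] with y hy
      obtain ⟨z, hz, hzy⟩ := exists_lt_of_csInf_lt ⟨1, hmem1 α hα⟩ (lt_of_le_of_lt h hy)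
      exact hz.2.trans (hmono hzy.le)
    · intro h
      rcases lt_or_ge x 0 with hx | hx
      · rw [hFneg x hx] at h
        exact absurd hα.1 (not_lt.2 h)
      rcases le_or_gt x 1 with hx1 | hx1
      · exact csInf_le (hbdd α) ⟨⟨hx, hx1⟩, h⟩
      · exact (csInf_le (hbdd α) (hmem1 α hα)).trans hx1.le
  have hQm : MonotoneOn Q (Set.Ioc 0 1) := by
    intro a ha b hb hab
    rw [gal a ha]
    exact hab.trans ((gal b hb _).1 le_rfl)
  have hQae : AEMeasurable Q (volume.restrict (Set.Ioc (0:ℝ) 1)) :=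
    aemeasurable_restrict_of_monotoneOn measurableSet_Ioc hQm
  have hset : ∀ x, Q ⁻¹' Set.Iic x ∩ Set.Ioc 0 1 = Set.Ioc 0 (F x) := by
    intro x
    ext α
    constructor
    · rintro ⟨h1, h2⟩
      exact ⟨h2.1, (gal α h2 x).1 h1⟩
    · rintro ⟨h1, h2⟩
      have h3 : α ∈ Set.Ioc (0:ℝ) 1 := ⟨h1, h2.trans (hFle x)⟩
      exact ⟨(gal α h3 x).2 h2, h3⟩
  have hmap : μ.map X = (volume.restrict (Set.Ioc (0:ℝ) 1)).map Q := by
    refine Measure.ext_of_Iic _ _ fun x => ?_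
    rw [Measure.map_apply hX measurableSet_Iic, Measure.map_apply_of_aemeasurable hQae
      measurableSet_Iic, Measure.restrict_apply' measurableSet_Ioc, hset, Real.volume_Ioc, hF,
      sub_zero, ENNReal.ofReal_toReal (measure_ne_top _ _)]
    rfl
  have e1 : ∫ ω in {ω | X ω ≤ t}, X ω ∂μ = ∫ x in Set.Iic t, x ∂(μ.map X) :=
    (setIntegral_map measurableSet_Iic aestronglyMeasurable_id hX.aemeasurable).symm
  have e2 : ∫ x in Set.Iic t, x ∂((volume.restrict (Set.Ioc (0:ℝ) 1)).map Q)
      = ∫ α in Q ⁻¹' Set.Iic t, Q α ∂(volume.restrict (Set.Ioc (0:ℝ) 1)) :=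
    setIntegral_map measurableSet_Iic aestronglyMeasurable_id hQae
  rw [e1, hmap, e2, Measure.restrict_restrict' measurableSet_Ioc, hset]
end

section
/- Let (Ω, 𝓕, ℙ) be a probability space, Y : Ω → {0,1} a random variable with π₁ := ℙ(Y=1) > 0 and π₀ := ℙ(Y=0) > 0, and X : Ω → [0,1] a random variable that is calibrated for Y. Let F be the cumulative distribution function of X and Q its left-continuous generalized inverse. Then for every t ∈ [0,1], writing c = F(t): ℙ(X > t, Y = 1) = π₁ − ∫₀^c Q(α) dα and ℙ(X > t, Y = 0) = π₀ − c + ∫₀^c Q(α) dα; equivalently, the hit rate HR(t) = ℙ(X > t | Y=1) equals 1 − (1/π₁)·∫₀^c Q(α) dα and the false alarm rate FAR(t) = ℙ(X > t | Y=0) equals 1 − (1/π₀)·(c − ∫₀^c Q(α) dα). -/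
open MeasureTheory

/-- For a calibrated probability forecast `X` of the binary outcome `Y` with
`π₁ = ℙ(Y=1) > 0` and `π₀ = ℙ(Y=0) > 0`, and with `F` the CDF of `X` and `Q` its
left-continuous generalized inverse, for every `t ∈ [0,1]`, writing `c = F(t)`:
`ℙ(X > t, Y = 1) = π₁ − ∫₀^c Q(α) dα`, `ℙ(X > t, Y = 0) = π₀ − c + ∫₀^c Q(α) dα`,
and equivalently the hit rate `HR(t) = ℙ(X > t | Y = 1)` equals
`1 − (1/π₁)·∫₀^c Q(α) dα` and the false alarm rate `FAR(t) = ℙ(X > t | Y = 0)` equals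
`1 − (1/π₀)·(c − ∫₀^c Q(α) dα)`. -/
theorem hit_rate_false_alarm_rate_of_calibrated
    {Ω : Type*} [MeasurableSpace Ω] (μ : Measure Ω) [IsProbabilityMeasure μ]
    (X Y : Ω → ℝ) (hX : Measurable X) (hY : Measurable Y)
    (hXr : ∀ ω, X ω ∈ Set.Icc (0:ℝ) 1) (hYr : ∀ ω, Y ω = 0 ∨ Y ω = 1)
    (π₀ π₁ : ℝ) (hπ₀ : π₀ = (μ {ω | Y ω = 0}).toReal) (hπ₁ : π₁ = (μ {ω | Y ω = 1}).toReal)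
    (hπ₀pos : 0 < π₀) (hπ₁pos : 0 < π₁)
    (hcal : μ[Y | MeasurableSpace.comap X inferInstance] =ᵐ[μ] X)
    (F : ℝ → ℝ) (hF : ∀ t, F t = (μ {ω | X ω ≤ t}).toReal)
    (Q : ℝ → ℝ)
    (hQ : ∀ α ∈ Set.Ioc (0:ℝ) 1, Q α = sInf {x | x ∈ Set.Icc (0:ℝ) 1 ∧ α ≤ F x}) :
    ∀ t ∈ Set.Icc (0:ℝ) 1,
      (μ {ω | t < X ω ∧ Y ω = 1}).toReal = π₁ - (∫ α in Set.Ioc (0:ℝ) (F t), Q α)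
      ∧ (μ {ω | t < X ω ∧ Y ω = 0}).toReal
          = π₀ - F t + ∫ α in Set.Ioc (0:ℝ) (F t), Q α
      ∧ (μ {ω | t < X ω ∧ Y ω = 1}).toReal / π₁
          = 1 - (1 / π₁) * ∫ α in Set.Ioc (0:ℝ) (F t), Q α
      ∧ (μ {ω | t < X ω ∧ Y ω = 0}).toReal / π₀
          = 1 - (1 / π₀) * (F t - ∫ α in Set.Ioc (0:ℝ) (F t), Q α) := by
  classical
  have hFcdf : ∀ x, F x = ProbabilityTheory.cdf (μ.map X) x := by
    intro x
    haveI := Measure.isProbabilityMeasure_map (μ := μ) hX.aemeasurable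
    rw [hF, ProbabilityTheory.cdf_eq_real, measureReal_def, Measure.map_apply hX measurableSet_Iic]
    rfl
  have hmono : Monotone F := by
    intro a b hab
    rw [hFcdf, hFcdf]
    exact ProbabilityTheory.monotone_cdf _ hab
  have hFneg : ∀ x < 0, F x = 0 := by
    intro x hx
    have : {ω | X ω ≤ x} = ∅ := by
      ext ω
      simp only [Set.mem_setOf_eq, Set.mem_empty_iff_false, iff_false, not_le]
      exact hx.trans_le (hXr ω).1
    rw [hF, this]; simp
  have hF1 : F 1 = 1 := by
    have : {ω | X ω ≤ 1} = Set.univ := by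
      ext ω
      simpa using (hXr ω).2
    rw [hF, this]; simp
  have hFnn : ∀ x, 0 ≤ F x := fun x => by rw [hF]; exact ENNReal.toReal_nonneg
  have hFle : ∀ x, F x ≤ 1 := fun x => by rw [hFcdf]; exact ProbabilityTheory.cdf_le_one _ _
  have hbdd : ∀ α, BddBelow {x | x ∈ Set.Icc (0:ℝ) 1 ∧ α ≤ F x} :=
    fun α => ⟨0, fun x hx => hx.1.1⟩
  have hgal : ∀ α ∈ Set.Ioc (0:ℝ) 1, ∀ x, Q α ≤ x ↔ α ≤ F x := by
    intro α hα x
    have hne : (1:ℝ) ∈ {x | x ∈ Set.Icc (0:ℝ) 1 ∧ α ≤ F x} := by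
      refine ⟨by simp, ?_⟩
      rw [hF1]; exact hα.2
    rw [hQ α hα]
    constructor
    · intro h
      have key : ∀ y, x < y → α ≤ F y := by
        intro y hy
        obtain ⟨z, hz, hzy⟩ := exists_lt_of_csInf_lt ⟨1, hne⟩ (h.trans_lt hy)
        exact hz.2.trans (hmono hzy.le)
      have hc : Filter.Tendsto F (nhdsWithin x (Set.Ioi x)) (nhds (F x)) := by
        have := ((ProbabilityTheory.cdf (μ.map X)).right_continuous x).mono Set.Ioi_subset_Ici_self
        have e : F = ProbabilityTheory.cdf (μ.map X) := funext hFcdf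
        rw [e]; exact this
      exact ge_of_tendsto hc (Filter.eventually_of_mem self_mem_nhdsWithin key)
    · intro h
      have hx0 : 0 ≤ x := by
        by_contra hx
        rw [hFneg x (not_le.mp hx)] at h
        exact absurd hα.1 (not_lt.mpr h)
      rcases le_total x 1 with hx1 | hx1
      · exact csInf_le (hbdd α) ⟨⟨hx0, hx1⟩, h⟩
      · exact (csInf_le (hbdd α) hne).trans hx1
  have hQmono : MonotoneOn Q (Set.Ioc 0 1) := by
    intro a ha b hb hab
    rw [hgal a ha]
    exact hab.trans ((hgal b hb _).1 le_rfl)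
  have hQm : AEMeasurable Q (volume.restrict (Set.Ioc (0:ℝ) 1)) :=
    aemeasurable_restrict_of_monotoneOn measurableSet_Ioc hQmono
  have hset : ∀ x, Q ⁻¹' Set.Iic x ∩ Set.Ioc 0 1 = Set.Ioc 0 (F x) := by
    intro x
    ext α
    simp only [Set.mem_inter_iff, Set.mem_preimage, Set.mem_Iic]
    constructor
    · rintro ⟨h, hα⟩
      exact ⟨hα.1, (hgal α hα x).1 h⟩
    · intro h
      have hα : α ∈ Set.Ioc (0:ℝ) 1 := ⟨h.1, h.2.trans (hFle x)⟩
      exact ⟨(hgal α hα x).2 h.2, hα⟩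
  have hmap : Measure.map Q (volume.restrict (Set.Ioc (0:ℝ) 1)) = μ.map X := by
    haveI : IsFiniteMeasure (volume.restrict (Set.Ioc (0:ℝ) 1)) := inferInstance
    apply Measure.ext_of_Iic
    intro x
    rw [Measure.map_apply_of_aemeasurable hQm measurableSet_Iic,
      Measure.restrict_apply' measurableSet_Ioc, hset, Real.volume_Ioc,
      Measure.map_apply hX measurableSet_Iic, sub_zero, hF,
      ENNReal.ofReal_toReal (measure_ne_top _ _)]
    rfl
  intro t ht
  have h1 : ∫ α in Set.Ioc (0:ℝ) (F t), Q α = ∫ ω in {ω | X ω ≤ t}, X ω ∂μ := by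
    have hg : AEStronglyMeasurable ((Set.Iic t).indicator (fun y : ℝ => y)) (μ.map X) :=
      (measurable_id.indicator measurableSet_Iic).aestronglyMeasurable
    have hA : ∫ y, (Set.Iic t).indicator (fun y : ℝ => y) y ∂(μ.map X)
        = ∫ ω in {ω | X ω ≤ t}, X ω ∂μ := by
      rw [integral_map hX.aemeasurable hg,
        ← integral_indicator (measurableSet_le hX measurable_const)]
      rfl
    rw [← hA, ← hmap, integral_map hQm (by rw [hmap]; exact hg),
      ← integral_indicator measurableSet_Ioc, ← integral_indicator measurableSet_Ioc]
    congr 1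
    funext α
    have := Set.ext_iff.1 (hset t) α
    simp only [Set.mem_inter_iff, Set.mem_preimage] at this
    simp only [Set.indicator_apply]
    by_cases h : α ∈ Set.Ioc 0 (F t)
    · have h' := this.2 h
      rw [if_pos h, if_pos h'.2, if_pos h'.1]
    · rw [if_neg h]
      by_cases h2 : α ∈ Set.Ioc (0:ℝ) 1
      · rw [if_pos h2, if_neg (fun h3 => h (this.1 ⟨h3, h2⟩))]
      · rw [if_neg h2]
  have hYi : Integrable Y μ := by
    refine Integrable.of_bound hY.aestronglyMeasurable 1 (Filter.Eventually.of_forall ?_)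
    intro ω
    rcases hYr ω with h | h <;> simp [h]
  have hSm : MeasurableSet {ω | X ω ≤ t} := measurableSet_le hX measurable_const
  have h2 : ∫ ω in {ω | X ω ≤ t}, X ω ∂μ = ∫ ω in {ω | X ω ≤ t}, Y ω ∂μ := by
    rw [← setIntegral_condExp (s := {ω | X ω ≤ t}) hX.comap_le hYi ⟨Set.Iic t, measurableSet_Iic, rfl⟩]
    refine setIntegral_congr_ae hSm ?_
    filter_upwards [hcal] with ω h _
    exact h.symm
  have hY1 : MeasurableSet {ω | Y ω = 1} := hY (measurableSet_singleton 1)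
  have hY0 : MeasurableSet {ω | Y ω = 0} := hY (measurableSet_singleton 0)
  have hYind : Y = {ω | Y ω = 1}.indicator (fun _ => (1:ℝ)) := by
    funext ω
    rcases hYr ω with h | h <;> simp [Set.indicator_apply, h]
  have h3 : ∫ ω in {ω | X ω ≤ t}, Y ω ∂μ = μ.real ({ω | Y ω = 1} ∩ {ω | X ω ≤ t}) := by
    conv_lhs => rw [hYind]
    rw [integral_indicator hY1, Measure.restrict_restrict hY1]
    simp
  have e1 : {ω | t < X ω ∧ Y ω = 1} = {ω | Y ω = 1} \ {ω | X ω ≤ t} := by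
    ext ω; simp [and_comm]
  have e0 : {ω | t < X ω ∧ Y ω = 0} = {ω | Y ω = 0} \ {ω | X ω ≤ t} := by
    ext ω; simp [and_comm]
  have s1 := measureReal_inter_add_diff (μ := μ) (s := {ω | Y ω = 1}) hSm
  have s0 := measureReal_inter_add_diff (μ := μ) (s := {ω | Y ω = 0}) hSm
  have sF := measureReal_inter_add_diff (μ := μ) (s := {ω | X ω ≤ t}) hY1
  have e2 : {ω | X ω ≤ t} \ {ω | Y ω = 1} = {ω | Y ω = 0} ∩ {ω | X ω ≤ t} := by
    ext ω
    rcases hYr ω with h | h <;> simp [h]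
  rw [e2, Set.inter_comm] at sF
  have hFt := hF t
  rw [← e1] at s1
  rw [← e0] at s0
  rw [h1, h2, h3]
  simp only [measureReal_def] at *
  have r1 : (μ {ω | t < X ω ∧ Y ω = 1}).toReal
      = π₁ - (μ ({ω | Y ω = 1} ∩ {ω | X ω ≤ t})).toReal := by linarith
  have r0 : (μ {ω | t < X ω ∧ Y ω = 0}).toReal
      = π₀ - F t + (μ ({ω | Y ω = 1} ∩ {ω | X ω ≤ t})).toReal := by linarith
  refine ⟨r1, r0, ?_, ?_⟩
  · rw [r1]
    field_simp
  · rw [r0]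
    field_simp
    ring
end

section
/- Let (Ω, 𝓕, ℙ) be a probability space, Y : Ω → {0,1} a random variable with 0 < ℙ(Y=0) < 1, and X₁, X₂ : Ω → [0,1] random variables that are each calibrated for Y. Let F₁, F₂ be the cumulative distribution functions of X₁ and X₂, and Q₁, Q₂ their left-continuous generalized inverses. Suppose F₁ − F₂ has exactly n sign changes on [0,1], where n ≥ 1 is finite. Then the ROC curve difference D^ROC(c) := ∫₀^c (Q₁(α) − Q₂(α)) dα, c ∈ [0,1], has at most n − 1 sign changes. -/
open MeasureTheory

/-- `f` has at least `n` sign changes on the set `s`: there are points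
`t₀ < t₁ < ⋯ < t_n` in `s` with `f(tᵢ)·f(tᵢ₊₁) < 0` for all `i`. -/
def SignChangesAtLeast (f : ℝ → ℝ) (s : Set ℝ) (n : ℕ) : Prop :=
  ∃ t : Fin (n + 1) → ℝ, StrictMono t ∧ (∀ i, t i ∈ s) ∧
    ∀ i : Fin n, f (t i.castSucc) * f (t i.succ) < 0

/-- `f` has exactly `n` sign changes on the set `s`. -/
def SignChangesExactly (f : ℝ → ℝ) (s : Set ℝ) (n : ℕ) : Prop :=
  SignChangesAtLeast f s n ∧ ¬ SignChangesAtLeast f s (n + 1)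

theorem quantile_facts {Ω : Type*} [MeasurableSpace Ω] (μ : Measure Ω) [IsProbabilityMeasure μ]
    (X : Ω → ℝ) (hX : Measurable X) (hXr : ∀ ω, X ω ∈ Set.Icc (0:ℝ) 1)
    (F : ℝ → ℝ) (hF : ∀ t, F t = (μ {ω | X ω ≤ t}).toReal)
    (Q : ℝ → ℝ)
    (hQ : ∀ α ∈ Set.Ioc (0:ℝ) 1, Q α = sInf {x | x ∈ Set.Icc (0:ℝ) 1 ∧ α ≤ F x}) :
    (∀ α ∈ Set.Ioc (0:ℝ) 1, Q α ∈ Set.Icc (0:ℝ) 1) ∧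
    (∀ α ∈ Set.Ioc (0:ℝ) 1, ∀ x, Q α ≤ x ↔ α ≤ F x) ∧
    MonotoneOn Q (Set.Ioc 0 1) ∧
    IntegrableOn Q (Set.Ioc 0 1) ∧
    ∫ α in Set.Ioc (0:ℝ) 1, Q α = ∫ ω, X ω ∂μ := by
  have : IsProbabilityMeasure (μ.map X) := Measure.isProbabilityMeasure_map hX.aemeasurable
  have hFc : ∀ t, F t = ProbabilityTheory.cdf (μ.map X) t := by
    intro t
    rw [hF, ProbabilityTheory.cdf_eq_real, Measure.real, Measure.map_apply hX measurableSet_Iic]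
    rfl
  have hmono : Monotone F := by
    intro a b h
    rw [hFc, hFc]
    exact ProbabilityTheory.monotone_cdf _ h
  have hF1 : ∀ x, 1 ≤ x → F x = 1 := by
    intro x hx
    have : {ω | X ω ≤ x} = Set.univ := by
      ext ω; simpa using (hXr ω).2.trans hx
    rw [hF, this]; simp
  have hFle : ∀ x, F x ≤ 1 := by
    intro x
    rw [hFc]; exact ProbabilityTheory.cdf_le_one _ _
  have hF0 : ∀ x, x < 0 → F x = 0 := by
    intro x hx
    have : {ω | X ω ≤ x} = ∅ := by
      ext ω; simpa using hx.trans_le (hXr ω).1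
    rw [hF, this]; simp
  have hmem : ∀ α ∈ Set.Ioc (0:ℝ) 1, Q α ∈ Set.Icc (0:ℝ) 1 ∧ α ≤ F (Q α) ∧
      ∀ x ∈ Set.Icc (0:ℝ) 1, α ≤ F x → Q α ≤ x := by
    intro α hα
    set S := {x | x ∈ Set.Icc (0:ℝ) 1 ∧ α ≤ F x} with hS
    have h1 : (1:ℝ) ∈ S := ⟨by simp, by rw [hF1 1 le_rfl]; exact hα.2⟩
    have hbd : BddBelow S := ⟨0, fun x hx => hx.1.1⟩
    rw [hQ α hα]
    refine ⟨⟨le_csInf ⟨1, h1⟩ fun x hx => hx.1.1, csInf_le hbd h1⟩, ?_, 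
      fun x hx hx' => csInf_le hbd ⟨hx, hx'⟩⟩
    have hrc : Filter.Tendsto F (nhdsWithin (sInf S) (Set.Ioi (sInf S))) (nhds (F (sInf S))) := by
      have h := (ProbabilityTheory.cdf (μ.map X)).right_continuous (sInf S)
      have h2 : F = fun t => ProbabilityTheory.cdf (μ.map X) t := funext hFc
      rw [h2]
      exact h.tendsto.mono_left (nhdsWithin_mono _ Set.Ioi_subset_Ici_self)
    refine ge_of_tendsto hrc ?_
    filter_upwards [self_mem_nhdsWithin] with y hy
    obtain ⟨s, hs, hsy⟩ := exists_lt_of_csInf_lt ⟨1, h1⟩ hy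
    exact hs.2.trans (hmono hsy.le)
  have hgal : ∀ α ∈ Set.Ioc (0:ℝ) 1, ∀ x, Q α ≤ x ↔ α ≤ F x := by
    intro α hα x
    obtain ⟨h1, h2, h3⟩ := hmem α hα
    constructor
    · intro h; exact h2.trans (hmono h)
    · intro h
      rcases lt_or_ge x 0 with hx | hx
      · rw [hF0 x hx] at h; exact absurd hα.1 (not_lt.2 h)
      rcases le_or_gt x 1 with hx' | hx'
      · exact h3 x ⟨hx, hx'⟩ h
      · exact h1.2.trans hx'.le
  have hQm : MonotoneOn Q (Set.Ioc 0 1) := by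
    intro a ha b hb hab
    rw [hgal a ha]
    exact hab.trans (hmem b hb).2.1
  have hae : AEMeasurable Q (volume.restrict (Set.Ioc 0 1)) :=
    aemeasurable_restrict_of_monotoneOn measurableSet_Ioc hQm
  refine ⟨fun α hα => (hmem α hα).1, hgal, hQm, ?_, ?_⟩
  · refine Integrable.of_bound hae.aestronglyMeasurable 1 ?_
    filter_upwards [ae_restrict_mem measurableSet_Ioc] with α hα
    have := (hmem α hα).1
    rw [Real.norm_eq_abs, abs_le]
    constructor <;> linarith [this.1, this.2]
  · have hP : IsProbabilityMeasure ((volume : Measure ℝ).restrict (Set.Ioc 0 1)) :=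
      ⟨by simp⟩
    have hP2 : IsProbabilityMeasure (((volume : Measure ℝ).restrict (Set.Ioc 0 1)).map Q) :=
      Measure.isProbabilityMeasure_map hae
    have hmap : ((volume : Measure ℝ).restrict (Set.Ioc 0 1)).map Q = μ.map X := by
      refine Measure.ext_of_Iic _ _ fun x => ?_
      rw [Measure.map_apply_of_aemeasurable hae measurableSet_Iic,
        Measure.map_apply hX measurableSet_Iic,
        Measure.restrict_apply' measurableSet_Ioc]
      have : Q ⁻¹' Set.Iic x ∩ Set.Ioc 0 1 = Set.Ioc 0 (F x) := by
        ext α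
        constructor
        · rintro ⟨h1, h2⟩
          exact ⟨h2.1, (hgal α h2 x).1 h1⟩
        · rintro ⟨h1, h2⟩
          have hα : α ∈ Set.Ioc (0:ℝ) 1 := ⟨h1, h2.trans (hFle x)⟩
          exact ⟨(hgal α hα x).2 h2, hα⟩
      rw [this, Real.volume_Ioc, sub_zero, hF, ENNReal.ofReal_toReal (measure_ne_top _ _)]
      rfl
    have e1 := integral_map hae (f := fun x : ℝ => x) aestronglyMeasurable_id
    have e2 := integral_map (μ := μ) hX.aemeasurable (f := fun x : ℝ => x) aestronglyMeasurable_id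
    rw [← e1, ← e2, hmap]

theorem exists_sign (f : ℝ → ℝ) (a b : ℝ) (h : (∫ α in Set.Ioc a b, f α) ≠ 0) :
    ∃ α ∈ Set.Ioc a b, 0 < f α * ∫ α in Set.Ioc a b, f α := by
  by_contra! hc
  rcases lt_or_gt_of_ne h with h | h
  · have : 0 ≤ ∫ α in Set.Ioc a b, f α :=
      setIntegral_nonneg measurableSet_Ioc fun x hx => by
        have := hc x hx
        by_contra! hn
        nlinarith
    linarith
  · have : (∫ α in Set.Ioc a b, f α) ≤ 0 :=
      setIntegral_nonpos measurableSet_Ioc fun x hx => by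
        have := hc x hx
        by_contra! hn
        nlinarith
    linarith

/-- If `X₁` and `X₂` are calibrated probability forecasts of the binary outcome `Y`
with `0 < ℙ(Y=0) < 1`, and the difference `F₁ − F₂` of the CDFs has exactly `n ≥ 1`
sign changes on `[0,1]`, then the ROC curve difference
`D^ROC(c) = ∫₀^c (Q₁(α) − Q₂(α)) dα` has at most `n − 1` sign changes on `[0,1]`. -/
theorem roc_curve_difference_sign_changes
    {Ω : Type*} [MeasurableSpace Ω] (μ : Measure Ω) [IsProbabilityMeasure μ]
    (X₁ X₂ Y : Ω → ℝ) (hX₁ : Measurable X₁) (hX₂ : Measurable X₂) (hY : Measurable Y)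
    (hX₁r : ∀ ω, X₁ ω ∈ Set.Icc (0:ℝ) 1) (hX₂r : ∀ ω, X₂ ω ∈ Set.Icc (0:ℝ) 1)
    (hYr : ∀ ω, Y ω = 0 ∨ Y ω = 1)
    (hY0 : 0 < μ {ω | Y ω = 0}) (hY0' : μ {ω | Y ω = 0} < 1)
    (hcal₁ : μ[Y | MeasurableSpace.comap X₁ inferInstance] =ᵐ[μ] X₁)
    (hcal₂ : μ[Y | MeasurableSpace.comap X₂ inferInstance] =ᵐ[μ] X₂)
    (F₁ F₂ : ℝ → ℝ)
    (hF₁ : ∀ t, F₁ t = (μ {ω | X₁ ω ≤ t}).toReal)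
    (hF₂ : ∀ t, F₂ t = (μ {ω | X₂ ω ≤ t}).toReal)
    (Q₁ Q₂ : ℝ → ℝ)
    (hQ₁ : ∀ α ∈ Set.Ioc (0:ℝ) 1, Q₁ α = sInf {x | x ∈ Set.Icc (0:ℝ) 1 ∧ α ≤ F₁ x})
    (hQ₂ : ∀ α ∈ Set.Ioc (0:ℝ) 1, Q₂ α = sInf {x | x ∈ Set.Icc (0:ℝ) 1 ∧ α ≤ F₂ x})
    (n : ℕ) (hn : 1 ≤ n)
    (hsign : SignChangesExactly (fun x => F₁ x - F₂ x) (Set.Icc 0 1) n) :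
    ¬ SignChangesAtLeast
        (fun c => ∫ α in Set.Ioc (0:ℝ) c, (Q₁ α - Q₂ α)) (Set.Icc 0 1) n := by
  obtain ⟨hr1, hg1, hm1, hi1, he1⟩ := quantile_facts μ X₁ hX₁ hX₁r F₁ hF₁ Q₁ hQ₁
  obtain ⟨hr2, hg2, hm2, hi2, he2⟩ := quantile_facts μ X₂ hX₂ hX₂r F₂ hF₂ Q₂ hQ₂
  have hE : ∫ ω, X₁ ω ∂μ = ∫ ω, X₂ ω ∂μ := by
    rw [← integral_congr_ae hcal₁, ← integral_congr_ae hcal₂,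
      integral_condExp hX₁.comap_le, integral_condExp hX₂.comap_le]
  rintro ⟨t, htm, htI, hts⟩
  apply hsign.2
  set f : ℝ → ℝ := fun α => Q₁ α - Q₂ α with hf
  have hfi : IntegrableOn f (Set.Ioc 0 1) := hi1.sub hi2
  set D : ℝ → ℝ := fun c => ∫ α in Set.Ioc (0:ℝ) c, f α with hD
  have hD0 : D 0 = 0 := by simp [hD]
  have hD1 : D 1 = 0 := by
    simp only [hD, hf]
    rw [integral_sub hi1 hi2, he1, he2, hE, sub_self]
  have hDsub : ∀ a b, 0 ≤ a → a ≤ b → b ≤ 1 → D b - D a = ∫ α in Set.Ioc a b, f α := by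
    intro a b ha hab hb
    have hu : Set.Ioc 0 b = Set.Ioc 0 a ∪ Set.Ioc a b := (Set.Ioc_union_Ioc_eq_Ioc ha hab).symm
    have : D b = D a + ∫ α in Set.Ioc a b, f α := by
      simp only [hD]
      rw [hu, setIntegral_union (Set.Ioc_disjoint_Ioc_of_le le_rfl) measurableSet_Ioc
        (hfi.mono_set (Set.Ioc_subset_Ioc le_rfl (hab.trans hb)))
        (hfi.mono_set (Set.Ioc_subset_Ioc ha hb))]
    linarith
  let a : ℕ → ℝ := fun k => if k = 0 then 0 else if h : k - 1 < n + 1 then t ⟨k - 1, h⟩ else 1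
  have ha0 : a 0 = 0 := by simp [a]
  have hat : ∀ k (h : k < n + 1), a (k + 1) = t ⟨k, h⟩ := by
    intro k h
    simp [a, Nat.lt_succ_iff.1 h]
  have ha1 : a (n + 2) = 1 := by simp [a]
  have haI : ∀ k, a k ∈ Set.Icc (0:ℝ) 1 := by
    intro k
    simp only [a]
    split_ifs
    · simp
    · exact htI _
    · simp
  have hmono : ∀ k, k < n + 2 → a k ≤ a (k + 1) := by
    intro k hk
    rcases Nat.eq_zero_or_pos k with rfl | hk0
    · rw [ha0]; exact (haI _).1
    obtain ⟨j, rfl⟩ : ∃ j, k = j + 1 := ⟨k - 1, by omega⟩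
    rcases Nat.lt_or_ge (j + 1) (n + 1) with h | h
    · rw [hat j (by omega), hat (j + 1) h]
      exact htm.monotone (by simp)
    · have : j + 1 + 1 = n + 2 := by omega
      rw [this, ha1]; exact (haI _).2
  have hneg : ∀ k, 1 ≤ k → k < n + 1 → D (a k) * D (a (k + 1)) < 0 := by
    intro k h1 h2
    obtain ⟨j, rfl⟩ : ∃ j, k = j + 1 := ⟨k - 1, by omega⟩
    rw [hat j (by omega), hat (j + 1) h2]
    exact hts ⟨j, by omega⟩
  have hnonpos : ∀ k, k < n + 2 → D (a k) * D (a (k + 1)) ≤ 0 := by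
    intro k hk
    rcases Nat.eq_zero_or_pos k with rfl | hk0
    · rw [ha0, hD0, zero_mul]
    rcases Nat.lt_or_ge k (n + 1) with h | h
    · exact (hneg k hk0 h).le
    · have : k + 1 = n + 2 := by omega
      rw [this, ha1, hD1, mul_zero]
  have hne : ∀ k, k < n + 1 → D (a (k + 1)) ≠ 0 := by
    intro k hk h0
    rcases Nat.lt_or_ge k n with h | h
    · have := hneg (k + 1) (by omega) (by omega)
      rw [h0, zero_mul] at this; exact lt_irrefl _ this
    · have := hneg k (by omega) (by omega)
      rw [h0, mul_zero] at this; exact lt_irrefl _ this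
  have hss : ∀ k, k < n + 1 →
      (D (a (k + 1)) - D (a k)) * (D (a (k + 2)) - D (a (k + 1))) < 0 := by
    intro k hk
    have h1 := hnonpos k (by omega)
    have h2 := hnonpos (k + 1) (by omega)
    have h2 : D (a (k + 1)) * D (a (k + 2)) ≤ 0 := h2
    rcases lt_or_gt_of_ne (hne k hk) with h | h
    · have h3 : 0 ≤ D (a k) := by by_contra! hh; nlinarith
      have h4 : 0 ≤ D (a (k + 2)) := by by_contra! hh; nlinarith
      exact mul_neg_of_neg_of_pos (by linarith) (by linarith)
    · have h3 : D (a k) ≤ 0 := by by_contra! hh; nlinarith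
      have h4 : D (a (k + 2)) ≤ 0 := by by_contra! hh; nlinarith
      exact mul_neg_of_pos_of_neg (by linarith) (by linarith)
  have hex : ∀ k, ∃ α, k < n + 2 →
      α ∈ Set.Ioc (a k) (a (k + 1)) ∧ 0 < f α * (D (a (k + 1)) - D (a k)) := by
    intro k
    by_cases hk : k < n + 2
    · have hs : D (a (k + 1)) - D (a k) ≠ 0 := by
        intro h0
        rcases Nat.lt_or_ge k (n + 1) with h | h
        · have := hss k h
          rw [h0, zero_mul] at this; exact lt_irrefl _ this
        · obtain ⟨j, rfl⟩ : ∃ j, k = j + 1 := ⟨k - 1, by omega⟩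
          have := hss j (by omega)
          have h0' : D (a (j + 2)) - D (a (j + 1)) = 0 := h0
          rw [h0', mul_zero] at this; exact lt_irrefl _ this
      rw [hDsub _ _ (haI k).1 (hmono k hk) (haI (k + 1)).2] at hs ⊢
      obtain ⟨α, h1, h2⟩ := exists_sign f _ _ hs
      exact ⟨α, fun _ => ⟨h1, h2⟩⟩
    · exact ⟨0, fun h => absurd h hk⟩
  choose α hα using hex
  have hαI : ∀ k, k < n + 2 → α k ∈ Set.Ioc (0:ℝ) 1 := fun k hk =>
    ⟨(haI k).1.trans_lt (hα k hk).1.1, (hα k hk).1.2.trans (haI _).2⟩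
  have hG : ∀ β ∈ Set.Ioc (0:ℝ) 1, f β ≠ 0 →
      (F₁ (min (Q₁ β) (Q₂ β)) - F₂ (min (Q₁ β) (Q₂ β))) * f β < 0 := by
    intro β hβ h0
    rcases lt_or_gt_of_ne h0 with h | h
    · have h' : Q₁ β < Q₂ β := by simp only [hf] at h; linarith
      rw [min_eq_left h'.le]
      have e1 := (hg1 β hβ (Q₁ β)).1 le_rfl
      have e2 := mt (hg2 β hβ (Q₁ β)).2 (not_le.2 h')
      exact mul_neg_of_pos_of_neg (by linarith) h
    · have h' : Q₂ β < Q₁ β := by simp only [hf] at h; linarith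
      rw [min_eq_right h'.le]
      have e1 := (hg2 β hβ (Q₂ β)).1 le_rfl
      have e2 := mt (hg1 β hβ (Q₂ β)).2 (not_le.2 h')
      exact mul_neg_of_neg_of_pos (by linarith) h
  let x : ℕ → ℝ := fun k => min (Q₁ (α k)) (Q₂ (α k))
  have hGx : ∀ k, k < n + 2 → (F₁ (x k) - F₂ (x k)) * (D (a (k + 1)) - D (a k)) < 0 := by
    intro k hk
    have h1 := (hα k hk).2
    have h2 := hG (α k) (hαI k hk) (fun h => by rw [h, zero_mul] at h1; exact lt_irrefl _ h1)
    change (F₁ (x k) - F₂ (x k)) * f (α k) < 0 at h2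
    by_contra! h3
    have h4 := mul_neg_of_neg_of_pos h2 h1
    nlinarith [mul_nonneg h3 (mul_self_nonneg (f (α k)))]
  have hGG : ∀ k, k < n + 1 →
      (F₁ (x k) - F₂ (x k)) * (F₁ (x (k + 1)) - F₂ (x (k + 1))) < 0 := by
    intro k hk
    have h1 := hGx k (by omega)
    have h2 := hGx (k + 1) (by omega)
    have h3 := hss k hk
    have h4 := mul_pos_of_neg_of_neg h1 h2
    by_contra! h5
    have h6 := mul_nonpos_of_nonneg_of_nonpos h5 h3.le
    have h7 : k + 1 + 1 = k + 2 := rfl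
    rw [h7] at h4
    nlinarith
  have hxlt : ∀ k, k < n + 1 → x k < x (k + 1) := by
    intro k hk
    have hle : α k ≤ α (k + 1) :=
      (hα k (by omega)).1.2.trans (hα (k + 1) (by omega)).1.1.le
    have h1 : x k ≤ x (k + 1) :=
      min_le_min (hm1 (hαI k (by omega)) (hαI (k + 1) (by omega)) hle)
        (hm2 (hαI k (by omega)) (hαI (k + 1) (by omega)) hle)
    refine lt_of_le_of_ne h1 fun h => ?_
    have := hGG k hk
    rw [← h] at this
    exact absurd this (not_lt.2 (mul_self_nonneg _))
  refine ⟨fun i => x i, Fin.strictMono_iff_lt_succ.2 fun i => ?_, fun i => ?_, fun i => ?_⟩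
  · simpa using hxlt i i.2
  · have h1 := hr1 _ (hαI i i.2)
    have h2 := hr2 _ (hαI i i.2)
    exact ⟨le_min h1.1 h2.1, (min_le_left _ _).trans h1.2⟩
  · simpa using hGG i i.2
end

section
/- Let (Ω, 𝓕, ℙ) be a probability space, Y : Ω → {0,1} a random variable with 0 < ℙ(Y=0) < 1, and X₁, X₂ : Ω → [0,1] random variables that are each calibrated for Y. Let F₁, F₂ be the cumulative distribution functions of X₁ and X₂, and Q₁, Q₂ their left-continuous generalized inverses. Suppose F₁ − F₂ has exactly n sign changes on [0,1], where n ≥ 1 is finite. Then the Murphy curve difference D^MC(θ) := (1/2)·(E[S_θ(X₁,Y)] − E[S_θ(X₂,Y)]), θ ∈ (0,1), and the ROC curve difference D^ROC(c) := ∫₀^c (Q₁(α) − Q₂(α)) dα, c ∈ [0,1], have the same number of sign changes: for every natural number m, D^MC has exactly m sign changes if and only if D^ROC has exactly m sign changes. -/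
open MeasureTheory

/-- Young-dual pair on the unit interval. -/
structure YPair (φ ψ : ℝ → ℝ) : Prop where
  young : ∀ t ∈ Set.Icc (0:ℝ) 1, ∀ c ∈ Set.Icc (0:ℝ) 1, c * t ≤ φ t + ψ c
  att : ∀ t ∈ Set.Icc (0:ℝ) 1, ∃ c ∈ Set.Icc (0:ℝ) 1, φ t + ψ c = c * t
  att' : ∀ c ∈ Set.Icc (0:ℝ) 1, ∃ t ∈ Set.Icc (0:ℝ) 1, φ t + ψ c = c * t

theorem YPair.symm {φ ψ : ℝ → ℝ} (h : YPair φ ψ) : YPair ψ φ where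
  young := fun t ht c hc => by have := h.young c hc t ht; linarith
  att := fun t ht => by
    obtain ⟨c, hc, e⟩ := h.att' t ht
    exact ⟨c, hc, by linarith⟩
  att' := fun t ht => by
    obtain ⟨c, hc, e⟩ := h.att t ht
    exact ⟨c, hc, by linarith⟩

theorem YPair.lip {φ ψ : ℝ → ℝ} (h : YPair φ ψ) {s t : ℝ} (hs : s ∈ Set.Icc (0:ℝ) 1)
    (ht : t ∈ Set.Icc (0:ℝ) 1) : φ t - φ s ≤ |t - s| := by
  obtain ⟨c, hc, e⟩ := h.att t ht
  have := h.young s hs c hc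
  have h2 : c * (t - s) ≤ |t - s| := by
    calc c * (t - s) ≤ c * |t - s| := by gcongr; exact hc.1; exact le_abs_self _
      _ ≤ 1 * |t - s| := by gcongr; exact hc.2
      _ = _ := one_mul _
  linarith

theorem YPair.cont {φ ψ : ℝ → ℝ} (h : YPair φ ψ) : ContinuousOn φ (Set.Icc 0 1) := by
  have : LipschitzOnWith 1 φ (Set.Icc 0 1) := by
    apply LipschitzOnWith.of_dist_le_mul
    intro x hx y hy
    rw [Real.dist_eq, Real.dist_eq, abs_le]
    have h1 := h.lip hx hy
    have h2 := h.lip hy hx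
    rw [abs_sub_comm y x] at h1
    simp only [NNReal.coe_one, one_mul]
    constructor <;> linarith
  exact this.continuousOn

theorem YPair.conv {φ ψ : ℝ → ℝ} (h : YPair φ ψ) {s t e : ℝ} (hs : s ∈ Set.Icc (0:ℝ) 1)
    (ht : t ∈ Set.Icc (0:ℝ) 1) (he : 0 ≤ e) (he1 : e ≤ 1) :
    φ (t + e * (s - t)) ≤ φ t + e * (φ s - φ t) := by
  have hm : t + e * (s - t) ∈ Set.Icc (0:ℝ) 1 := by
    obtain ⟨a, b⟩ := hs
    obtain ⟨a', b'⟩ := ht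
    constructor <;> nlinarith
  obtain ⟨c, hc, eq⟩ := h.att _ hm
  have h1 := h.young s hs c hc
  have h2 := h.young t ht c hc
  nlinarith

/-- Local lemma, positive case. -/
theorem peak_pos {φ₁ φ₂ ψ₁ ψ₂ : ℝ → ℝ} (h₁ : YPair φ₁ ψ₁) (h₂ : YPair φ₂ ψ₂)
    (e0 : φ₁ 0 = φ₂ 0) (e1 : φ₁ 1 = φ₂ 1) {t : ℝ} (ht : t ∈ Set.Icc (0:ℝ) 1)
    (hpos : 0 < φ₁ t - φ₂ t) :
    ∃ s ∈ Set.Icc (0:ℝ) 1, ∃ c ∈ Set.Icc (0:ℝ) 1,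
      (∀ x ∈ Set.uIcc t s, 0 < φ₁ x - φ₂ x) ∧
      φ₁ s + ψ₁ c = c * s ∧ φ₂ s + ψ₂ c = c * s := by
  have hG : ContinuousOn (fun x => φ₁ x - φ₂ x) (Set.Icc 0 1) := h₁.cont.sub h₂.cont
  have cA : IsCompact (Set.Icc 0 t ∩ (fun x => φ₁ x - φ₂ x) ⁻¹' Set.Iic 0) :=
    isCompact_Icc.of_isClosed_subset
      ((hG.mono (Set.Icc_subset_Icc le_rfl ht.2)).preimage_isClosed_of_isClosed isClosed_Icc isClosed_Iic)
      Set.inter_subset_left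
  have cB : IsCompact (Set.Icc t 1 ∩ (fun x => φ₁ x - φ₂ x) ⁻¹' Set.Iic 0) :=
    isCompact_Icc.of_isClosed_subset
      ((hG.mono (Set.Icc_subset_Icc ht.1 le_rfl)).preimage_isClosed_of_isClosed isClosed_Icc isClosed_Iic)
      Set.inter_subset_left
  obtain ⟨a, ⟨haI, ha0⟩, ha⟩ := cA.exists_isGreatest ⟨0, ⟨le_rfl, ht.1⟩, by simp [e0]⟩
  obtain ⟨b, ⟨hbI, hb0⟩, hb⟩ := cB.exists_isLeast ⟨1, ⟨ht.2, le_rfl⟩, by simp [e1]⟩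
  simp only [Set.mem_preimage, Set.mem_Iic] at ha0 hb0
  have hat : a < t := lt_of_le_of_ne haI.2 (by rintro rfl; linarith)
  have htb : t < b := lt_of_le_of_ne hbI.1 (by rintro rfl; linarith)
  have hp : ∀ x, a < x → x < b → 0 < φ₁ x - φ₂ x := by
    intro x hax hxb
    by_contra hc
    rw [not_lt] at hc
    rcases le_total x t with hxt | hxt
    · exact absurd (ha ⟨⟨by linarith [haI.1], hxt⟩, hc⟩) (not_le.2 hax)
    · exact absurd (hb ⟨⟨hxt, by linarith [hbI.2]⟩, hc⟩) (not_le.2 hxb)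
  have hsub : Set.Icc a b ⊆ Set.Icc 0 1 := Set.Icc_subset_Icc haI.1 hbI.2
  obtain ⟨s, hs, hmax⟩ := isCompact_Icc.exists_isMaxOn ⟨t, hat.le, htb.le⟩ (hG.mono hsub)
  have hmax' : ∀ x ∈ Set.Icc a b, φ₁ x - φ₂ x ≤ φ₁ s - φ₂ s := fun x hx => hmax hx
  have hst := hmax' t ⟨hat.le, htb.le⟩
  have has : a < s := lt_of_le_of_ne hs.1 (by rintro rfl; linarith)
  have hsb : s < b := lt_of_le_of_ne hs.2 (by rintro rfl; linarith)
  obtain ⟨c, hc, hcs⟩ := h₁.att s (hsub hs)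
  refine ⟨s, hsub hs, c, hc, ?_, hcs, ?_⟩
  · intro x hx
    rw [Set.mem_uIcc] at hx
    rcases hx with hx | hx
    · exact hp x (by linarith) (by linarith)
    · exact hp x (by linarith) (by linarith)
  · apply le_antisymm _ (h₂.young s (hsub hs) c hc)
    obtain ⟨r, hr, hcr⟩ := h₂.att' c hc
    -- small step from s towards r
    obtain ⟨e, he, he1, hm⟩ : ∃ e : ℝ, 0 < e ∧ e ≤ 1 ∧ s + e * (r - s) ∈ Set.Icc a b := by
      refine ⟨min 1 (min (s - a) (b - s)), by simp [has, hsb], min_le_left _ _, ?_⟩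
      set e := min 1 (min (s - a) (b - s)) with hedef
      have k1 : e ≤ s - a := (min_le_right _ _).trans (min_le_left _ _)
      have k2 : e ≤ b - s := (min_le_right _ _).trans (min_le_right _ _)
      have k0 : 0 < e := by simp [hedef, has, hsb]
      have r1 : |r - s| ≤ 1 := by
        have := (hsub hs)
        rw [abs_le]; constructor <;> linarith [hr.1, hr.2, this.1, this.2]
      rw [abs_le] at r1
      constructor <;> nlinarith
    have k1 := hmax' _ hm
    have k2 := h₂.conv hr (hsub hs) he.le he1
    have k3 := h₁.young _ (hsub hm) c hc
    have k4 : e * (c * (r - s)) ≤ e * (φ₂ r - φ₂ s) := by nlinarith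
    have k5 := le_of_mul_le_mul_left k4 he
    nlinarith

theorem peak {φ₁ φ₂ ψ₁ ψ₂ : ℝ → ℝ} (h₁ : YPair φ₁ ψ₁) (h₂ : YPair φ₂ ψ₂)
    (e0 : φ₁ 0 = φ₂ 0) (e1 : φ₁ 1 = φ₂ 1) {t : ℝ} (ht : t ∈ Set.Icc (0:ℝ) 1)
    (hne : φ₁ t - φ₂ t ≠ 0) :
    ∃ s ∈ Set.Icc (0:ℝ) 1, ∃ c ∈ Set.Icc (0:ℝ) 1,
      (∀ x ∈ Set.uIcc t s, 0 < (φ₁ t - φ₂ t) * (φ₁ x - φ₂ x)) ∧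
      φ₁ s + ψ₁ c = c * s ∧ φ₂ s + ψ₂ c = c * s := by
  rcases lt_or_gt_of_ne hne with h | h
  · obtain ⟨s, hs, c, hc, h3, h4, h5⟩ := peak_pos h₂ h₁ e0.symm e1.symm ht (by linarith)
    exact ⟨s, hs, c, hc, fun x hx => mul_pos_of_neg_of_neg h (by linarith [h3 x hx]), h5, h4⟩
  · obtain ⟨s, hs, c, hc, h3, h4, h5⟩ := peak_pos h₁ h₂ e0 e1 ht h
    exact ⟨s, hs, c, hc, fun x hx => mul_pos h (h3 x hx), h4, h5⟩

theorem ne_of_sc {f : ℝ → ℝ} {m : ℕ} {t : Fin (m + 1 + 1) → ℝ}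
    (h : ∀ i : Fin (m + 1), f (t i.castSucc) * f (t i.succ) < 0) (i : Fin (m + 1 + 1)) :
    f (t i) ≠ 0 := by
  intro h0
  rcases Fin.eq_castSucc_or_eq_last i with ⟨j, rfl⟩ | rfl
  · have := h j; rw [h0] at this; simp at this
  · have := h (Fin.last m); rw [Fin.succ_last, h0] at this; simp at this

theorem sc_transfer {φ₁ φ₂ ψ₁ ψ₂ : ℝ → ℝ} (h₁ : YPair φ₁ ψ₁) (h₂ : YPair φ₂ ψ₂)
    (e0 : φ₁ 0 = φ₂ 0) (e1 : φ₁ 1 = φ₂ 1) (m : ℕ)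
    (h : SignChangesAtLeast (fun x => φ₁ x - φ₂ x) (Set.Icc 0 1) m) :
    SignChangesAtLeast (fun x => ψ₁ x - ψ₂ x) (Set.Icc 0 1) m := by
  cases m with
  | zero => exact ⟨fun _ => 0, fun i j h => absurd h (by omega), by simp, fun i => i.elim0⟩
  | succ m =>
    obtain ⟨t, tm, tI, tp⟩ := h
    have tne : ∀ i, φ₁ (t i) - φ₂ (t i) ≠ 0 := ne_of_sc (f := fun x => φ₁ x - φ₂ x) tp
    choose s hs c hc h3 h4 h5 using fun i => peak h₁ h₂ e0 e1 (tI i) (tne i)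
    have hprod : ∀ i : Fin (m + 1),
        (ψ₁ (c i.castSucc) - ψ₂ (c i.castSucc)) * (ψ₁ (c i.succ) - ψ₂ (c i.succ)) < 0 := by
      intro i
      have a1 := h3 i.castSucc (s i.castSucc) Set.right_mem_uIcc
      have a2 := h3 i.succ (s i.succ) Set.right_mem_uIcc
      have a3 := tp i
      have b1 : ψ₁ (c i.castSucc) - ψ₂ (c i.castSucc)
          = -(φ₁ (s i.castSucc) - φ₂ (s i.castSucc)) := by linarith [h4 i.castSucc, h5 i.castSucc]
      have b2 : ψ₁ (c i.succ) - ψ₂ (c i.succ)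
          = -(φ₁ (s i.succ) - φ₂ (s i.succ)) := by linarith [h4 i.succ, h5 i.succ]
      rw [b1, b2, neg_mul_neg]
      have a4 := mul_pos a1 a2
      by_contra hcon
      rw [not_lt] at hcon
      have := mul_nonpos_of_nonpos_of_nonneg a3.le hcon
      simp only at this
      nlinarith
    refine ⟨c, Fin.strictMono_iff_lt_succ.2 fun i => ?_, hc, hprod⟩
    have hss : s i.castSucc < s i.succ := by
      have htt : t i.castSucc < t i.succ := tm (Fin.castSucc_lt_succ)
      by_contra hcon
      rw [not_lt] at hcon
      obtain ⟨x, hx1, hx2⟩ : ∃ x, x ∈ Set.uIcc (t i.castSucc) (s i.castSucc) ∧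
          x ∈ Set.uIcc (t i.succ) (s i.succ) := by
        simp only [Set.mem_uIcc]
        rcases le_total (s i.castSucc) (t i.castSucc) with q | q
        · exact ⟨t i.castSucc, Or.inr ⟨q, le_rfl⟩, Or.inr ⟨by linarith, htt.le⟩⟩
        · rcases le_total (s i.castSucc) (t i.succ) with q' | q'
          · exact ⟨s i.castSucc, Or.inl ⟨q, le_rfl⟩, Or.inr ⟨hcon, q'⟩⟩
          · exact ⟨t i.succ, Or.inl ⟨htt.le, q'⟩, by rcases le_total (t i.succ) (s i.succ) with w | w <;> simp [w]⟩
      have a1 := h3 _ x hx1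
      have a2 := h3 _ x hx2
      have a3 := tp i
      simp only at a3
      rcases lt_trichotomy (φ₁ x - φ₂ x) 0 with w | w | w
      · have z1 := neg_of_mul_pos_left a1 w.le
        have z2 := neg_of_mul_pos_left a2 w.le
        nlinarith
      · rw [w] at a1; simp at a1
      · have z1 := pos_of_mul_pos_left a1 w.le
        have z2 := pos_of_mul_pos_left a2 w.le
        nlinarith
    have y1 := h₁.young _ (hs i.succ) _ (hc i.castSucc)
    have y2 := h₁.young _ (hs i.castSucc) _ (hc i.succ)
    have e3 := h4 i.castSucc
    have e4 := h4 i.succ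
    apply lt_of_le_of_ne
    · by_contra hcon
      rw [not_le] at hcon
      nlinarith
    · intro heq
      have := hprod i
      rw [heq] at this
      nlinarith [mul_self_nonneg (ψ₁ (c i.succ) - ψ₂ (c i.succ))]

theorem sc_Ioo_iff {f : ℝ → ℝ} (h0 : f 0 = 0) (h1 : f 1 = 0) (m : ℕ) :
    SignChangesAtLeast f (Set.Ioo 0 1) m ↔ SignChangesAtLeast f (Set.Icc 0 1) m := by
  constructor
  · rintro ⟨t, a, b, c⟩
    exact ⟨t, a, fun i => Set.Ioo_subset_Icc_self (b i), c⟩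
  · cases m with
    | zero =>
      intro _
      exact ⟨fun _ => 1/2, fun i j h => absurd h (by omega), by intro; norm_num, fun i => i.elim0⟩
    | succ m =>
      rintro ⟨t, a, b, c⟩
      refine ⟨t, a, fun i => ?_, c⟩
      have hne := ne_of_sc c i
      refine ⟨lt_of_le_of_ne (b i).1 ?_, lt_of_le_of_ne (b i).2 ?_⟩
      · intro h; rw [← h] at hne; exact hne h0
      · intro h; rw [h] at hne; exact hne h1

theorem sc_congr {f g : ℝ → ℝ} {s : Set ℝ} (h : ∀ x ∈ s, ∀ y ∈ s, f x * f y = g x * g y) (m : ℕ) :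
    SignChangesAtLeast f s m ↔ SignChangesAtLeast g s m := by
  constructor
  · rintro ⟨t, a, b, c⟩
    exact ⟨t, a, b, fun i => by rw [← h _ (b _) _ (b _)]; exact c i⟩
  · rintro ⟨t, a, b, c⟩
    exact ⟨t, a, b, fun i => by rw [h _ (b _) _ (b _)]; exact c i⟩

section
variable {Ω : Type*} [MeasurableSpace Ω] {μ : Measure Ω} [IsProbabilityMeasure μ]

/-- Galois property of the quantile function. -/
theorem quant_galois {X : Ω → ℝ} (hX : Measurable X) (hXr : ∀ ω, X ω ∈ Set.Icc (0:ℝ) 1)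
    {F Q : ℝ → ℝ} (hF : ∀ t, F t = (μ {ω | X ω ≤ t}).toReal)
    (hQ : ∀ α ∈ Set.Ioc (0:ℝ) 1, Q α = sInf {x | x ∈ Set.Icc (0:ℝ) 1 ∧ α ≤ F x}) :
    (∀ α ∈ Set.Ioc (0:ℝ) 1, Q α ∈ Set.Icc (0:ℝ) 1) ∧
    ∀ α ∈ Set.Ioc (0:ℝ) 1, ∀ t, Q α ≤ t ↔ α ≤ F t := by
  have : IsProbabilityMeasure (μ.map X) := Measure.isProbabilityMeasure_map hX.aemeasurable
  have hFc : F = ProbabilityTheory.cdf (μ.map X) := by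
    ext t
    rw [hF, ProbabilityTheory.cdf_eq_real, measureReal_def, Measure.map_apply hX measurableSet_Iic]
    rfl
  have hmono : Monotone F := by rw [hFc]; exact ProbabilityTheory.monotone_cdf _
  have hF1 : F 1 = 1 := by
    rw [hF]
    have : {ω | X ω ≤ 1} = Set.univ := by ext ω; simp [(hXr ω).2]
    simp [this]
  have hFneg : ∀ t < 0, F t = 0 := by
    intro t ht
    rw [hF]
    have : {ω | X ω ≤ t} = ∅ := by
      ext ω
      simp only [Set.mem_ofPred_eq, Set.mem_empty_iff_false, iff_false, not_le]
      exact ht.trans_le (hXr ω).1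
    simp [this]
  have hbdd : ∀ α, BddBelow {x | x ∈ Set.Icc (0:ℝ) 1 ∧ α ≤ F x} := fun α => ⟨0, fun x hx => hx.1.1⟩
  have hne : ∀ α ∈ Set.Ioc (0:ℝ) 1, (1:ℝ) ∈ {x | x ∈ Set.Icc (0:ℝ) 1 ∧ α ≤ F x} := by
    intro α hα
    exact ⟨by simp, by rw [hF1]; exact hα.2⟩
  have hQI : ∀ α ∈ Set.Ioc (0:ℝ) 1, Q α ∈ Set.Icc (0:ℝ) 1 := by
    intro α hα
    rw [hQ α hα]
    exact ⟨le_csInf ⟨1, hne α hα⟩ fun x hx => hx.1.1, csInf_le (hbdd α) (hne α hα)⟩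
  refine ⟨hQI, fun α hα t => ⟨fun h => ?_, fun h => ?_⟩⟩
  · refine le_trans ?_ (hmono h)
    have hrc : ContinuousWithinAt F (Set.Ioi (Q α)) (Q α) := by
      rw [hFc]
      exact ((ProbabilityTheory.cdf (μ.map X)).right_continuous _).mono Set.Ioi_subset_Ici_self
    refine ge_of_tendsto hrc ?_
    filter_upwards [self_mem_nhdsWithin] with x hx
    rw [Set.mem_Ioi, hQ α hα] at hx
    obtain ⟨y, hy, hyx⟩ := exists_lt_of_csInf_lt ⟨1, hne α hα⟩ hx
    exact hy.2.trans (hmono hyx.le)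
  · have ht0 : 0 ≤ t := by
      by_contra hc
      rw [hFneg t (not_le.1 hc)] at h
      linarith [hα.1]
    rcases le_total t 1 with h1 | h1
    · rw [hQ α hα]
      exact csInf_le (hbdd α) ⟨⟨ht0, h1⟩, h⟩
    · exact (hQI α hα).2.trans h1

theorem quant_mono {F Q : ℝ → ℝ} 
    (hg : ∀ α ∈ Set.Ioc (0:ℝ) 1, ∀ t, Q α ≤ t ↔ α ≤ F t) : MonotoneOn Q (Set.Ioc 0 1) := by
  intro a ha b hb hab
  rw [hg a ha]
  exact hab.trans ((hg b hb _).1 le_rfl)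

theorem quant_map {X : Ω → ℝ} (hX : Measurable X) 
    {F Q : ℝ → ℝ} (hF : ∀ t, F t = (μ {ω | X ω ≤ t}).toReal)
    (hg : ∀ α ∈ Set.Ioc (0:ℝ) 1, ∀ t, Q α ≤ t ↔ α ≤ F t) :
    (volume.restrict (Set.Ioc (0:ℝ) 1)).map Q = μ.map X := by
  have hm : AEMeasurable Q (volume.restrict (Set.Ioc (0:ℝ) 1)) :=
    aemeasurable_restrict_of_monotoneOn measurableSet_Ioc (quant_mono hg)
  have : IsProbabilityMeasure (μ.map X) := Measure.isProbabilityMeasure_map hX.aemeasurable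
  have : IsFiniteMeasure ((volume.restrict (Set.Ioc (0:ℝ) 1)).map Q) := inferInstance
  apply Measure.ext_of_Iic
  intro t
  rw [Measure.map_apply_of_aemeasurable hm measurableSet_Iic, Measure.map_apply hX measurableSet_Iic,
    Measure.restrict_apply' measurableSet_Ioc]
  have hF1 : F t ≤ 1 := by
    rw [hF, ← measureReal_def]; exact measureReal_le_one
  have : Q ⁻¹' Set.Iic t ∩ Set.Ioc 0 1 = Set.Ioc 0 (F t) := by
    ext α
    simp only [Set.mem_inter_iff, Set.mem_preimage, Set.mem_Iic, Set.mem_Ioc]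
    constructor
    · rintro ⟨h1, h2⟩
      exact ⟨h2.1, (hg α h2 t).1 h1⟩
    · rintro ⟨h1, h2⟩
      exact ⟨(hg α ⟨h1, h2.trans hF1⟩ t).2 h2, h1, h2.trans hF1⟩
  rw [this, Real.volume_Ioc, sub_zero, hF, ENNReal.ofReal_toReal (measure_ne_top _ _)]
  rfl

theorem quant_int {X : Ω → ℝ} (hX : Measurable X)
    {F Q : ℝ → ℝ} (hF : ∀ t, F t = (μ {ω | X ω ≤ t}).toReal)
    (hg : ∀ α ∈ Set.Ioc (0:ℝ) 1, ∀ t, Q α ≤ t ↔ α ≤ F t) {g : ℝ → ℝ} (hgm : Measurable g) :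
    ∫ ω, g (X ω) ∂μ = ∫ α in Set.Ioc (0:ℝ) 1, g (Q α) := by
  have hm : AEMeasurable Q (volume.restrict (Set.Ioc (0:ℝ) 1)) :=
    aemeasurable_restrict_of_monotoneOn measurableSet_Ioc (quant_mono hg)
  rw [← integral_map hX.aemeasurable hgm.aestronglyMeasurable, ← quant_map hX hF hg,
    integral_map hm hgm.aestronglyMeasurable]

theorem quant_integrable {F Q : ℝ → ℝ} (hI : ∀ α ∈ Set.Ioc (0:ℝ) 1, Q α ∈ Set.Icc (0:ℝ) 1)
    (hg : ∀ α ∈ Set.Ioc (0:ℝ) 1, ∀ t, Q α ≤ t ↔ α ≤ F t) :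
    IntegrableOn Q (Set.Ioc 0 1) := by
  have hm : AEMeasurable Q (volume.restrict (Set.Ioc (0:ℝ) 1)) :=
    aemeasurable_restrict_of_monotoneOn measurableSet_Ioc (quant_mono hg)
  refine Integrable.of_bound hm.aestronglyMeasurable 1 ?_
  filter_upwards [ae_restrict_mem measurableSet_Ioc] with α hα
  rw [Real.norm_eq_abs, abs_of_nonneg (hI α hα).1]
  exact (hI α hα).2

theorem quant_ypair {X : Ω → ℝ} (hX : Measurable X) (hXr : ∀ ω, X ω ∈ Set.Icc (0:ℝ) 1)
    {F Q : ℝ → ℝ} (hF : ∀ t, F t = (μ {ω | X ω ≤ t}).toReal)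
    (hQ : ∀ α ∈ Set.Ioc (0:ℝ) 1, Q α = sInf {x | x ∈ Set.Icc (0:ℝ) 1 ∧ α ≤ F x}) :
    YPair (fun t => ∫ ω, max (t - X ω) 0 ∂μ) (fun c => ∫ α in Set.Ioc (0:ℝ) c, Q α) := by
  obtain ⟨hI, hg⟩ := quant_galois hX hXr hF hQ
  have hmono := quant_mono hg
  have hint := quant_integrable hI hg
  have hF01 : ∀ t, F t ∈ Set.Icc (0:ℝ) 1 := fun t => by
    rw [hF, ← measureReal_def]; exact ⟨measureReal_nonneg, measureReal_le_one⟩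
  have hsub : ∀ c ∈ Set.Icc (0:ℝ) 1, Set.Ioc 0 c ⊆ Set.Ioc (0:ℝ) 1 :=
    fun c hc => Set.Ioc_subset_Ioc_right hc.2
  have hphi : ∀ t, ∫ ω, max (t - X ω) 0 ∂μ = ∫ α in Set.Ioc (0:ℝ) 1, max (t - Q α) 0 := fun t =>
    quant_int hX hF hg (g := fun x => max (t - x) 0) (by fun_prop)
  have hint1 : ∀ t, IntegrableOn (fun α => t - Q α) (Set.Ioc 0 1) := fun t =>
    (integrable_const t).sub hint
  have hint2 : ∀ t, IntegrableOn (fun α => max (t - Q α) 0) (Set.Ioc 0 1) := fun t =>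
    (hint1 t).pos_part
  -- splitting
  have hsplit : ∀ t, ∀ c ∈ Set.Icc (0:ℝ) 1, ∫ α in Set.Ioc (0:ℝ) 1, max (t - Q α) 0 =
      (∫ α in Set.Ioc (0:ℝ) c, max (t - Q α) 0) + ∫ α in Set.Ioc c 1, max (t - Q α) 0 := by
    intro t c hc
    rw [← setIntegral_union (Set.Ioc_disjoint_Ioc_of_le le_rfl) measurableSet_Ioc
      ((hint2 t).mono_set (hsub c hc)) ((hint2 t).mono_set (Set.Ioc_subset_Ioc_left hc.1)),
      Set.Ioc_union_Ioc_eq_Ioc hc.1 hc.2]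
  have hlin : ∀ t, ∀ c ∈ Set.Icc (0:ℝ) 1, ∫ α in Set.Ioc (0:ℝ) c, (t - Q α) =
      c * t - ∫ α in Set.Ioc (0:ℝ) c, Q α := by
    intro t c hc
    rw [integral_sub (integrable_const t) (hint.mono_set (hsub c hc))]
    simp [hc.1]
  have heq : ∀ t, ∀ c ∈ Set.Icc (0:ℝ) 1, (∀ α ∈ Set.Ioc 0 c, Q α ≤ t) →
      (∀ α ∈ Set.Ioc c 1, t ≤ Q α) →
      (∫ ω, max (t - X ω) 0 ∂μ) + (∫ α in Set.Ioc (0:ℝ) c, Q α) = c * t := by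
    intro t c hc h1 h2
    rw [hphi, hsplit t c hc]
    have a1 : ∫ α in Set.Ioc (0:ℝ) c, max (t - Q α) 0 = ∫ α in Set.Ioc (0:ℝ) c, (t - Q α) :=
      setIntegral_congr_fun measurableSet_Ioc fun α hα => max_eq_left (by linarith [h1 α hα])
    have a2 : ∫ α in Set.Ioc c 1, max (t - Q α) 0 = ∫ α in Set.Ioc c 1, (0:ℝ) :=
      setIntegral_congr_fun measurableSet_Ioc fun α hα => max_eq_right (by linarith [h2 α hα])
    rw [a1, a2, hlin t c hc]
    simp
  refine ⟨fun t ht c hc => ?_, fun t ht => ?_, fun c hc => ?_⟩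
  · have a1 : ∫ α in Set.Ioc (0:ℝ) c, (t - Q α) ≤ ∫ α in Set.Ioc (0:ℝ) c, max (t - Q α) 0 :=
      setIntegral_mono ((hint1 t).mono_set (hsub c hc)) ((hint2 t).mono_set (hsub c hc))
        fun α => le_max_left _ _
    have a2 : 0 ≤ ∫ α in Set.Ioc c 1, max (t - Q α) 0 :=
      integral_nonneg fun α => le_max_right _ _
    rw [hlin t c hc] at a1
    rw [hphi, hsplit t c hc]
    linarith
  · refine ⟨F t, hF01 t, heq t _ (hF01 t) (fun α hα => ?_) fun α hα => ?_⟩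
    · exact (hg α (hsub _ (hF01 t) hα) t).2 hα.2
    · by_contra hc
      exact absurd ((hg α ⟨(hF01 t).1.trans_lt hα.1, hα.2⟩ t).1 (not_le.1 hc).le) (not_le.2 hα.1)
  · rcases eq_or_lt_of_le hc.1 with h0 | h0
    · refine ⟨0, by simp, heq 0 c hc (fun α hα => ?_) fun α hα => ?_⟩
      · rw [← h0] at hα; simp at hα
      · exact (hI α ⟨h0 ▸ hα.1, hα.2⟩).1
    · refine ⟨Q c, hI c ⟨h0, hc.2⟩, heq _ c hc (fun α hα => ?_) fun α hα => ?_⟩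
      · exact hmono (hsub c hc hα) ⟨h0, hc.2⟩ hα.2
      · exact hmono ⟨h0, hc.2⟩ ⟨h0.trans hα.1, hα.2⟩ hα.1.le

theorem calib_set {X Y : Ω → ℝ} (hX : Measurable X) (hYi : Integrable Y μ)
    (hcal : μ[Y | MeasurableSpace.comap X inferInstance] =ᵐ[μ] X) {s : Set ℝ} (hs : MeasurableSet s) :
    ∫ ω in X ⁻¹' s, Y ω ∂μ = ∫ ω in X ⁻¹' s, X ω ∂μ := by
  have hm : MeasurableSpace.comap X inferInstance ≤ ‹MeasurableSpace Ω› := hX.comap_le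
  rw [← setIntegral_condExp hm hYi ⟨s, hs, rfl⟩]
  exact setIntegral_congr_ae (hX hs) (hcal.mono fun ω h _ => h)

theorem murphy_eq {X Y : Ω → ℝ} (hX : Measurable X) (hY : Measurable Y)
    (hXr : ∀ ω, X ω ∈ Set.Icc (0:ℝ) 1) (hYr : ∀ ω, Y ω = 0 ∨ Y ω = 1)
    (hcal : μ[Y | MeasurableSpace.comap X inferInstance] =ᵐ[μ] X) (θ : ℝ) :
    (∫ ω, elemScore θ (X ω) (Y ω) ∂μ)
      = 2 * (θ - θ * (∫ ω, Y ω ∂μ) - ∫ ω, max (θ - X ω) 0 ∂μ) := by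
  have hXi : Integrable X μ := Integrable.of_bound hX.aestronglyMeasurable 1 (.of_forall fun ω => by
    rw [Real.norm_eq_abs, abs_of_nonneg (hXr ω).1]; exact (hXr ω).2)
  have hYi : Integrable Y μ := Integrable.of_bound hY.aestronglyMeasurable 1 (.of_forall fun ω => by
    rcases hYr ω with h | h <;> simp [h])
  have hmi : Integrable (fun ω => max (θ - X ω) 0) μ := ((integrable_const θ).sub hXi).pos_part
  have hA : MeasurableSet (X ⁻¹' Set.Iio θ) := hX measurableSet_Iio
  have hB : MeasurableSet (X ⁻¹' Set.Ioi θ) := hX measurableSet_Ioi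
  have hEX : ∫ ω, Y ω ∂μ = ∫ ω, X ω ∂μ := by
    simpa using calib_set hX hYi hcal MeasurableSet.univ
  have e1 := calib_set hX hYi hcal (measurableSet_Iio (a := θ))
  have e2 := calib_set hX hYi hcal (measurableSet_Ioi (a := θ))
  rw [← integral_indicator hA, ← integral_indicator hA] at e1
  rw [← integral_indicator hB, ← integral_indicator hB] at e2
  have hpt : ∀ ω, elemScore θ (X ω) (Y ω) =
      2 * (θ - θ * X ω - max (θ - X ω) 0)
      + (2 * (1 - θ) * ((X ⁻¹' Set.Iio θ).indicator Y ω - (X ⁻¹' Set.Iio θ).indicator X ω)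
        - 2 * θ * ((X ⁻¹' Set.Ioi θ).indicator Y ω - (X ⁻¹' Set.Ioi θ).indicator X ω)) := by
    intro ω
    unfold elemScore
    simp only [Set.indicator, Set.mem_preimage, Set.mem_Iio, Set.mem_Ioi]
    rcases lt_trichotomy (X ω) θ with h | h | h
    · rw [max_eq_left (by linarith)]
      rcases hYr ω with hy | hy <;> simp [h, hy, h.not_gt, h.ne] <;> ring
    · rw [max_eq_right (by linarith)]
      rcases hYr ω with hy | hy <;> simp [h, hy] <;> ring
    · rw [max_eq_right (by linarith)]
      rcases hYr ω with hy | hy <;> simp [h, hy, h.not_gt, h.ne'] <;> ring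
  simp_rw [hpt]
  have i1 := hYi.indicator hA
  have i2 := hXi.indicator hA
  have i3 := hYi.indicator hB
  have i4 := hXi.indicator hB
  rw [integral_add, integral_sub, integral_const_mul, integral_const_mul, integral_const_mul,
    integral_sub i1 i2, integral_sub i3 i4, e1, e2, integral_sub _ hmi,
    integral_sub (integrable_const _) (hXi.const_mul θ), integral_const_mul, hEX]
  · simp
  · exact (integrable_const _).sub (hXi.const_mul θ)
  · exact (i1.sub i2).const_mul _
  · exact (i3.sub i4).const_mul _
  · exact (((integrable_const _).sub (hXi.const_mul θ)).sub hmi).const_mul _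
  · exact ((i1.sub i2).const_mul _).sub ((i3.sub i4).const_mul _)
end

/-- If `X₁` and `X₂` are calibrated probability forecasts of the binary outcome `Y`
with `0 < ℙ(Y=0) < 1`, and the difference `F₁ − F₂` of the CDFs has exactly `n ≥ 1`
sign changes on `[0,1]`, then the Murphy curve difference
`D^MC(θ) = (1/2)(E[S_θ(X₁,Y)] − E[S_θ(X₂,Y)])` on `(0,1)` and the ROC curve difference
`D^ROC(c) = ∫₀^c (Q₁(α) − Q₂(α)) dα` on `[0,1]` have the same number of sign changes. -/
theorem murphy_roc_same_number_of_sign_changes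
    {Ω : Type*} [MeasurableSpace Ω] (μ : Measure Ω) [IsProbabilityMeasure μ]
    (X₁ X₂ Y : Ω → ℝ) (hX₁ : Measurable X₁) (hX₂ : Measurable X₂) (hY : Measurable Y)
    (hX₁r : ∀ ω, X₁ ω ∈ Set.Icc (0:ℝ) 1) (hX₂r : ∀ ω, X₂ ω ∈ Set.Icc (0:ℝ) 1)
    (hYr : ∀ ω, Y ω = 0 ∨ Y ω = 1)
    (hY0 : 0 < μ {ω | Y ω = 0}) (hY0' : μ {ω | Y ω = 0} < 1)
    (hcal₁ : μ[Y | MeasurableSpace.comap X₁ inferInstance] =ᵐ[μ] X₁)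
    (hcal₂ : μ[Y | MeasurableSpace.comap X₂ inferInstance] =ᵐ[μ] X₂)
    (F₁ F₂ : ℝ → ℝ)
    (hF₁ : ∀ t, F₁ t = (μ {ω | X₁ ω ≤ t}).toReal)
    (hF₂ : ∀ t, F₂ t = (μ {ω | X₂ ω ≤ t}).toReal)
    (Q₁ Q₂ : ℝ → ℝ)
    (hQ₁ : ∀ α ∈ Set.Ioc (0:ℝ) 1, Q₁ α = sInf {x | x ∈ Set.Icc (0:ℝ) 1 ∧ α ≤ F₁ x})
    (hQ₂ : ∀ α ∈ Set.Ioc (0:ℝ) 1, Q₂ α = sInf {x | x ∈ Set.Icc (0:ℝ) 1 ∧ α ≤ F₂ x})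
    (n : ℕ) (hn : 1 ≤ n)
    (hsign : SignChangesExactly (fun x => F₁ x - F₂ x) (Set.Icc 0 1) n) :
    ∀ m : ℕ,
      SignChangesExactly
        (fun θ => (1 / 2) * ((∫ ω, elemScore θ (X₁ ω) (Y ω) ∂μ)
            - ∫ ω, elemScore θ (X₂ ω) (Y ω) ∂μ)) (Set.Ioo 0 1) m
      ↔ SignChangesExactly
          (fun c => ∫ α in Set.Ioc (0:ℝ) c, (Q₁ α - Q₂ α)) (Set.Icc 0 1) m := by
  have hYi : Integrable Y μ := Integrable.of_bound hY.aestronglyMeasurable 1 (.of_forall fun ω => by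
    rcases hYr ω with h | h <;> simp [h])
  have hi : ∀ {X : Ω → ℝ}, Measurable X → (∀ ω, X ω ∈ Set.Icc (0:ℝ) 1) → Integrable X μ :=
    fun {X} hX hXr => Integrable.of_bound hX.aestronglyMeasurable 1 (.of_forall fun ω => by
      rw [Real.norm_eq_abs, abs_of_nonneg (hXr ω).1]; exact (hXr ω).2)
  have hEX : ∀ {X : Ω → ℝ}, Measurable X →
      (μ[Y | MeasurableSpace.comap X inferInstance] =ᵐ[μ] X) → ∫ ω, X ω ∂μ = ∫ ω, Y ω ∂μ :=
    fun {X} hX hcal => by simpa using (calib_set hX hYi hcal MeasurableSet.univ).symm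
  have p₁ := quant_ypair hX₁ hX₁r hF₁ hQ₁
  have p₂ := quant_ypair hX₂ hX₂r hF₂ hQ₂
  have hzero : ∀ {X : Ω → ℝ}, (∀ ω, X ω ∈ Set.Icc (0:ℝ) 1) → ∫ ω, max (0 - X ω) 0 ∂μ = 0 := by
    intro X hXr
    exact integral_eq_zero_of_ae (.of_forall fun ω => max_eq_right (by linarith [(hXr ω).1]))
  have hone : ∀ {X : Ω → ℝ}, Measurable X → (∀ ω, X ω ∈ Set.Icc (0:ℝ) 1) →
      (μ[Y | MeasurableSpace.comap X inferInstance] =ᵐ[μ] X) →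
      ∫ ω, max (1 - X ω) 0 ∂μ = 1 - ∫ ω, Y ω ∂μ := by
    intro X hX hXr hcal
    have : (fun ω => max (1 - X ω) 0) = fun ω => 1 - X ω := by
      ext ω
      exact max_eq_left (by linarith [(hXr ω).2])
    rw [this, integral_sub (integrable_const _) (hi hX hXr), hEX hX hcal]
    simp
  obtain ⟨hI₁, hg₁⟩ := quant_galois hX₁ hX₁r hF₁ hQ₁
  obtain ⟨hI₂, hg₂⟩ := quant_galois hX₂ hX₂r hF₂ hQ₂
  have hint₁ := quant_integrable hI₁ hg₁
  have hint₂ := quant_integrable hI₂ hg₂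
  have e0 : (fun t => ∫ ω, max (t - X₁ ω) 0 ∂μ) 0 = (fun t => ∫ ω, max (t - X₂ ω) 0 ∂μ) 0 := by
    simp only [hzero hX₁r, hzero hX₂r]
  have e1 : (fun t => ∫ ω, max (t - X₁ ω) 0 ∂μ) 1 = (fun t => ∫ ω, max (t - X₂ ω) 0 ∂μ) 1 := by
    simp only [hone hX₁ hX₁r hcal₁, hone hX₂ hX₂r hcal₂]
  have f0 : (fun c => ∫ α in Set.Ioc (0:ℝ) c, Q₁ α) 0 = (fun c => ∫ α in Set.Ioc (0:ℝ) c, Q₂ α) 0 := by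
    simp
  have f1 : (fun c => ∫ α in Set.Ioc (0:ℝ) c, Q₁ α) 1 = (fun c => ∫ α in Set.Ioc (0:ℝ) c, Q₂ α) 1 := by
    have a1 := quant_int hX₁ hF₁ hg₁ measurable_id
    have a2 := quant_int hX₂ hF₂ hg₂ measurable_id
    simp only [id] at a1 a2
    simp only
    rw [← a1, ← a2, hEX hX₁ hcal₁, hEX hX₂ hcal₂]
  have key : ∀ m, SignChangesAtLeast
        (fun θ => (1 / 2) * ((∫ ω, elemScore θ (X₁ ω) (Y ω) ∂μ)
            - ∫ ω, elemScore θ (X₂ ω) (Y ω) ∂μ)) (Set.Ioo 0 1) m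
      ↔ SignChangesAtLeast
          (fun c => ∫ α in Set.Ioc (0:ℝ) c, (Q₁ α - Q₂ α)) (Set.Icc 0 1) m := by
    intro m
    have k1 := sc_congr (s := Set.Ioo 0 1) (f := fun θ => (1 / 2) * ((∫ ω, elemScore θ (X₁ ω) (Y ω) ∂μ)
            - ∫ ω, elemScore θ (X₂ ω) (Y ω) ∂μ))
        (g := fun t => (fun t => ∫ ω, max (t - X₁ ω) 0 ∂μ) t - (fun t => ∫ ω, max (t - X₂ ω) 0 ∂μ) t)
        (by
          intro x _ y _
          simp only [murphy_eq hX₁ hY hX₁r hYr hcal₁, murphy_eq hX₂ hY hX₂r hYr hcal₂]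
          ring) m
    have k2 := sc_congr (s := Set.Icc 0 1) (f := fun c => ∫ α in Set.Ioc (0:ℝ) c, (Q₁ α - Q₂ α))
        (g := fun c => (fun c => ∫ α in Set.Ioc (0:ℝ) c, Q₁ α) c - (fun c => ∫ α in Set.Ioc (0:ℝ) c, Q₂ α) c)
        (by
          have : ∀ c ∈ Set.Icc (0:ℝ) 1, ∫ α in Set.Ioc (0:ℝ) c, (Q₁ α - Q₂ α) =
              (∫ α in Set.Ioc (0:ℝ) c, Q₁ α) - ∫ α in Set.Ioc (0:ℝ) c, Q₂ α := fun c hc =>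
            integral_sub (hint₁.mono_set (Set.Ioc_subset_Ioc_right hc.2))
              (hint₂.mono_set (Set.Ioc_subset_Ioc_right hc.2))
          intro x hx y hy
          simp only [this x hx, this y hy]) m
    rw [k1, k2, sc_Ioo_iff (f := fun t => (fun t => ∫ ω, max (t - X₁ ω) 0 ∂μ) t -
      (fun t => ∫ ω, max (t - X₂ ω) 0 ∂μ) t) (sub_eq_zero.2 e0) (sub_eq_zero.2 e1)]
    exact ⟨sc_transfer p₁ p₂ e0 e1 m, sc_transfer p₁.symm p₂.symm f0 f1 m⟩
  intro m
  unfold SignChangesExactly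
  rw [key, key]
end

section
/- Let F₁ and F₂ be the cumulative distribution functions of two probability measures on [0,1], and let Q₁ and Q₂ be their left-continuous generalized inverses. If F₁ − F₂ has exactly n sign changes on [0,1], where n ≥ 1 is finite, then Q₁ − Q₂ has exactly n sign changes on (0,1]. -/
open MeasureTheory

theorem signChanges_transfer (f g φ : ℝ → ℝ) (s u : Set ℝ)
    (hφ : ∀ x ∈ s, ∀ y ∈ s, x ≤ y → φ x ≤ φ y)
    (hneg : ∀ x ∈ s, f x < 0 → φ x ∈ u ∧ 0 < g (φ x))
    (hpos : ∀ x ∈ s, 0 < f x → φ x ∈ u ∧ g (φ x) < 0)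
    (n : ℕ) (hn : 1 ≤ n) (h : SignChangesAtLeast f s n) : SignChangesAtLeast g u n := by
  obtain ⟨t, ht, hts, hs⟩ := h
  have hne : ∀ i, f (t i) ≠ 0 := by
    intro i hi
    rcases Fin.eq_zero_or_eq_succ i with rfl | ⟨j, rfl⟩
    · have := hs ⟨0, hn⟩
      have h0 : (Fin.castSucc (⟨0, hn⟩ : Fin n)) = 0 := rfl
      rw [h0, hi] at this
      simp at this
    · have := hs j
      rw [hi] at this
      simp at this
  have hprod : ∀ i : Fin n, g (φ (t i.castSucc)) * g (φ (t i.succ)) < 0 := by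
    intro i
    rcases mul_neg_iff.1 (hs i) with ⟨a, b⟩ | ⟨a, b⟩
    · exact mul_neg_of_neg_of_pos (hpos _ (hts _) a).2 (hneg _ (hts _) b).2
    · exact mul_neg_of_pos_of_neg (hneg _ (hts _) a).2 (hpos _ (hts _) b).2
  refine ⟨fun i => φ (t i), ?_, ?_, hprod⟩
  · rw [Fin.strictMono_iff_lt_succ]
    intro i
    refine lt_of_le_of_ne (hφ _ (hts _) _ (hts _) (ht.monotone (Fin.castSucc_lt_succ).le)) ?_
    intro he
    have := hprod i
    rw [he] at this
    exact absurd this (not_lt.2 (mul_self_nonneg _))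
  · intro i
    rcases lt_or_gt_of_ne (hne i) with a | a
    · exact (hneg _ (hts _) a).1
    · exact (hpos _ (hts _) a).1

theorem quantile_basic (μ : Measure ℝ) [IsProbabilityMeasure μ]
    (hμ : μ (Set.Icc (0:ℝ) 1) = 1) (F Q : ℝ → ℝ)
    (hF : ∀ t, F t = (μ (Set.Iic t)).toReal)
    (hQ : ∀ α ∈ Set.Ioc (0:ℝ) 1, Q α = sInf {x | x ∈ Set.Icc (0:ℝ) 1 ∧ α ≤ F x}) :
    Monotone F ∧ (∀ x, 0 ≤ F x) ∧ (∀ x, F x ≤ 1) ∧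
    (∀ α ∈ Set.Ioc (0:ℝ) 1, Q α ∈ Set.Icc (0:ℝ) 1) ∧
    (∀ α ∈ Set.Ioc (0:ℝ) 1, ∀ x ∈ Set.Icc (0:ℝ) 1, α ≤ F x ↔ Q α ≤ x) := by
  have hFc : F = ProbabilityTheory.cdf μ := by
    funext t
    rw [hF, ProbabilityTheory.cdf_eq_real]
    rfl
  have hmono : Monotone F := hFc ▸ ProbabilityTheory.monotone_cdf μ
  have h1 : ∀ x, F x ≤ 1 := fun x => hFc ▸ ProbabilityTheory.cdf_le_one μ x
  have h11 : F 1 = 1 := by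
    have : μ (Set.Iic 1) = 1 :=
      le_antisymm prob_le_one (hμ ▸ measure_mono (fun x hx => hx.2))
    rw [hF, this]; rfl
  have hbdd : ∀ α, BddBelow {x | x ∈ Set.Icc (0:ℝ) 1 ∧ α ≤ F x} :=
    fun α => ⟨0, fun x hx => hx.1.1⟩
  have hone : ∀ α ∈ Set.Ioc (0:ℝ) 1, (1:ℝ) ∈ {x | x ∈ Set.Icc (0:ℝ) 1 ∧ α ≤ F x} :=
    fun α hα => ⟨⟨zero_le_one, le_rfl⟩, h11.symm ▸ hα.2⟩
  refine ⟨hmono, fun x => hFc ▸ ProbabilityTheory.cdf_nonneg μ x, h1, ?_, ?_⟩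
  · intro α hα
    rw [hQ α hα]
    exact ⟨le_csInf ⟨1, hone α hα⟩ (fun x hx => hx.1.1), csInf_le (hbdd α) (hone α hα)⟩
  · intro α hα x hx
    constructor
    · intro h
      rw [hQ α hα]
      exact csInf_le (hbdd α) ⟨hx, h⟩
    · intro h
      refine le_trans ?_ (hmono h)
      have hc : ContinuousWithinAt F (Set.Ici (Q α)) (Q α) :=
        hFc ▸ (ProbabilityTheory.cdf μ).right_continuous (Q α)
      have hc' : Filter.Tendsto F (nhdsWithin (Q α) (Set.Ioi (Q α))) (nhds (F (Q α))) :=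
        hc.mono_left (nhdsWithin_mono _ Set.Ioi_subset_Ici_self)
      refine ge_of_tendsto hc' ?_
      filter_upwards [self_mem_nhdsWithin] with y hy
      have hy' : sInf {x | x ∈ Set.Icc (0:ℝ) 1 ∧ α ≤ F x} < y := hQ α hα ▸ hy
      obtain ⟨z, hz, hzy⟩ := exists_lt_of_csInf_lt ⟨1, hone α hα⟩ hy'
      exact hz.2.trans (hmono hzy.le)

/-- Let `F₁, F₂` be the CDFs of two probability measures on `[0,1]` and `Q₁, Q₂` their
left-continuous generalized inverses.  If `F₁ − F₂` has exactly `n ≥ 1` sign changes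
on `[0,1]`, then `Q₁ − Q₂` has exactly `n` sign changes on `(0,1]`. -/
theorem quantile_difference_sign_changes
    (μ₁ μ₂ : Measure ℝ) [IsProbabilityMeasure μ₁] [IsProbabilityMeasure μ₂]
    (hμ₁ : μ₁ (Set.Icc (0:ℝ) 1) = 1) (hμ₂ : μ₂ (Set.Icc (0:ℝ) 1) = 1)
    (F₁ F₂ : ℝ → ℝ)
    (hF₁ : ∀ t, F₁ t = (μ₁ (Set.Iic t)).toReal)
    (hF₂ : ∀ t, F₂ t = (μ₂ (Set.Iic t)).toReal)
    (Q₁ Q₂ : ℝ → ℝ)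
    (hQ₁ : ∀ α ∈ Set.Ioc (0:ℝ) 1, Q₁ α = sInf {x | x ∈ Set.Icc (0:ℝ) 1 ∧ α ≤ F₁ x})
    (hQ₂ : ∀ α ∈ Set.Ioc (0:ℝ) 1, Q₂ α = sInf {x | x ∈ Set.Icc (0:ℝ) 1 ∧ α ≤ F₂ x})
    (n : ℕ) (hn : 1 ≤ n)
    (hsign : SignChangesExactly (fun x => F₁ x - F₂ x) (Set.Icc 0 1) n) :
    SignChangesExactly (fun α => Q₁ α - Q₂ α) (Set.Ioc 0 1) n := by
  obtain ⟨m₁, p₁, l₁, q₁, g₁⟩ := quantile_basic μ₁ hμ₁ F₁ Q₁ hF₁ hQ₁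
  obtain ⟨m₂, p₂, l₂, q₂, g₂⟩ := quantile_basic μ₂ hμ₂ F₂ Q₂ hF₂ hQ₂
  have qm : ∀ (F Q : ℝ → ℝ), (∀ α ∈ Set.Ioc (0:ℝ) 1, Q α ∈ Set.Icc (0:ℝ) 1) →
      (∀ α ∈ Set.Ioc (0:ℝ) 1, ∀ x ∈ Set.Icc (0:ℝ) 1, α ≤ F x ↔ Q α ≤ x) →
      ∀ x ∈ Set.Ioc (0:ℝ) 1, ∀ y ∈ Set.Ioc (0:ℝ) 1, x ≤ y → Q x ≤ Q y := by
    intro F Q q g x hx y hy hxy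
    exact (g x hx _ (q y hy)).1 (hxy.trans ((g y hy _ (q y hy)).2 le_rfl))
  refine ⟨signChanges_transfer _ _ (fun x => max (F₁ x) (F₂ x)) _ _ ?_ ?_ ?_ n hn hsign.1,
    fun h => hsign.2 (signChanges_transfer _ _ (fun x => min (Q₁ x) (Q₂ x)) _ _ ?_ ?_ ?_
      (n + 1) (by omega) h)⟩
  · intro x _ y _ hxy
    exact max_le_max (m₁ hxy) (m₂ hxy)
  · intro x hx h
    have h' : F₁ x < F₂ x := sub_neg.1 h
    have hα : F₂ x ∈ Set.Ioc (0:ℝ) 1 := ⟨(p₁ x).trans_lt h', l₂ x⟩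
    simp only [max_eq_right h'.le]
    refine ⟨hα, sub_pos.2 (lt_of_le_of_lt ((g₂ _ hα x hx).1 le_rfl) ?_)⟩
    exact not_le.1 fun hh => absurd ((g₁ _ hα x hx).2 hh) (not_le.2 h')
  · intro x hx h
    have h' : F₂ x < F₁ x := sub_pos.1 h
    have hα : F₁ x ∈ Set.Ioc (0:ℝ) 1 := ⟨(p₂ x).trans_lt h', l₁ x⟩
    simp only [max_eq_left h'.le]
    refine ⟨hα, sub_neg.2 (lt_of_le_of_lt ((g₁ _ hα x hx).1 le_rfl) ?_)⟩
    exact not_le.1 fun hh => absurd ((g₂ _ hα x hx).2 hh) (not_le.2 h')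
  · intro x hx y hy hxy
    exact min_le_min (qm F₁ Q₁ q₁ g₁ x hx y hy hxy) (qm F₂ Q₂ q₂ g₂ x hx y hy hxy)
  · intro α hα h
    have h' : Q₁ α < Q₂ α := sub_neg.1 h
    simp only [min_eq_left h'.le]
    refine ⟨q₁ α hα, sub_pos.2 (lt_of_lt_of_le ?_ ((g₁ α hα _ (q₁ α hα)).2 le_rfl))⟩
    exact not_le.1 fun hh => absurd ((g₂ α hα _ (q₁ α hα)).1 hh) (not_le.2 h')
  · intro α hα h
    have h' : Q₂ α < Q₁ α := sub_pos.1 h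
    simp only [min_eq_right h'.le]
    refine ⟨q₂ α hα, sub_neg.2 (lt_of_lt_of_le ?_ ((g₂ α hα _ (q₂ α hα)).2 le_rfl))⟩
    exact not_le.1 fun hh => absurd ((g₁ α hα _ (q₂ α hα)).1 hh) (not_le.2 h')
end

section
/- Let n ≥ 1 and let g : [0,1] → ℝ be Lebesgue integrable. Suppose there exist points 0 = a₀ ≤ a₁ ≤ ⋯ ≤ a_{n+1} = 1 and a sign ε ∈ {−1, +1} such that ε·(−1)^i·g(x) ≥ 0 for almost every x ∈ (a_i, a_{i+1}), for each i = 0,…,n, and suppose ∫₀¹ g(x) dx = 0. Then the function G(c) = ∫₀^c g(x) dx, c ∈ [0,1], has at most n − 1 sign changes. -/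
open MeasureTheory

lemma core_aux (n : ℕ) (hn : 1 ≤ n) (H : ℝ → ℝ) (A T : ℕ → ℝ)
    (hA0 : A 0 = 0) (hA1 : A (n + 1) = 1) (H0 : H 0 = 0) (H1 : H 1 = 0)
    (hmono : ∀ k, k ≤ n → ∀ x y, A k ≤ x → x ≤ y → y ≤ A (k + 1) →
      (-1) ^ k * H x ≤ (-1) ^ k * H y)
    (hT : ∀ k, k < n → T k < T (k + 1)) (hT0 : 0 ≤ T 0) (hT1 : T n ≤ 1)
    (hs : ∀ k, k < n → H (T k) * H (T (k + 1)) < 0) : False := by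
  have h0 : H (T 0) ≠ 0 := by
    intro h
    have := hs 0 (by omega)
    rw [h] at this
    simp at this
  rcases lt_or_gt_of_ne h0 with h0 | h0
  · have key : ∀ k, k ≤ n → A (k + 1) < T k ∧ (-1) ^ k * H (T k) < 0 := by
      intro k
      induction k with
      | zero =>
        intro _
        refine ⟨?_, by simpa using h0⟩
        by_contra hc
        have := hmono 0 (by omega) 0 (T 0) hA0.le hT0 (not_lt.1 hc)
        simp [H0] at this
        linarith
      | succ k ih =>
        intro hk
        obtain ⟨h1, h2⟩ := ih (by omega)
        have h3 := hs k (by omega)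
        have h4 : (-1) ^ (k + 1) * H (T (k + 1)) < 0 := by
          rw [pow_succ]
          rcases neg_one_pow_eq_or ℝ k with e | e <;> rw [e] at h2 ⊢ <;> nlinarith
        refine ⟨?_, h4⟩
        by_contra hc
        have := hmono (k + 1) hk (T k) (T (k + 1)) h1.le (hT k (by omega)).le (not_lt.1 hc)
        rw [pow_succ] at this h4
        linarith
    have := (key n le_rfl).1
    linarith
  · have key : ∀ k, k ≤ n → A k ≤ T k ∧ 0 < (-1) ^ k * H (T k) := by
      intro k
      induction k with
      | zero =>
        intro _
        exact ⟨by rw [hA0]; exact hT0, by simpa using h0⟩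
      | succ k ih =>
        intro hk
        obtain ⟨h1, h2⟩ := ih (by omega)
        have h3 := hs k (by omega)
        have h4 : 0 < (-1) ^ (k + 1) * H (T (k + 1)) := by
          rw [pow_succ]
          rcases neg_one_pow_eq_or ℝ k with e | e <;> rw [e] at h2 ⊢ <;> nlinarith
        refine ⟨?_, h4⟩
        by_contra hc
        have := hmono k (by omega) (T k) (T (k + 1)) h1 (hT k (by omega)).le (not_le.1 hc).le
        rw [pow_succ] at h4
        linarith
    obtain ⟨h1, h2⟩ := key n le_rfl
    have := hmono n le_rfl (T n) 1 h1 hT1 hA1.ge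
    rw [H1] at this
    linarith

/-- Let `g` be Lebesgue integrable on `[0,1]`.  Suppose there are points
`0 = a₀ ≤ a₁ ≤ ⋯ ≤ a_{n+1} = 1` and a sign `ε ∈ {−1, +1}` such that
`ε·(−1)^i·g(x) ≥ 0` for a.e. `x ∈ (aᵢ, aᵢ₊₁)` for each `i = 0, …, n`, and
`∫₀¹ g(x) dx = 0`.  Then `G(c) = ∫₀^c g(x) dx` has at most `n − 1` sign changes
on `[0,1]`. -/
theorem integral_sign_changes_of_alternating
    (n : ℕ) (hn : 1 ≤ n) (g : ℝ → ℝ)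
    (hg : IntegrableOn g (Set.Icc (0:ℝ) 1))
    (a : Fin (n + 2) → ℝ) (ha : Monotone a)
    (ha0 : a 0 = 0) (ha1 : a (Fin.last (n + 1)) = 1)
    (ε : ℝ) (hε : ε = -1 ∨ ε = 1)
    (halt : ∀ i : Fin (n + 1), ∀ᵐ x ∂(volume : Measure ℝ),
      x ∈ Set.Ioo (a i.castSucc) (a i.succ) → 0 ≤ ε * (-1) ^ (i : ℕ) * g x)
    (hzero : (∫ x in (0:ℝ)..1, g x) = 0) :
    ¬ SignChangesAtLeast (fun c => ∫ x in (0:ℝ)..c, g x) (Set.Icc 0 1) n := by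
  rintro ⟨t, ht, hts, hsgn⟩
  have hint : ∀ x y, 0 ≤ x → x ≤ y → y ≤ 1 → IntervalIntegrable g volume x y := by
    intro x y hx hxy hy
    rw [intervalIntegrable_iff_integrableOn_Icc_of_le hxy]
    exact hg.mono_set (Set.Icc_subset_Icc hx hy)
  refine core_aux n hn (fun c => ε * ∫ x in (0:ℝ)..c, g x)
    (fun k => if h : k < n + 2 then a ⟨k, h⟩ else 1)
    (fun k => if h : k < n + 1 then t ⟨k, h⟩ else 1) ?_ ?_ (by simp) (by simp [hzero])
    ?_ ?_ ?_ ?_ ?_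
  · simpa using ha0
  · have h : n + 1 < n + 2 := by omega
    simp only [h, dif_pos]
    exact ha1
  · intro k hk x y hx hxy hy
    have hk1 : k < n + 2 := by omega
    have hk2 : k + 1 < n + 2 := by omega
    simp only [hk1, hk2, dif_pos] at hx hy
    have hx0 : 0 ≤ x := by
      refine le_trans ?_ hx
      rw [← ha0]; exact ha (Fin.zero_le _)
    have hy1 : y ≤ 1 := by
      refine hy.trans ?_
      rw [← ha1]; exact ha (Fin.le_last _)
    have hadd := intervalIntegral.integral_add_adjacent_intervals
      (hint 0 x le_rfl hx0 (hxy.trans hy1)) (hint x y hx0 hxy hy1)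
    have hnn : 0 ≤ ∫ u in x..y, ε * (-1) ^ k * g u := by
      rw [intervalIntegral.integral_of_le hxy, integral_Ioc_eq_integral_Ioo]
      apply integral_nonneg_of_ae
      rw [Filter.EventuallyLE, ae_restrict_iff' measurableSet_Ioo]
      filter_upwards [halt ⟨k, by omega⟩] with u hu hmem
      exact hu ⟨lt_of_le_of_lt hx hmem.1, lt_of_lt_of_le hmem.2 hy⟩
    rw [intervalIntegral.integral_const_mul] at hnn
    simp only [← hadd]
    nlinarith
  · intro k hk
    have h1 : k < n + 1 := by omega
    have h2 : k + 1 < n + 1 := by omega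
    simp only [h1, h2, dif_pos]
    exact ht (by simp [Fin.lt_def])
  · simpa using (hts 0).1
  · have h : n < n + 1 := by omega
    simp only [h, dif_pos]
    exact (hts (Fin.last n)).2
  · intro k hk
    have h1 : k < n + 1 := by omega
    have h2 : k + 1 < n + 1 := by omega
    simp only [h1, h2, dif_pos]
    have := hsgn ⟨k, hk⟩
    simp only [Fin.castSucc_mk, Fin.succ_mk] at this
    rcases hε with rfl | rfl <;> linarith
end

section
/- Let (Ω, 𝓕, ℙ) be a probability space, Y : Ω → {0,1} a random variable with 0 < ℙ(Y=0) < 1, and X₁, X₂ : Ω → [0,1] random variables that are each calibrated for Y. Let Q₁, Q₂ be the left-continuous generalized inverses of the cumulative distribution functions of X₁ and X₂. Then X₁ dominates X₂ in the ROC sense (i.e., ∫₀^c (Q₁(α) − Q₂(α)) dα ≤ 0 for all c ∈ [0,1], with strict inequality for some c) if and only if X₁ dominates X₂ in the Murphy sense (i.e., E[S_θ(X₁,Y)] ≤ E[S_θ(X₂,Y)] for all θ ∈ (0,1), with strict inequality for some θ). -/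
open MeasureTheory

namespace RocAux

lemma galois {Ω : Type*} [MeasurableSpace Ω] (μ : Measure Ω) [IsProbabilityMeasure μ]
    (X : Ω → ℝ) (hX : Measurable X) (hXr : ∀ ω, X ω ∈ Set.Icc (0:ℝ) 1)
    (F : ℝ → ℝ) (hF : ∀ t, F t = (μ {ω | X ω ≤ t}).toReal)
    (Q : ℝ → ℝ)
    (hQ : ∀ α ∈ Set.Ioc (0:ℝ) 1, Q α = sInf {x | x ∈ Set.Icc (0:ℝ) 1 ∧ α ≤ F x})
    (α : ℝ) (hα : α ∈ Set.Ioc (0:ℝ) 1) (t : ℝ) : Q α ≤ t ↔ α ≤ F t := by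
  have hmono : Monotone F := by
    intro a b hab
    rw [hF, hF]
    exact ENNReal.toReal_mono (measure_ne_top _ _) (measure_mono fun ω (h : X ω ≤ a) => h.trans hab)
  have hF1 : F 1 = 1 := by
    rw [hF]
    have : {ω | X ω ≤ 1} = Set.univ := Set.eq_univ_of_forall fun ω => (hXr ω).2
    simp [this]
  have h1 : (1:ℝ) ∈ {x | x ∈ Set.Icc (0:ℝ) 1 ∧ α ≤ F x} := ⟨by simp, by rw [hF1]; exact hα.2⟩
  have hbdd : BddBelow {x | x ∈ Set.Icc (0:ℝ) 1 ∧ α ≤ F x} := ⟨0, fun x hx => hx.1.1⟩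
  rw [hQ α hα]
  have : IsProbabilityMeasure (μ.map X) := Measure.isProbabilityMeasure_map hX.aemeasurable
  have hcdf : ∀ t, F t = ProbabilityTheory.cdf (μ.map X) t := by
    intro t
    rw [hF, ProbabilityTheory.cdf_eq_real, Measure.real, Measure.map_apply hX measurableSet_Iic]
    rfl
  constructor
  · intro h
    have hrc : Filter.Tendsto F (nhdsWithin t (Set.Ioi t)) (nhds (F t)) := by
      have h2 := ((ProbabilityTheory.cdf (μ.map X)).right_continuous t).tendsto.mono_left
        (nhdsWithin_mono t Set.Ioi_subset_Ici_self)
      rw [← hcdf] at h2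
      exact h2.congr fun x => (hcdf x).symm
    refine ge_of_tendsto hrc ?_
    filter_upwards [self_mem_nhdsWithin] with t' ht'
    obtain ⟨x, hx, hxt⟩ := exists_lt_of_csInf_lt ⟨1, h1⟩ (lt_of_le_of_lt h ht')
    exact hx.2.trans (hmono hxt.le)
  · intro h
    have ht0 : 0 ≤ t := by
      by_contra! hlt
      have : {ω | X ω ≤ t} = ∅ := by
        ext ω
        simp only [Set.mem_ofPred_eq, Set.mem_empty_iff_false, iff_false, not_le]
        exact hlt.trans_le (hXr ω).1
      rw [hF, this] at h
      simp at h
      linarith [hα.1]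
    rcases le_total t 1 with h' | h'
    · exact csInf_le hbdd ⟨⟨ht0, h'⟩, h⟩
    · exact (csInf_le hbdd h1).trans h'

lemma core {Ω : Type*} [MeasurableSpace Ω] (μ : Measure Ω) [IsProbabilityMeasure μ]
    (X : Ω → ℝ) (hX : Measurable X) (hXr : ∀ ω, X ω ∈ Set.Icc (0:ℝ) 1)
    (F : ℝ → ℝ) (hF : ∀ t, F t = (μ {ω | X ω ≤ t}).toReal)
    (Q : ℝ → ℝ)
    (hQ : ∀ α ∈ Set.Ioc (0:ℝ) 1, Q α = sInf {x | x ∈ Set.Icc (0:ℝ) 1 ∧ α ≤ F x}) :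
    IntegrableOn Q (Set.Ioc 0 1) ∧
    (∀ θ, ∀ c ∈ Set.Icc (0:ℝ) 1,
      ∫ ω, min (X ω) θ ∂μ ≤ (∫ α in Set.Ioc (0:ℝ) c, Q α) + (1 - c) * θ) ∧
    (∀ θ, ∃ c ∈ Set.Icc (0:ℝ) 1,
      ∫ ω, min (X ω) θ ∂μ = (∫ α in Set.Ioc (0:ℝ) c, Q α) + (1 - c) * θ) ∧
    (∀ c ∈ Set.Icc (0:ℝ) 1, ∃ θ ∈ Set.Icc (0:ℝ) 1,
      ∫ ω, min (X ω) θ ∂μ = (∫ α in Set.Ioc (0:ℝ) c, Q α) + (1 - c) * θ) := by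
  have gal := galois μ X hX hXr F hF Q hQ
  have hF01 : ∀ t, F t ∈ Set.Icc (0:ℝ) 1 := by
    intro t
    rw [hF]
    exact ⟨ENNReal.toReal_nonneg, ENNReal.toReal_le_of_le_ofReal zero_le_one (by simpa using prob_le_one)⟩
  have hF1 : F 1 = 1 := by
    rw [hF]
    have : {ω | X ω ≤ 1} = Set.univ := Set.eq_univ_of_forall fun ω => (hXr ω).2
    simp [this]
  have hQmono : MonotoneOn Q (Set.Ioc 0 1) := by
    intro a ha b hb hab
    rw [gal a ha]
    exact hab.trans ((gal b hb _).1 le_rfl)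
  have hQ01 : ∀ α ∈ Set.Ioc (0:ℝ) 1, Q α ∈ Set.Icc (0:ℝ) 1 := by
    intro α hα
    refine ⟨?_, ?_⟩
    · rw [hQ α hα]
      exact Real.sInf_nonneg fun x hx => hx.1.1
    · rw [gal α hα, hF1]
      exact hα.2
  have hQm : AEMeasurable Q (volume.restrict (Set.Ioc 0 1)) :=
    aemeasurable_restrict_of_monotoneOn measurableSet_Ioc hQmono
  have hprobP : IsProbabilityMeasure ((volume : Measure ℝ).restrict (Set.Ioc 0 1)) := ⟨by simp⟩
  have hmap : (volume.restrict (Set.Ioc (0:ℝ) 1)).map Q = μ.map X := by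
    have : IsProbabilityMeasure (μ.map X) := Measure.isProbabilityMeasure_map hX.aemeasurable
    have : IsProbabilityMeasure ((volume.restrict (Set.Ioc (0:ℝ) 1)).map Q) :=
      Measure.isProbabilityMeasure_map hQm
    refine Measure.ext_of_Iic _ _ fun t => ?_
    rw [Measure.map_apply_of_aemeasurable hQm measurableSet_Iic,
      Measure.map_apply hX measurableSet_Iic, Measure.restrict_apply' measurableSet_Ioc]
    have h1 : Q ⁻¹' Set.Iic t ∩ Set.Ioc 0 1 = Set.Ioc 0 (F t) := by
      ext α
      constructor
      · rintro ⟨h, h'⟩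
        exact ⟨h'.1, (gal α h' t).1 h⟩
      · rintro ⟨h, h'⟩
        have hα : α ∈ Set.Ioc (0:ℝ) 1 := ⟨h, h'.trans (hF01 t).2⟩
        exact ⟨(gal α hα t).2 h', hα⟩
    rw [h1, Real.volume_Ioc, sub_zero, hF, ENNReal.ofReal_toReal (measure_ne_top _ _)]
    rfl
  have hint : IntegrableOn Q (Set.Ioc 0 1) := by
    refine Integrable.of_mem_Icc 0 1 hQm ?_
    exact (ae_restrict_iff' measurableSet_Ioc).2 (Filter.Eventually.of_forall hQ01)
  have hintm : ∀ θ, IntegrableOn (fun α => min (Q α) θ) (Set.Ioc 0 1) := fun θ =>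
    Integrable.inf hint (integrable_const θ)
  have hM : ∀ θ, ∫ ω, min (X ω) θ ∂μ = ∫ α in Set.Ioc (0:ℝ) 1, min (Q α) θ := by
    intro θ
    have hc : Continuous fun x : ℝ => min x θ := by fun_prop
    rw [← integral_map hX.aemeasurable (f := fun x => min x θ) hc.aestronglyMeasurable, ← hmap,
      integral_map hQm hc.aestronglyMeasurable]
  have hsub1 : ∀ c ∈ Set.Icc (0:ℝ) 1, Set.Ioc 0 c ⊆ Set.Ioc (0:ℝ) 1 := fun c hc =>
    Set.Ioc_subset_Ioc_right hc.2
  have hsub2 : ∀ c ∈ Set.Icc (0:ℝ) 1, Set.Ioc c 1 ⊆ Set.Ioc (0:ℝ) 1 := fun c hc =>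
    Set.Ioc_subset_Ioc_left hc.1
  have hsplit : ∀ θ, ∀ c ∈ Set.Icc (0:ℝ) 1, ∫ ω, min (X ω) θ ∂μ =
      (∫ α in Set.Ioc (0:ℝ) c, min (Q α) θ) + ∫ α in Set.Ioc c 1, min (Q α) θ := by
    intro θ c hc
    rw [hM, ← Set.Ioc_union_Ioc_eq_Ioc hc.1 hc.2]
    exact setIntegral_union (Set.Ioc_disjoint_Ioc_of_le le_rfl) measurableSet_Ioc
      ((hintm θ).mono_set (hsub1 c hc)) ((hintm θ).mono_set (hsub2 c hc))
  have hconst : ∀ θ, ∀ c ∈ Set.Icc (0:ℝ) 1, ∫ α in Set.Ioc c 1, θ = (1 - c) * θ := by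
    intro θ c hc
    simp [Measure.real, ENNReal.toReal_ofReal (sub_nonneg.2 hc.2)]
  have heq : ∀ θ, ∀ c ∈ Set.Icc (0:ℝ) 1, (∀ α ∈ Set.Ioc 0 c, Q α ≤ θ) →
      (∀ α ∈ Set.Ioc c 1, θ ≤ Q α) →
      ∫ ω, min (X ω) θ ∂μ = (∫ α in Set.Ioc (0:ℝ) c, Q α) + (1 - c) * θ := by
    intro θ c hc h1 h2
    rw [hsplit θ c hc, ← hconst θ c hc]
    congr 1
    · exact setIntegral_congr_fun measurableSet_Ioc fun α hα => min_eq_left (h1 α hα)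
    · exact setIntegral_congr_fun measurableSet_Ioc fun α hα => min_eq_right (h2 α hα)
  refine ⟨hint, ?_, ?_, ?_⟩
  · intro θ c hc
    rw [hsplit θ c hc, ← hconst θ c hc]
    refine add_le_add ?_ ?_
    · exact setIntegral_mono ((hintm θ).mono_set (hsub1 c hc)) (hint.mono_set (hsub1 c hc))
        fun α => min_le_left _ _
    · exact setIntegral_mono ((hintm θ).mono_set (hsub2 c hc)) (integrable_const θ)
        fun α => min_le_right _ _
  · intro θ
    refine ⟨F θ, hF01 θ, heq θ _ (hF01 θ) ?_ ?_⟩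
    · intro α hα
      exact (gal α (hsub1 _ (hF01 θ) hα) θ).2 hα.2
    · intro α hα
      by_contra! h
      exact absurd ((gal α (hsub2 _ (hF01 θ) hα) θ).1 h.le) (not_le.2 hα.1)
  · intro c hc
    rcases hc.1.eq_or_lt with h0 | h0
    · subst h0
      refine ⟨0, by simp, heq 0 0 hc (by simp) fun α hα => (hQ01 α hα).1⟩
    · have hc' : c ∈ Set.Ioc (0:ℝ) 1 := ⟨h0, hc.2⟩
      refine ⟨Q c, hQ01 c hc', heq _ c hc ?_ ?_⟩
      · intro α hα
        exact hQmono (hsub1 c hc hα) hc' hα.2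
      · intro α hα
        exact hQmono hc' (hsub2 c hc hα) hα.1.le

lemma score {Ω : Type*} [MeasurableSpace Ω] (μ : Measure Ω) [IsProbabilityMeasure μ]
    (X Y : Ω → ℝ) (hX : Measurable X) (hY : Measurable Y)
    (hXr : ∀ ω, X ω ∈ Set.Icc (0:ℝ) 1) (hYr : ∀ ω, Y ω = 0 ∨ Y ω = 1)
    (hcal : μ[Y | MeasurableSpace.comap X inferInstance] =ᵐ[μ] X) :
    (∫ ω, X ω ∂μ = ∫ ω, Y ω ∂μ) ∧
    ∀ θ, ∫ ω, elemScore θ (X ω) (Y ω) ∂μ = 2 * ((∫ ω, min (X ω) θ ∂μ) - θ * ∫ ω, Y ω ∂μ) := by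
  have hm : MeasurableSpace.comap X inferInstance ≤ (inferInstance : MeasurableSpace Ω) :=
    hX.comap_le
  have hXi : Integrable X μ :=
    Integrable.of_mem_Icc 0 1 hX.aemeasurable (Filter.Eventually.of_forall hXr)
  have hYi : Integrable Y μ :=
    Integrable.of_mem_Icc 0 1 hY.aemeasurable (Filter.Eventually.of_forall fun ω => by
      rcases hYr ω with h | h <;> simp [h])
  have hXY : ∫ ω, X ω ∂μ = ∫ ω, Y ω ∂μ := by
    rw [← integral_condExp hm (f := Y)]
    exact integral_congr_ae hcal.symm
  refine ⟨hXY, fun θ => ?_⟩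
  have hset : ∀ s : Set ℝ, MeasurableSet s →
      ∫ ω, (X ⁻¹' s).indicator (fun ω => X ω - Y ω) ω ∂μ = 0 := by
    intro s hs
    rw [integral_indicator (hX hs), integral_sub hXi.integrableOn hYi.integrableOn,
      ← setIntegral_condExp hm hYi ⟨s, hs, rfl⟩, sub_eq_zero]
    exact integral_congr_ae (ae_restrict_of_ae hcal.symm)
  have hpt : ∀ ω, elemScore θ (X ω) (Y ω) = 2 * (min (X ω) θ - θ * X ω)
      + (2 * θ * (X ⁻¹' Set.Ioi θ).indicator (fun ω => X ω - Y ω) ω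
      - 2 * (1 - θ) * (X ⁻¹' Set.Iio θ).indicator (fun ω => X ω - Y ω) ω) := by
    intro ω
    simp only [elemScore, Set.indicator, Set.mem_preimage, Set.mem_Ioi, Set.mem_Iio]
    rcases lt_trichotomy (X ω) θ with h | h | h
    · rw [min_eq_left h.le]
      rcases hYr ω with h' | h' <;> simp [h, h', h.not_gt, h.ne] <;> ring
    · simp [h]; ring
    · rw [min_eq_right h.le]
      rcases hYr ω with h' | h' <;> simp [h, h', h.not_gt, h.ne'] <;> ring
  have hi1 : Integrable (fun ω => min (X ω) θ) μ := hXi.inf (integrable_const θ)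
  have hi2 : ∀ s : Set ℝ, MeasurableSet s →
      Integrable (fun ω => (X ⁻¹' s).indicator (fun ω => X ω - Y ω) ω) μ :=
    fun s hs => (hXi.sub hYi).indicator (hX hs)
  simp_rw [hpt]
  have e1 := hi2 _ (measurableSet_Ioi (a := θ))
  have e2 := hi2 _ (measurableSet_Iio (a := θ))
  have f1 : Integrable (fun ω => 2 * (min (X ω) θ - θ * X ω)) μ :=
    (hi1.sub (hXi.const_mul θ)).const_mul 2
  have f2 : Integrable (fun ω => 2 * θ * (X ⁻¹' Set.Ioi θ).indicator (fun ω => X ω - Y ω) ω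
      - 2 * (1 - θ) * (X ⁻¹' Set.Iio θ).indicator (fun ω => X ω - Y ω) ω) μ :=
    (e1.const_mul _).sub (e2.const_mul _)
  rw [integral_add f1 f2,
    integral_sub (e1.const_mul _) (e2.const_mul _), integral_const_mul, integral_const_mul,
    integral_const_mul, integral_sub hi1 (hXi.const_mul θ), integral_const_mul,
    hset _ measurableSet_Ioi, hset _ measurableSet_Iio, hXY]
  ring

end RocAux

/-- For calibrated probability forecasts `X₁, X₂` of the binary outcome `Y` with
`0 < ℙ(Y=0) < 1`: `X₁` dominates `X₂` in the ROC sense if and only if `X₁` dominates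
`X₂` in the Murphy sense. -/
theorem roc_dominance_iff_murphy_dominance
    {Ω : Type*} [MeasurableSpace Ω] (μ : Measure Ω) [IsProbabilityMeasure μ]
    (X₁ X₂ Y : Ω → ℝ) (hX₁ : Measurable X₁) (hX₂ : Measurable X₂) (hY : Measurable Y)
    (hX₁r : ∀ ω, X₁ ω ∈ Set.Icc (0:ℝ) 1) (hX₂r : ∀ ω, X₂ ω ∈ Set.Icc (0:ℝ) 1)
    (hYr : ∀ ω, Y ω = 0 ∨ Y ω = 1)
    (hY0 : 0 < μ {ω | Y ω = 0}) (hY0' : μ {ω | Y ω = 0} < 1)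
    (hcal₁ : μ[Y | MeasurableSpace.comap X₁ inferInstance] =ᵐ[μ] X₁)
    (hcal₂ : μ[Y | MeasurableSpace.comap X₂ inferInstance] =ᵐ[μ] X₂)
    (F₁ F₂ : ℝ → ℝ)
    (hF₁ : ∀ t, F₁ t = (μ {ω | X₁ ω ≤ t}).toReal)
    (hF₂ : ∀ t, F₂ t = (μ {ω | X₂ ω ≤ t}).toReal)
    (Q₁ Q₂ : ℝ → ℝ)
    (hQ₁ : ∀ α ∈ Set.Ioc (0:ℝ) 1, Q₁ α = sInf {x | x ∈ Set.Icc (0:ℝ) 1 ∧ α ≤ F₁ x})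
    (hQ₂ : ∀ α ∈ Set.Ioc (0:ℝ) 1, Q₂ α = sInf {x | x ∈ Set.Icc (0:ℝ) 1 ∧ α ≤ F₂ x}) :
    ((∀ c ∈ Set.Icc (0:ℝ) 1, (∫ α in Set.Ioc (0:ℝ) c, (Q₁ α - Q₂ α)) ≤ 0)
      ∧ (∃ c ∈ Set.Icc (0:ℝ) 1, (∫ α in Set.Ioc (0:ℝ) c, (Q₁ α - Q₂ α)) < 0))
    ↔ ((∀ θ ∈ Set.Ioo (0:ℝ) 1,
          (∫ ω, elemScore θ (X₁ ω) (Y ω) ∂μ) ≤ ∫ ω, elemScore θ (X₂ ω) (Y ω) ∂μ)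
        ∧ (∃ θ ∈ Set.Ioo (0:ℝ) 1,
            (∫ ω, elemScore θ (X₁ ω) (Y ω) ∂μ) < ∫ ω, elemScore θ (X₂ ω) (Y ω) ∂μ)) := by
  obtain ⟨hi1, le1, ex1, ey1⟩ := RocAux.core μ X₁ hX₁ hX₁r F₁ hF₁ Q₁ hQ₁
  obtain ⟨hi2, le2, ex2, ey2⟩ := RocAux.core μ X₂ hX₂ hX₂r F₂ hF₂ Q₂ hQ₂
  obtain ⟨m1, s1⟩ := RocAux.score μ X₁ Y hX₁ hY hX₁r hYr hcal₁
  obtain ⟨m2, s2⟩ := RocAux.score μ X₂ Y hX₂ hY hX₂r hYr hcal₂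
  have hG : ∀ c ∈ Set.Icc (0:ℝ) 1, (∫ α in Set.Ioc (0:ℝ) c, (Q₁ α - Q₂ α)) =
      (∫ α in Set.Ioc (0:ℝ) c, Q₁ α) - ∫ α in Set.Ioc (0:ℝ) c, Q₂ α := fun c hc =>
    integral_sub (hi1.mono_set (Set.Ioc_subset_Ioc_right hc.2))
      (hi2.mono_set (Set.Ioc_subset_Ioc_right hc.2))
  have hz : ∀ X : Ω → ℝ, (∀ ω, X ω ∈ Set.Icc (0:ℝ) 1) → ∫ ω, min (X ω) 0 ∂μ = 0 := by
    intro X hX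
    simp [fun ω => min_eq_right (hX ω).1]
  have ho : ∀ X : Ω → ℝ, (∀ ω, X ω ∈ Set.Icc (0:ℝ) 1) →
      ∫ ω, min (X ω) 1 ∂μ = ∫ ω, X ω ∂μ := by
    intro X hX
    simp [fun ω => min_eq_left (hX ω).2]
  have hb : ∀ θ ∈ Set.Icc (0:ℝ) 1, θ ∈ Set.Ioo (0:ℝ) 1 ∨
      ∫ ω, min (X₁ ω) θ ∂μ = ∫ ω, min (X₂ ω) θ ∂μ := by
    intro θ hθ
    rcases hθ.1.eq_or_lt with h | h
    · right
      rw [← h, hz X₁ hX₁r, hz X₂ hX₂r]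
    · rcases hθ.2.eq_or_lt with h' | h'
      · right
        rw [h', ho X₁ hX₁r, ho X₂ hX₂r, m1, m2]
      · exact Or.inl ⟨h, h'⟩
  constructor
  · rintro ⟨hle, c, hc, hlt⟩
    refine ⟨fun θ hθ => ?_, ?_⟩
    · rw [s1, s2]
      obtain ⟨c, hc, h⟩ := ex2 θ
      have h1 := le1 θ c hc
      have h2 := hle c hc
      rw [hG c hc] at h2
      linarith
    · rw [hG c hc] at hlt
      obtain ⟨θ, hθ, h⟩ := ey2 c hc
      have h1 := le1 θ c hc
      rcases hb θ hθ with h' | h'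
      · refine ⟨θ, h', ?_⟩
        rw [s1, s2]
        linarith
      · linarith
  · rintro ⟨hle, θ, hθ, hlt⟩
    refine ⟨fun c hc => ?_, ?_⟩
    · rw [hG c hc]
      obtain ⟨θ, hθ, h⟩ := ey1 c hc
      have h2 := le2 θ c hc
      rcases hb θ hθ with h' | h'
      · have h3 := hle θ h'
        rw [s1, s2] at h3
        linarith
      · linarith
    · obtain ⟨c, hc, h⟩ := ex1 θ
      have h2 := le2 θ c hc
      refine ⟨c, hc, ?_⟩
      rw [hG c hc]
      rw [s1, s2] at hlt
      linarith
end

section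
/- Let (Ω, 𝓕, ℙ) be a probability space, Y : Ω → {0,1} a random variable with 0 < ℙ(Y=0) < 1, and X₁, X₂ : Ω → [0,1] random variables that are each calibrated for Y. Let Q₁, Q₂ be the left-continuous generalized inverses of the cumulative distribution functions of X₁ and X₂. Then X₁ is sharper than X₂ (i.e., E[φ(X₁)] ≥ E[φ(X₂)] for every convex function φ : [0,1] → ℝ, with strict inequality for some convex φ) if and only if X₁ dominates X₂ in the ROC sense (i.e., ∫₀^c (Q₁(α) − Q₂(α)) dα ≤ 0 for all c ∈ [0,1], with strict inequality for some c). -/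
open MeasureTheory

namespace SharpROC

noncomputable def slope' (φ : ℝ → ℝ) (n k : ℕ) : ℝ :=
  ((n:ℝ)+1) * (φ (((k:ℝ)+1)/((n:ℝ)+1)) - φ ((k:ℝ)/((n:ℝ)+1)))

noncomputable def interp (φ : ℝ → ℝ) (n : ℕ) (x : ℝ) : ℝ :=
  φ 0 + slope' φ n 0 * x + ∑ k ∈ Finset.range n,
    (slope' φ n (k+1) - slope' φ n k) * max (x - ((k:ℝ)+1)/((n:ℝ)+1)) 0

lemma interp_aux (φ : ℝ → ℝ) (n j : ℕ) (x : ℝ) :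
    φ 0 + slope' φ n 0 * x + ∑ k ∈ Finset.range j,
      (slope' φ n (k+1) - slope' φ n k) * (x - ((k:ℝ)+1)/((n:ℝ)+1))
    = φ ((j:ℝ)/((n:ℝ)+1)) + slope' φ n j * (x - (j:ℝ)/((n:ℝ)+1)) := by
  induction j with
  | zero => simp
  | succ j ih =>
    rw [Finset.sum_range_succ, ← add_assoc, ih]
    have hn : (n:ℝ)+1 ≠ 0 := by positivity
    have h : slope' φ n j * (1/((n:ℝ)+1)) =
      φ (((j:ℝ)+1)/((n:ℝ)+1)) - φ ((j:ℝ)/((n:ℝ)+1)) := by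
      unfold slope'; field_simp
    have h2 : ((j:ℝ)+1)/((n:ℝ)+1) = (j:ℝ)/((n:ℝ)+1) + 1/((n:ℝ)+1) := by ring
    push_cast
    have h3 : slope' φ n j * (((j:ℝ)+1)/((n:ℝ)+1)) =
      slope' φ n j * ((j:ℝ)/((n:ℝ)+1)) + slope' φ n j * (1/((n:ℝ)+1)) := by
      rw [h2]; ring
    linear_combination h3 + h

lemma interp_eq (φ : ℝ → ℝ) (n j : ℕ) (hj : j ≤ n) (x : ℝ)
    (h1 : (j:ℝ)/((n:ℝ)+1) ≤ x) (h2 : x ≤ ((j:ℝ)+1)/((n:ℝ)+1)) :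
    interp φ n x = φ ((j:ℝ)/((n:ℝ)+1)) + slope' φ n j * (x - (j:ℝ)/((n:ℝ)+1)) := by
  rw [← interp_aux, interp]
  congr 1
  have hn : (0:ℝ) < (n:ℝ)+1 := by positivity
  symm
  rw [← Finset.sum_subset (Finset.range_mono hj)]
  · apply Finset.sum_congr rfl
    intro k hk
    rw [max_eq_left]
    have : (k:ℝ)+1 ≤ j := by exact_mod_cast Finset.mem_range.1 hk
    have : ((k:ℝ)+1)/((n:ℝ)+1) ≤ (j:ℝ)/((n:ℝ)+1) := by gcongr
    linarith
  · intro k _ hk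
    rw [max_eq_right, mul_zero]
    have : (j:ℝ) ≤ k := by exact_mod_cast not_lt.1 (fun h => hk (Finset.mem_range.2 h))
    have : ((j:ℝ)+1)/((n:ℝ)+1) ≤ ((k:ℝ)+1)/((n:ℝ)+1) := by gcongr
    linarith

/-- local description: convex combination of nearby values -/
lemma interp_comb (φ : ℝ → ℝ) (n : ℕ) (x : ℝ) (hx : x ∈ Set.Icc (0:ℝ) 1) :
    ∃ a b s : ℝ, a ∈ Set.Icc (0:ℝ) 1 ∧ b ∈ Set.Icc (0:ℝ) 1 ∧ s ∈ Set.Icc (0:ℝ) 1 ∧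
      |a - x| ≤ 1/((n:ℝ)+1) ∧ |b - x| ≤ 1/((n:ℝ)+1) ∧
      interp φ n x = (1-s) * φ a + s * φ b := by
  have hn : (0:ℝ) < (n:ℝ)+1 := by positivity
  obtain ⟨j, hj, h1, h2⟩ : ∃ j : ℕ, j ≤ n ∧ (j:ℝ)/((n:ℝ)+1) ≤ x ∧ x ≤ ((j:ℝ)+1)/((n:ℝ)+1) := by
    rcases eq_or_lt_of_le hx.2 with h | h
    · refine ⟨n, le_rfl, ?_, ?_⟩
      · rw [h, div_le_one hn]; linarith
      · rw [h, div_self hn.ne']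
    · have h0 : 0 ≤ x * ((n:ℝ)+1) := mul_nonneg hx.1 hn.le
      refine ⟨⌊x * ((n:ℝ)+1)⌋₊, ?_, ?_, ?_⟩
      · have : ⌊x * ((n:ℝ)+1)⌋₊ < n+1 := by
          rw [Nat.floor_lt h0]; push_cast; nlinarith
        omega
      · rw [div_le_iff₀ hn]; exact Nat.floor_le h0
      · rw [le_div_iff₀ hn]; exact (Nat.lt_floor_add_one _).le
  have hjn : (j:ℝ) ≤ n := by exact_mod_cast hj
  have e : ((j:ℝ)+1)/((n:ℝ)+1) = (j:ℝ)/((n:ℝ)+1) + 1/((n:ℝ)+1) := by ring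
  have hb1 : ((j:ℝ)+1)/((n:ℝ)+1) ≤ 1 := by rw [div_le_one hn]; linarith
  have ha0 : 0 ≤ (j:ℝ)/((n:ℝ)+1) := by positivity
  refine ⟨(j:ℝ)/((n:ℝ)+1), ((j:ℝ)+1)/((n:ℝ)+1), ((n:ℝ)+1) * (x - (j:ℝ)/((n:ℝ)+1)),
    ⟨ha0, by linarith [hx.2]⟩, ⟨by linarith [hx.1], hb1⟩, ⟨?_, ?_⟩, ?_, ?_, ?_⟩
  · exact mul_nonneg hn.le (by linarith)
  · have : ((n:ℝ)+1) * (x - (j:ℝ)/((n:ℝ)+1)) ≤ ((n:ℝ)+1) * (1/((n:ℝ)+1)) := by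
      gcongr; linarith
    rwa [mul_one_div_cancel hn.ne'] at this
  · rw [abs_le]; constructor <;> linarith
  · rw [abs_le]; constructor <;> linarith
  · rw [interp_eq φ n j hj x h1 h2, slope']; ring

lemma interp_zero (φ : ℝ → ℝ) (n : ℕ) : interp φ n 0 = φ 0 := by
  rw [interp_eq φ n 0 (by omega) 0 (by simp) (by positivity)]; simp

lemma interp_one (φ : ℝ → ℝ) (n : ℕ) : interp φ n 1 = φ 1 := by
  have hn : (0:ℝ) < (n:ℝ)+1 := by positivity
  rw [interp_eq φ n n le_rfl 1 (by rw [div_le_one hn]; linarith) (by rw [div_self hn.ne']),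
    slope', div_self hn.ne']
  field_simp
  ring

lemma cvx {φ : ℝ → ℝ} (hφ : ConvexOn ℝ (Set.Icc 0 1) φ) (x y a b : ℝ)
    (hx : x ∈ Set.Icc (0:ℝ) 1) (hy : y ∈ Set.Icc (0:ℝ) 1) (ha : 0 ≤ a) (hb : 0 ≤ b)
    (hab : a + b = 1) : φ (a * x + b * y) ≤ a * φ x + b * φ y := by
  have := hφ.2 hx hy ha hb hab
  simpa only [smul_eq_mul] using this

lemma convex_bdd {φ : ℝ → ℝ} (hφ : ConvexOn ℝ (Set.Icc 0 1) φ) :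
    ∃ C, ∀ x ∈ Set.Icc (0:ℝ) 1, |φ x| ≤ C := by
  have up : ∀ x ∈ Set.Icc (0:ℝ) 1, φ x ≤ |φ 0| + |φ 1| := by
    intro x hx
    have := cvx hφ 0 1 (1-x) x (by simp) (by simp)
      (by linarith [hx.2]) hx.1 (by ring)
    simp only [mul_zero, mul_one, zero_add] at this
    have h1 : (1-x) * φ 0 ≤ |φ 0| := by
      nlinarith [le_abs_self (φ 0), abs_nonneg (φ 0), hx.1, hx.2]
    have h2 : x * φ 1 ≤ |φ 1| := by
      nlinarith [le_abs_self (φ 1), abs_nonneg (φ 1), hx.1, hx.2]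
    linarith
  refine ⟨|φ 0| + |φ 1| + 2 * |φ (1/2)|, fun x hx => ?_⟩
  have hx' : 1 - x ∈ Set.Icc (0:ℝ) 1 := ⟨by linarith [hx.2], by linarith [hx.1]⟩
  have := cvx hφ _ _ (1/2) (1/2) hx hx' (by norm_num) (by norm_num) (by norm_num)
  rw [show 1/2 * x + 1/2 * (1-x) = 1/2 by ring] at this
  have := up x hx
  have := up _ hx'
  rw [abs_le]
  constructor <;> linarith [neg_abs_le (φ (1/2)), abs_nonneg (φ (1/2))]

lemma comb_close {s u v w ε : ℝ} (hs : s ∈ Set.Icc (0:ℝ) 1) (hu : |u - w| ≤ ε) (hv : |v - w| ≤ ε) :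
    |(1-s) * u + s * v - w| ≤ ε := by
  obtain ⟨h0, h1⟩ := hs
  rw [abs_le] at *
  constructor <;> nlinarith

lemma interp_tendsto {φ : ℝ → ℝ} (hφ : ConvexOn ℝ (Set.Icc 0 1) φ) (x : ℝ)
    (hx : x ∈ Set.Icc (0:ℝ) 1) :
    Filter.Tendsto (fun n => interp φ n x) Filter.atTop (nhds (φ x)) := by
  rcases eq_or_lt_of_le hx.1 with h0 | h0
  · subst h0; simp [interp_zero]
  rcases eq_or_lt_of_le hx.2 with h1 | h1
  · subst h1; simp [interp_one]
  have hc : ContinuousAt φ x := by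
    have := hφ.continuousOn_interior
    rw [interior_Icc] at this
    exact this.continuousAt (Ioo_mem_nhds h0 h1)
  rw [Metric.tendsto_atTop]
  intro ε hε
  obtain ⟨δ, hδ, hd⟩ := Metric.continuousAt_iff.1 hc (ε/2) (by linarith)
  obtain ⟨N, hN⟩ := exists_nat_one_div_lt hδ
  refine ⟨N, fun n hn => ?_⟩
  obtain ⟨a, b, s, _, _, hs, ha, hb, e⟩ := interp_comb φ n x hx
  have hlt : 1/((n:ℝ)+1) < δ := by
    refine lt_of_le_of_lt ?_ hN
    gcongr
  have h1 := hd (x := a) (by rw [Real.dist_eq]; linarith)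
  have h2 := hd (x := b) (by rw [Real.dist_eq]; linarith)
  rw [Real.dist_eq] at *
  rw [e]
  have := comb_close hs h1.le h2.le
  linarith

lemma slope_mono {φ : ℝ → ℝ} (hφ : ConvexOn ℝ (Set.Icc 0 1) φ) (n k : ℕ) (hk : k < n) :
    0 ≤ slope' φ n (k+1) - slope' φ n k := by
  have hn : (0:ℝ) < (n:ℝ)+1 := by positivity
  have hk' : (k:ℝ)+1 ≤ n := by exact_mod_cast hk
  have := cvx hφ ((k:ℝ)/((n:ℝ)+1)) (((k:ℝ)+1+1)/((n:ℝ)+1)) (1/2) (1/2)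
    ⟨by positivity, by rw [div_le_one hn]; linarith⟩
    ⟨by positivity, by rw [div_le_one hn]; linarith⟩
    (by norm_num) (by norm_num) (by norm_num)
  rw [show 1/2 * ((k:ℝ)/((n:ℝ)+1)) + 1/2 * (((k:ℝ)+1+1)/((n:ℝ)+1)) = ((k:ℝ)+1)/((n:ℝ)+1) by
    ring] at this
  unfold slope'
  push_cast
  rw [← mul_sub]
  apply mul_nonneg hn.le
  linarith

section
variable {Ω : Type*} [MeasurableSpace Ω] (μ : Measure Ω) [IsProbabilityMeasure μ]

lemma integrable_of_unit {X : Ω → ℝ} (hX : Measurable X) (hr : ∀ ω, X ω ∈ Set.Icc (0:ℝ) 1) :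
    Integrable X μ :=
  Integrable.of_bound hX.aestronglyMeasurable 1
    (Filter.Eventually.of_forall fun ω => by
      rw [Real.norm_eq_abs, abs_le]; constructor <;> linarith [(hr ω).1, (hr ω).2])

lemma integrable_hinge {X : Ω → ℝ} (hX : Measurable X) (hr : ∀ ω, X ω ∈ Set.Icc (0:ℝ) 1)
    (t : ℝ) : Integrable (fun ω => max (X ω - t) 0) μ :=
  ((integrable_of_unit μ hX hr).sub (integrable_const t)).pos_part

lemma integrable_hinge' {X : Ω → ℝ} (hX : Measurable X) (hr : ∀ ω, X ω ∈ Set.Icc (0:ℝ) 1)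
    (t : ℝ) : Integrable (fun ω => max (t - X ω) 0) μ :=
  ((integrable_const t).sub (integrable_of_unit μ hX hr)).pos_part

lemma hinge_swap {X : Ω → ℝ} (hX : Measurable X) (hr : ∀ ω, X ω ∈ Set.Icc (0:ℝ) 1) (t : ℝ) :
    ∫ ω, max (X ω - t) 0 ∂μ = ∫ ω, max (t - X ω) 0 ∂μ + (∫ ω, X ω ∂μ) - t := by
  have : ∀ ω, max (X ω - t) 0 = max (t - X ω) 0 + (X ω - t) := by
    intro ω
    rcases le_total (X ω) t with h | h
    · rw [max_eq_right (by linarith), max_eq_left (by linarith)]; ring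
    · rw [max_eq_left (by linarith), max_eq_right (by linarith)]; ring
  simp_rw [this]
  have hi := integrable_of_unit μ hX hr
  have hi2 : Integrable (fun ω => X ω - t) μ := hi.sub (integrable_const t)
  rw [integral_add (integrable_hinge' μ hX hr t) hi2,
    integral_sub hi (integrable_const t)]
  simp
  ring

lemma integral_interp {X : Ω → ℝ} (hX : Measurable X) (hr : ∀ ω, X ω ∈ Set.Icc (0:ℝ) 1)
    (φ : ℝ → ℝ) (n : ℕ) :
    ∫ ω, interp φ n (X ω) ∂μ = φ 0 + slope' φ n 0 * (∫ ω, X ω ∂μ) + ∑ k ∈ Finset.range n,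
      (slope' φ n (k+1) - slope' φ n k) * ∫ ω, max (X ω - ((k:ℝ)+1)/((n:ℝ)+1)) 0 ∂μ := by
  unfold interp
  have hi := integrable_of_unit μ hX hr
  have hs : ∀ k ∈ Finset.range n, Integrable (fun ω =>
      (slope' φ n (k+1) - slope' φ n k) * max (X ω - ((k:ℝ)+1)/((n:ℝ)+1)) 0) μ :=
    fun k _ => (integrable_hinge μ hX hr _).const_mul _
  have hi2 : Integrable (fun ω => φ 0 + slope' φ n 0 * X ω) μ :=
    (integrable_const _).add (hi.const_mul _)
  rw [integral_add hi2 (integrable_finsetSum _ hs),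
    integral_add (integrable_const _) (hi.const_mul _), integral_const_mul,
    integral_finsetSum _ hs]
  simp [integral_const_mul]

lemma interp_integral_tendsto {X : Ω → ℝ} (hX : Measurable X)
    (hr : ∀ ω, X ω ∈ Set.Icc (0:ℝ) 1) {φ : ℝ → ℝ} (hφ : ConvexOn ℝ (Set.Icc 0 1) φ) :
    Filter.Tendsto (fun n => ∫ ω, interp φ n (X ω) ∂μ) Filter.atTop
      (nhds (∫ ω, φ (X ω) ∂μ)) := by
  obtain ⟨C, hC⟩ := convex_bdd hφ
  apply tendsto_integral_of_dominated_convergence (fun _ => C)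
  · intro n
    have : Measurable (interp φ n) := by unfold interp; fun_prop
    exact (this.comp hX).aestronglyMeasurable
  · exact integrable_const _
  · intro n
    refine Filter.Eventually.of_forall fun ω => ?_
    obtain ⟨a, b, s, ha, hb, hs, _, _, e⟩ := interp_comb φ n (X ω) (hr ω)
    have := comb_close (w := 0) hs (by simpa using hC a ha) (by simpa using hC b hb)
    rw [Real.norm_eq_abs, e]
    simpa using this
  · exact Filter.Eventually.of_forall fun ω => interp_tendsto hφ _ (hr ω)

lemma convex_of_hinge {X₁ X₂ : Ω → ℝ} (hX₁ : Measurable X₁) (hX₂ : Measurable X₂)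
    (hr₁ : ∀ ω, X₁ ω ∈ Set.Icc (0:ℝ) 1) (hr₂ : ∀ ω, X₂ ω ∈ Set.Icc (0:ℝ) 1)
    (hm : ∫ ω, X₁ ω ∂μ = ∫ ω, X₂ ω ∂μ)
    (hh : ∀ t, ∫ ω, max (t - X₂ ω) 0 ∂μ ≤ ∫ ω, max (t - X₁ ω) 0 ∂μ)
    {φ : ℝ → ℝ} (hφ : ConvexOn ℝ (Set.Icc 0 1) φ) :
    (∫ ω, φ (X₂ ω) ∂μ) ≤ ∫ ω, φ (X₁ ω) ∂μ := by
  refine le_of_tendsto_of_tendsto' (interp_integral_tendsto μ hX₂ hr₂ hφ)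
    (interp_integral_tendsto μ hX₁ hr₁ hφ) fun n => ?_
  rw [integral_interp μ hX₁ hr₁, integral_interp μ hX₂ hr₂, hm]
  refine add_le_add le_rfl (Finset.sum_le_sum fun k hk => ?_)
  refine mul_le_mul_of_nonneg_left ?_ (slope_mono hφ n k (Finset.mem_range.1 hk))
  · rw [hinge_swap μ hX₁ hr₁, hinge_swap μ hX₂ hr₂, hm]
    linarith [hh (((k:ℝ)+1)/((n:ℝ)+1))]

section quantile
variable {X : Ω → ℝ} (hX : Measurable X) (hr : ∀ ω, X ω ∈ Set.Icc (0:ℝ) 1)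
  {F Q : ℝ → ℝ} (hF : ∀ t, F t = (μ {ω | X ω ≤ t}).toReal)
  (hQ : ∀ α ∈ Set.Ioc (0:ℝ) 1, Q α = sInf {x | x ∈ Set.Icc (0:ℝ) 1 ∧ α ≤ F x})
include hX hr hF hQ

lemma F_props : Monotone F ∧ (∀ t < 0, F t = 0) ∧ (∀ t, 1 ≤ t → F t = 1) ∧
    (∀ t, 0 ≤ F t ∧ F t ≤ 1) ∧ ∀ t, ContinuousWithinAt F (Set.Ici t) t := by
  have : IsProbabilityMeasure (μ.map X) := Measure.isProbabilityMeasure_map hX.aemeasurable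
  have e : F = ProbabilityTheory.cdf (μ.map X) := by
    ext t
    rw [hF, ProbabilityTheory.cdf_eq_real, measureReal_def,
      Measure.map_apply hX measurableSet_Iic]
    rfl
  refine ⟨by rw [e]; exact ProbabilityTheory.monotone_cdf _, fun t ht => ?_, fun t ht => ?_,
    fun t => ?_, fun t => ?_⟩
  · have : {ω | X ω ≤ t} = ∅ := by
      ext ω; simp; linarith [(hr ω).1]
    rw [hF, this]; simp
  · have : {ω | X ω ≤ t} = Set.univ := by
      ext ω; simp; linarith [(hr ω).2]
    rw [hF, this]; simp
  · rw [e]; exact ⟨ProbabilityTheory.cdf_nonneg _ _, ProbabilityTheory.cdf_le_one _ _⟩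
  · rw [e]; exact (ProbabilityTheory.cdf (μ.map X)).right_continuous t

lemma Q_mem {α : ℝ} (hα : α ∈ Set.Ioc (0:ℝ) 1) : Q α ∈ Set.Icc (0:ℝ) 1 := by
  obtain ⟨_, _, h1, _, _⟩ := F_props μ hX hr hF hQ
  rw [hQ α hα]
  refine ⟨le_csInf ⟨1, by simp, by rw [h1 1 le_rfl]; exact hα.2⟩ fun x hx => hx.1.1,
    csInf_le ⟨0, fun x hx => hx.1.1⟩ ⟨by simp, by rw [h1 1 le_rfl]; exact hα.2⟩⟩

lemma Q_le_iff {α : ℝ} (hα : α ∈ Set.Ioc (0:ℝ) 1) (t : ℝ) : Q α ≤ t ↔ α ≤ F t := by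
  obtain ⟨hm, h0, h1, _, hc⟩ := F_props μ hX hr hF hQ
  have hmem := Q_mem μ hX hr hF hQ hα
  constructor
  · intro h
    refine le_trans ?_ (hm h)
    -- right continuity
    have ht : Filter.Tendsto F (nhdsWithin (Q α) (Set.Ioi (Q α))) (nhds (F (Q α))) :=
      (hc (Q α)).mono_left (nhdsWithin_mono _ Set.Ioi_subset_Ici_self)
    refine ge_of_tendsto ht ?_
    filter_upwards [self_mem_nhdsWithin] with x hx
    have hx' : sInf {x | x ∈ Set.Icc (0:ℝ) 1 ∧ α ≤ F x} < x := by
      rw [← hQ α hα]; exact hx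
    have hne : {x | x ∈ Set.Icc (0:ℝ) 1 ∧ α ≤ F x}.Nonempty :=
      ⟨1, by simp, by rw [h1 1 le_rfl]; exact hα.2⟩
    obtain ⟨y, hy, hyx⟩ := exists_lt_of_csInf_lt hne hx'
    exact hy.2.trans (hm hyx.le)
  · intro h
    by_cases ht1 : 1 ≤ t
    · exact hmem.2.trans ht1
    by_cases ht0 : t < 0
    · rw [h0 t ht0] at h; linarith [hα.1]
    rw [hQ α hα]
    exact csInf_le ⟨0, fun x hx => hx.1.1⟩ ⟨⟨by linarith, by linarith⟩, h⟩

lemma Q_mono : MonotoneOn Q (Set.Ioc 0 1) := by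
  intro a ha b hb hab
  rw [Q_le_iff μ hX hr hF hQ ha]
  exact hab.trans ((Q_le_iff μ hX hr hF hQ hb _).1 le_rfl)

lemma Q_aem : AEMeasurable Q (volume.restrict (Set.Ioc (0:ℝ) 1)) :=
  aemeasurable_restrict_of_monotoneOn measurableSet_Ioc (Q_mono μ hX hr hF hQ)

lemma Q_int : IntegrableOn Q (Set.Ioc (0:ℝ) 1) := by
  refine Integrable.of_bound (Q_aem μ hX hr hF hQ).aestronglyMeasurable 1 ?_
  refine (ae_restrict_iff' measurableSet_Ioc).2 (Filter.Eventually.of_forall fun α hα => ?_)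
  have := Q_mem μ hX hr hF hQ hα
  rw [Real.norm_eq_abs, abs_le]; constructor <;> linarith [this.1, this.2]

lemma Q_law : (volume.restrict (Set.Ioc (0:ℝ) 1)).map Q = μ.map X := by
  have hp : IsProbabilityMeasure (volume.restrict (Set.Ioc (0:ℝ) 1)) := ⟨by simp⟩
  have := Measure.isProbabilityMeasure_map (μ := μ) hX.aemeasurable
  have := Measure.isProbabilityMeasure_map (Q_aem μ hX hr hF hQ)
  obtain ⟨_, _, _, hb, _⟩ := F_props μ hX hr hF hQ
  refine Measure.ext_of_Iic _ _ fun t => ?_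
  rw [Measure.map_apply_of_aemeasurable (Q_aem μ hX hr hF hQ) measurableSet_Iic,
    Measure.map_apply hX measurableSet_Iic, Measure.restrict_apply' measurableSet_Ioc]
  have : Q ⁻¹' Set.Iic t ∩ Set.Ioc 0 1 = Set.Ioc 0 (F t) := by
    ext α
    simp only [Set.mem_inter_iff, Set.mem_preimage, Set.mem_Iic]
    constructor
    · rintro ⟨h, hα⟩
      exact ⟨hα.1, (Q_le_iff μ hX hr hF hQ hα t).1 h⟩
    · intro h
      have hα : α ∈ Set.Ioc (0:ℝ) 1 := ⟨h.1, h.2.trans (hb t).2⟩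
      exact ⟨(Q_le_iff μ hX hr hF hQ hα t).2 h.2, hα⟩
  rw [this, Real.volume_Ioc, sub_zero, hF, ENNReal.ofReal_toReal (measure_ne_top _ _)]
  rfl

lemma Q_integral {g : ℝ → ℝ} (hg : Measurable g) :
    ∫ α in Set.Ioc (0:ℝ) 1, g (Q α) = ∫ ω, g (X ω) ∂μ := by
  rw [← integral_map hX.aemeasurable hg.aestronglyMeasurable, ← Q_law μ hX hr hF hQ,
    integral_map (Q_aem μ hX hr hF hQ) hg.aestronglyMeasurable]

lemma Q_lin {c : ℝ} (hc : c ∈ Set.Icc (0:ℝ) 1) (t : ℝ) :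
    ∫ α in Set.Ioc (0:ℝ) c, (t - Q α) = c * t - ∫ α in Set.Ioc (0:ℝ) c, Q α := by
  rw [integral_sub (integrable_const t)
    ((Q_int μ hX hr hF hQ).mono_set (Set.Ioc_subset_Ioc_right hc.2))]
  simp [measureReal_def, hc.1]

lemma L1 {c : ℝ} (hc : c ∈ Set.Icc (0:ℝ) 1) (t : ℝ) :
    c * t - ∫ α in Set.Ioc (0:ℝ) c, Q α ≤ ∫ ω, max (t - X ω) 0 ∂μ := by
  have hI := Q_int μ hX hr hF hQ
  have hsub : Set.Ioc (0:ℝ) c ⊆ Set.Ioc 0 1 := Set.Ioc_subset_Ioc_right hc.2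
  have hi1 : IntegrableOn (fun α => t - Q α) (Set.Ioc (0:ℝ) 1) := (integrable_const t).sub hI
  have hi2 : IntegrableOn (fun α => max (t - Q α) 0) (Set.Ioc (0:ℝ) 1) := hi1.pos_part
  rw [← Q_lin μ hX hr hF hQ hc, ← Q_integral μ hX hr hF hQ (g := fun x => max (t - x) 0)
    (by fun_prop)]
  calc _ ≤ ∫ α in Set.Ioc (0:ℝ) c, max (t - Q α) 0 :=
        setIntegral_mono (hi1.mono_set hsub) (hi2.mono_set hsub) fun α => le_max_left _ _
    _ ≤ _ := setIntegral_mono_set hi2 (Filter.Eventually.of_forall fun α => le_max_right _ _)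
        hsub.eventuallyLE

lemma L0 {c : ℝ} (hc : c ∈ Set.Icc (0:ℝ) 1) (t : ℝ)
    (h1 : ∀ α ∈ Set.Ioc (0:ℝ) 1, α ≤ c → Q α ≤ t) (h2 : ∀ α ∈ Set.Ioc (0:ℝ) 1, c < α → t ≤ Q α) :
    ∫ ω, max (t - X ω) 0 ∂μ = c * t - ∫ α in Set.Ioc (0:ℝ) c, Q α := by
  have hsub : Set.Ioc (0:ℝ) c ⊆ Set.Ioc 0 1 := Set.Ioc_subset_Ioc_right hc.2
  rw [← Q_lin μ hX hr hF hQ hc, ← Q_integral μ hX hr hF hQ (g := fun x => max (t - x) 0)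
    (by fun_prop)]
  rw [setIntegral_eq_of_subset_of_forall_sdiff_eq_zero measurableSet_Ioc hsub]
  · refine setIntegral_congr_fun measurableSet_Ioc fun α hα => ?_
    exact max_eq_left (by linarith [h1 α (hsub hα) hα.2])
  · intro α hα
    have : c < α := not_le.1 fun h => hα.2 ⟨hα.1.1, h⟩
    exact max_eq_right (by linarith [h2 α hα.1 this])

lemma L2 {c : ℝ} (hc : c ∈ Set.Icc (0:ℝ) 1) :
    ∃ t, ∫ ω, max (t - X ω) 0 ∂μ = c * t - ∫ α in Set.Ioc (0:ℝ) c, Q α := by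
  rcases eq_or_lt_of_le hc.1 with h | h
  · refine ⟨0, L0 μ hX hr hF hQ hc 0 (fun α hα h' => ?_) fun α hα _ =>
      (Q_mem μ hX hr hF hQ hα).1⟩
    linarith [hα.1]
  · refine ⟨Q c, L0 μ hX hr hF hQ hc _ (fun α hα h' => ?_) fun α hα h' => ?_⟩
    · exact Q_mono μ hX hr hF hQ hα ⟨h, hc.2⟩ h'
    · exact Q_mono μ hX hr hF hQ ⟨h, hc.2⟩ hα h'.le

lemma L3 (t : ℝ) : ∃ c ∈ Set.Icc (0:ℝ) 1,
    ∫ ω, max (t - X ω) 0 ∂μ = c * t - ∫ α in Set.Ioc (0:ℝ) c, Q α := by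
  obtain ⟨_, _, _, hb, _⟩ := F_props μ hX hr hF hQ
  refine ⟨F t, hb t, L0 μ hX hr hF hQ (hb t) t (fun α hα h => ?_) fun α hα h => ?_⟩
  · exact (Q_le_iff μ hX hr hF hQ hα t).2 h
  · by_contra! h'
    exact absurd ((Q_le_iff μ hX hr hF hQ hα t).1 h'.le) (not_le.2 h)

end quantile

lemma convex_hinge (t : ℝ) : ConvexOn ℝ (Set.Icc 0 1) (fun x : ℝ => max (t - x) 0) := by
  refine ConvexOn.sup ((convexOn_const t (convex_Icc 0 1)).sub (concaveOn_id (convex_Icc 0 1)))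
    (convexOn_const 0 (convex_Icc 0 1))

lemma key {X₁ X₂ : Ω → ℝ} (hX₁ : Measurable X₁) (hX₂ : Measurable X₂)
    (hr₁ : ∀ ω, X₁ ω ∈ Set.Icc (0:ℝ) 1) (hr₂ : ∀ ω, X₂ ω ∈ Set.Icc (0:ℝ) 1)
    (hm : ∫ ω, X₁ ω ∂μ = ∫ ω, X₂ ω ∂μ)
    {F₁ F₂ Q₁ Q₂ : ℝ → ℝ}
    (hF₁ : ∀ t, F₁ t = (μ {ω | X₁ ω ≤ t}).toReal)
    (hF₂ : ∀ t, F₂ t = (μ {ω | X₂ ω ≤ t}).toReal)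
    (hQ₁ : ∀ α ∈ Set.Ioc (0:ℝ) 1, Q₁ α = sInf {x | x ∈ Set.Icc (0:ℝ) 1 ∧ α ≤ F₁ x})
    (hQ₂ : ∀ α ∈ Set.Ioc (0:ℝ) 1, Q₂ α = sInf {x | x ∈ Set.Icc (0:ℝ) 1 ∧ α ≤ F₂ x}) :
    (∀ φ : ℝ → ℝ, ConvexOn ℝ (Set.Icc 0 1) φ →
        (∫ ω, φ (X₂ ω) ∂μ) ≤ ∫ ω, φ (X₁ ω) ∂μ) ↔
    (∀ c ∈ Set.Icc (0:ℝ) 1, (∫ α in Set.Ioc (0:ℝ) c, Q₁ α) ≤ ∫ α in Set.Ioc (0:ℝ) c, Q₂ α) := by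
  constructor
  · intro h c hc
    obtain ⟨t, ht⟩ := L2 μ hX₁ hr₁ hF₁ hQ₁ hc
    have := L1 μ hX₂ hr₂ hF₂ hQ₂ hc t
    have := h _ (convex_hinge t)
    linarith
  · intro h φ hφ
    refine convex_of_hinge μ hX₁ hX₂ hr₁ hr₂ hm (fun t => ?_) hφ
    obtain ⟨c, hc, ht⟩ := L3 μ hX₂ hr₂ hF₂ hQ₂ t
    have := L1 μ hX₁ hr₁ hF₁ hQ₁ hc t
    have := h c hc
    linarith

end

end SharpROC

/-- For calibrated probability forecasts `X₁, X₂` of the binary outcome `Y` with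
`0 < ℙ(Y=0) < 1`: `X₁` is sharper than `X₂` (greater in convex order, with strict
inequality for some convex function) if and only if `X₁` dominates `X₂` in the ROC
sense (`∫₀^c (Q₁ − Q₂) ≤ 0` for all `c ∈ [0,1]`, strictly for some `c`). -/
theorem sharper_iff_roc_dominance
    {Ω : Type*} [MeasurableSpace Ω] (μ : Measure Ω) [IsProbabilityMeasure μ]
    (X₁ X₂ Y : Ω → ℝ) (hX₁ : Measurable X₁) (hX₂ : Measurable X₂) (hY : Measurable Y)
    (hX₁r : ∀ ω, X₁ ω ∈ Set.Icc (0:ℝ) 1) (hX₂r : ∀ ω, X₂ ω ∈ Set.Icc (0:ℝ) 1)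
    (hYr : ∀ ω, Y ω = 0 ∨ Y ω = 1)
    (hY0 : 0 < μ {ω | Y ω = 0}) (hY0' : μ {ω | Y ω = 0} < 1)
    (hcal₁ : μ[Y | MeasurableSpace.comap X₁ inferInstance] =ᵐ[μ] X₁)
    (hcal₂ : μ[Y | MeasurableSpace.comap X₂ inferInstance] =ᵐ[μ] X₂)
    (F₁ F₂ : ℝ → ℝ)
    (hF₁ : ∀ t, F₁ t = (μ {ω | X₁ ω ≤ t}).toReal)
    (hF₂ : ∀ t, F₂ t = (μ {ω | X₂ ω ≤ t}).toReal)
    (Q₁ Q₂ : ℝ → ℝ)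
    (hQ₁ : ∀ α ∈ Set.Ioc (0:ℝ) 1, Q₁ α = sInf {x | x ∈ Set.Icc (0:ℝ) 1 ∧ α ≤ F₁ x})
    (hQ₂ : ∀ α ∈ Set.Ioc (0:ℝ) 1, Q₂ α = sInf {x | x ∈ Set.Icc (0:ℝ) 1 ∧ α ≤ F₂ x}) :
    ((∀ φ : ℝ → ℝ, ConvexOn ℝ (Set.Icc 0 1) φ →
        (∫ ω, φ (X₂ ω) ∂μ) ≤ ∫ ω, φ (X₁ ω) ∂μ)
      ∧ (∃ φ : ℝ → ℝ, ConvexOn ℝ (Set.Icc 0 1) φ ∧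
          (∫ ω, φ (X₂ ω) ∂μ) < ∫ ω, φ (X₁ ω) ∂μ))
    ↔ ((∀ c ∈ Set.Icc (0:ℝ) 1, (∫ α in Set.Ioc (0:ℝ) c, (Q₁ α - Q₂ α)) ≤ 0)
        ∧ (∃ c ∈ Set.Icc (0:ℝ) 1, (∫ α in Set.Ioc (0:ℝ) c, (Q₁ α - Q₂ α)) < 0)) := by
  have hYi : ∀ X : Ω → ℝ, Measurable X →
      μ[Y | MeasurableSpace.comap X inferInstance] =ᵐ[μ] X → ∫ ω, X ω ∂μ = ∫ ω, Y ω ∂μ := by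
    intro X hX h
    rw [← integral_congr_ae h]
    exact integral_condExp hX.comap_le
  have hm : ∫ ω, X₁ ω ∂μ = ∫ ω, X₂ ω ∂μ := by
    rw [hYi X₁ hX₁ hcal₁, hYi X₂ hX₂ hcal₂]
  have k1 := SharpROC.key μ hX₁ hX₂ hX₁r hX₂r hm hF₁ hF₂ hQ₁ hQ₂
  have k2 := SharpROC.key μ hX₂ hX₁ hX₂r hX₁r hm.symm hF₂ hF₁ hQ₂ hQ₁
  have hs : ∀ c ∈ Set.Icc (0:ℝ) 1, (∫ α in Set.Ioc (0:ℝ) c, (Q₁ α - Q₂ α)) =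
      (∫ α in Set.Ioc (0:ℝ) c, Q₁ α) - ∫ α in Set.Ioc (0:ℝ) c, Q₂ α := fun c hc =>
    integral_sub
      ((SharpROC.Q_int μ hX₁ hX₁r hF₁ hQ₁).mono_set (Set.Ioc_subset_Ioc_right hc.2))
      ((SharpROC.Q_int μ hX₂ hX₂r hF₂ hQ₂).mono_set (Set.Ioc_subset_Ioc_right hc.2))
  constructor
  · rintro ⟨h, φ, hφ, hlt⟩
    refine ⟨fun c hc => by rw [hs c hc]; linarith [k1.1 h c hc], ?_⟩
    by_contra! hn
    have := k2.2 (fun c hc => by have := hn c hc; rw [hs c hc] at this; linarith) φ hφ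
    linarith
  · rintro ⟨h, c, hc, hlt⟩
    refine ⟨k1.2 fun c hc => by have := h c hc; rw [hs c hc] at this; linarith, ?_⟩
    by_contra! hn
    have := k2.1 hn c hc
    rw [hs c hc] at hlt
    linarith
end

section
/- Let S : [0,1] × {0,1} → ℝ be a bounded scoring rule, measurable in its first argument, that is proper: for all p, x ∈ [0,1], p·S(p,1) + (1−p)·S(p,0) ≤ p·S(x,1) + (1−p)·S(x,0). Let (Ω, 𝓕, ℙ) be a probability space, Y : Ω → {0,1} a random variable, X : Ω → [0,1] a random variable, and let X̂ be a σ(X)-measurable random variable with values in [0,1] that is a version of E[Y | σ(X)]. Then E[S(X̂, Y)] ≤ E[S(X, Y)]; that is, the recalibrated forecast is at least as good as the original forecast under every proper scoring rule. -/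
open MeasureTheory

theorem aux_integral_eq
    (S : ℝ → ℝ → ℝ)
    (hSmeas : ∀ y, Measurable fun x => S x y)
    (C : ℝ) (hC : ∀ x ∈ Set.Icc (0:ℝ) 1, ∀ y ∈ ({0, 1} : Set ℝ), |S x y| ≤ C)
    {Ω : Type*} (m : MeasurableSpace Ω) [m0 : MeasurableSpace Ω] (hm : m ≤ m0)
    (μ : Measure Ω) [IsProbabilityMeasure μ]
    (Y : Ω → ℝ) (hY : Measurable Y) (hYr : ∀ ω, Y ω = 0 ∨ Y ω = 1)
    (P : Ω → ℝ) (hPm : Measurable P) (hPr : ∀ ω, P ω ∈ Set.Icc (0:ℝ) 1)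
    (hP : P =ᵐ[μ] μ[Y | m])
    (Z : Ω → ℝ) (hZ : Measurable[m] Z) (hZr : ∀ ω, Z ω ∈ Set.Icc (0:ℝ) 1) :
    Integrable (fun ω => P ω * S (Z ω) 1 + (1 - P ω) * S (Z ω) 0) μ ∧
    ∫ ω, S (Z ω) (Y ω) ∂μ = ∫ ω, (P ω * S (Z ω) 1 + (1 - P ω) * S (Z ω) 0) ∂μ := by
  have hZ0 : Measurable Z := hZ.mono hm le_rfl
  have h1 : ∀ y ∈ ({0, 1} : Set ℝ), Integrable (fun ω => S (Z ω) y) μ := fun y hy =>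
    Integrable.of_bound ((hSmeas y).comp hZ0).aestronglyMeasurable C
      (Filter.Eventually.of_forall fun ω => hC _ (hZr ω) y hy)
  have i0 := h1 0 (by simp)
  have i1 := h1 1 (by simp)
  have iD : Integrable (fun ω => S (Z ω) 1 - S (Z ω) 0) μ := i1.sub i0
  have iY : Integrable Y μ := Integrable.of_bound hY.aestronglyMeasurable 1
    (Filter.Eventually.of_forall fun ω => by rcases hYr ω with h | h <;> simp [h])
  have iDY : Integrable (fun ω => (S (Z ω) 1 - S (Z ω) 0) * Y ω) μ :=
    iD.mul_bdd (c := 1) hY.aestronglyMeasurable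
      (Filter.Eventually.of_forall fun ω => by rcases hYr ω with h | h <;> simp [h])
  have iDP : Integrable (fun ω => (S (Z ω) 1 - S (Z ω) 0) * P ω) μ :=
    iD.mul_bdd (c := 1) hPm.aestronglyMeasurable
      (Filter.Eventually.of_forall fun ω => by
        rw [Real.norm_eq_abs, abs_of_nonneg (hPr ω).1]; exact (hPr ω).2)
  have hDm : StronglyMeasurable[m] (fun ω => S (Z ω) 1 - S (Z ω) 0) :=
    (((hSmeas 1).comp hZ).sub ((hSmeas 0).comp hZ)).stronglyMeasurable
  have key : ∫ ω, (S (Z ω) 1 - S (Z ω) 0) * Y ω ∂μ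
      = ∫ ω, (S (Z ω) 1 - S (Z ω) 0) * P ω ∂μ := by
    rw [← integral_condExp hm]
    apply integral_congr_ae
    have := condExp_mul_of_stronglyMeasurable_left (μ := μ) hDm iDY iY
    filter_upwards [this, hP] with ω a b
    rw [b]
    exact a
  have e1 : (fun ω => P ω * S (Z ω) 1 + (1 - P ω) * S (Z ω) 0)
      = fun ω => S (Z ω) 0 + (S (Z ω) 1 - S (Z ω) 0) * P ω := by
    funext ω; ring
  have e2 : (fun ω => S (Z ω) (Y ω))
      = fun ω => S (Z ω) 0 + (S (Z ω) 1 - S (Z ω) 0) * Y ω := by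
    funext ω; rcases hYr ω with h | h <;> simp [h]
  rw [e1, e2]
  exact ⟨i0.add iDP, by rw [integral_add i0 iDY, integral_add i0 iDP, key]⟩

/-- For any bounded proper scoring rule `S` (measurable in its first argument), the
PAV-recalibrated forecast `X̂`, a `σ(X)`-measurable version of `E[Y | σ(X)]`, is at
least as good as the original forecast `X`: `E[S(X̂,Y)] ≤ E[S(X,Y)]`. -/
theorem recalibrated_forecast_dominates
    (S : ℝ → ℝ → ℝ)
    (hSmeas : ∀ y, Measurable fun x => S x y)
    (hSbdd : ∃ C : ℝ, ∀ x ∈ Set.Icc (0:ℝ) 1, ∀ y ∈ ({0, 1} : Set ℝ), |S x y| ≤ C)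
    (hSproper : ∀ p ∈ Set.Icc (0:ℝ) 1, ∀ x ∈ Set.Icc (0:ℝ) 1,
      p * S p 1 + (1 - p) * S p 0 ≤ p * S x 1 + (1 - p) * S x 0)
    {Ω : Type*} [MeasurableSpace Ω] (μ : Measure Ω) [IsProbabilityMeasure μ]
    (X Y : Ω → ℝ) (hX : Measurable X) (hY : Measurable Y)
    (hXr : ∀ ω, X ω ∈ Set.Icc (0:ℝ) 1) (hYr : ∀ ω, Y ω = 0 ∨ Y ω = 1)
    (Xhat : Ω → ℝ)
    (hXhatMeas : Measurable[MeasurableSpace.comap X inferInstance] Xhat)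
    (hXhatr : ∀ ω, Xhat ω ∈ Set.Icc (0:ℝ) 1)
    (hXhat : Xhat =ᵐ[μ] μ[Y | MeasurableSpace.comap X inferInstance]) :
    ∫ ω, S (Xhat ω) (Y ω) ∂μ ≤ ∫ ω, S (X ω) (Y ω) ∂μ := by
  obtain ⟨C, hC⟩ := hSbdd
  have hm := hX.comap_le
  have hPm : Measurable Xhat := hXhatMeas.mono hm le_rfl
  have A := aux_integral_eq S hSmeas C hC _ hm μ Y hY hYr Xhat hPm hXhatr hXhat
    Xhat hXhatMeas hXhatr
  have B := aux_integral_eq S hSmeas C hC _ hm μ Y hY hYr Xhat hPm hXhatr hXhat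
    X (comap_measurable X) hXr
  rw [A.2, B.2]
  exact integral_mono A.1 B.1 fun ω => hSproper _ (hXhatr ω) _ (hXr ω)
end

section
/- Let (Ω, 𝓕, ℙ) be a probability space, Y : Ω → {0,1} a random variable, X : Ω → [0,1] a random variable, and let X̂ be a σ(X)-measurable random variable with values in [0,1] that is a version of E[Y | σ(X)]. Then the mean Brier score admits the exact decomposition E[(X − Y)²] = MCB − DSC + UNC, where MCB = E[(X − X̂)²] ≥ 0, DSC = Var(X̂) ≥ 0, and UNC = Var(Y) = E[Y]·(1 − E[Y]); that is, E[(X − Y)²] = E[(X − X̂)²] − Var(X̂) + Var(Y). -/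
open MeasureTheory ProbabilityTheory

/-- CORP-type decomposition of the mean Brier score at the population level:
`E[(X − Y)²] = MCB − DSC + UNC` with `MCB = E[(X − X̂)²] ≥ 0`, `DSC = Var(X̂) ≥ 0`,
and `UNC = Var(Y) = E[Y]·(1 − E[Y])`, where `X̂` is the recalibrated forecast, a
`σ(X)`-measurable version of `E[Y | σ(X)]`. -/
theorem brier_score_MCB_DSC_UNC_decomposition
    {Ω : Type*} [MeasurableSpace Ω] (μ : Measure Ω) [IsProbabilityMeasure μ]
    (X Y : Ω → ℝ) (hX : Measurable X) (hY : Measurable Y)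
    (hXr : ∀ ω, X ω ∈ Set.Icc (0:ℝ) 1) (hYr : ∀ ω, Y ω = 0 ∨ Y ω = 1)
    (Xhat : Ω → ℝ)
    (hXhatMeas : Measurable[MeasurableSpace.comap X inferInstance] Xhat)
    (hXhatr : ∀ ω, Xhat ω ∈ Set.Icc (0:ℝ) 1)
    (hXhat : Xhat =ᵐ[μ] μ[Y | MeasurableSpace.comap X inferInstance]) :
    (∫ ω, (X ω - Y ω) ^ 2 ∂μ)
        = (∫ ω, (X ω - Xhat ω) ^ 2 ∂μ) - variance Xhat μ + variance Y μ
    ∧ 0 ≤ ∫ ω, (X ω - Xhat ω) ^ 2 ∂μ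
    ∧ 0 ≤ variance Xhat μ
    ∧ variance Y μ = (∫ ω, Y ω ∂μ) * (1 - ∫ ω, Y ω ∂μ) := by
  have hm : MeasurableSpace.comap X inferInstance ≤ (inferInstance : MeasurableSpace Ω) :=
    hX.comap_le
  have hH : Measurable Xhat := hXhatMeas.mono hm le_rfl
  have hYb : ∀ ω, Y ω ∈ Set.Icc (0:ℝ) 1 := by
    intro ω
    rcases hYr ω with h | h <;> rw [h] <;> simp
  have int1 : ∀ f : Ω → ℝ, Measurable f → (∀ ω, f ω ∈ Set.Icc (0:ℝ) 1) → MemLp f 2 μ := by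
    intro f hf hb
    refine MemLp.of_bound hf.aestronglyMeasurable 1 (ae_of_all _ fun ω => ?_)
    rw [Real.norm_eq_abs, abs_of_nonneg (hb ω).1]
    exact (hb ω).2
  have lX := int1 X hX hXr
  have lY := int1 Y hY hYb
  have lH := int1 Xhat hH hXhatr
  have iY : Integrable Y μ := lY.integrable (by norm_num)
  have key : ∀ Z : Ω → ℝ, Measurable[MeasurableSpace.comap X inferInstance] Z →
      MemLp Z 2 μ → ∫ ω, Z ω * Y ω ∂μ = ∫ ω, Z ω * Xhat ω ∂μ := by
    intro Z hZ lZ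
    have h1 := condExp_mul_of_stronglyMeasurable_left (μ := μ) (f := Z) (g := Y)
      hZ.stronglyMeasurable (lZ.integrable_mul lY) iY
    have h2 := integral_condExp (μ := μ) (f := Z * Y) hm
    have h3 : ∫ ω, Z ω * Y ω ∂μ = ∫ ω, (Z * Y) ω ∂μ := rfl
    rw [h3, ← h2]
    refine integral_congr_ae ?_
    filter_upwards [h1, hXhat] with ω a b
    rw [a, b, Pi.mul_apply]
  have hXm : Measurable[MeasurableSpace.comap X inferInstance] X := comap_measurable X
  have kX := key X hXm lX
  have kH := key Xhat hXhatMeas lH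
  have k1 : ∫ ω, Xhat ω ∂μ = ∫ ω, Y ω ∂μ := by
    rw [integral_congr_ae hXhat, integral_condExp hm]
  have sq : ∀ f : Ω → ℝ, MemLp f 2 μ → ∫ ω, (X ω - f ω) ^ 2 ∂μ
      = ∫ ω, X ω ^ 2 ∂μ - 2 * ∫ ω, X ω * f ω ∂μ + ∫ ω, f ω ^ 2 ∂μ := by
    intro f lf
    have i2 : Integrable (fun ω => 2 * (X ω * f ω)) μ := (lX.integrable_mul lf).const_mul 2
    have i3 : Integrable (fun ω => X ω ^ 2 - 2 * (X ω * f ω)) μ := lX.integrable_sq.sub i2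
    rw [← integral_const_mul, ← integral_sub lX.integrable_sq i2,
      ← integral_add i3 lf.integrable_sq]
    congr 1
    ext ω
    ring
  have vY : variance Y μ = ∫ ω, Y ω ^ 2 ∂μ - (∫ ω, Y ω ∂μ) ^ 2 := by
    simpa using variance_eq_sub lY
  have vH : variance Xhat μ = ∫ ω, Xhat ω ^ 2 ∂μ - (∫ ω, Xhat ω ∂μ) ^ 2 := by
    simpa using variance_eq_sub lH
  have yy : ∫ ω, Y ω ^ 2 ∂μ = ∫ ω, Y ω ∂μ := by
    congr 1
    ext ω
    rcases hYr ω with h | h <;> rw [h] <;> norm_num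
  refine ⟨?_, integral_nonneg fun ω => sq_nonneg _, variance_nonneg _ _, ?_⟩
  · rw [sq Y lY, sq Xhat lH, vY, vH, kX, k1]
    ring
  · rw [vY, yy]
    ring
end

section
/- For every θ ∈ (0,1), the elementary score S_θ is a proper scoring rule: for all p, x ∈ [0,1], p·S_θ(p,1) + (1−p)·S_θ(p,0) ≤ p·S_θ(x,1) + (1−p)·S_θ(x,0). Moreover, S_θ is not strictly proper: there exist p ≠ x in [0,1] for which equality holds. -/
/-- For every `θ ∈ (0,1)` the elementary score `S_θ` is a proper scoring rule, but it
is not strictly proper: there exist `p ≠ x` for which equality of expected scores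
holds. -/
theorem elemScore_proper_not_strictly_proper (θ : ℝ) (hθ : θ ∈ Set.Ioo (0:ℝ) 1) :
    (∀ p ∈ Set.Icc (0:ℝ) 1, ∀ x ∈ Set.Icc (0:ℝ) 1,
      p * elemScore θ p 1 + (1 - p) * elemScore θ p 0
        ≤ p * elemScore θ x 1 + (1 - p) * elemScore θ x 0)
    ∧ (∃ p ∈ Set.Icc (0:ℝ) 1, ∃ x ∈ Set.Icc (0:ℝ) 1, p ≠ x ∧
        p * elemScore θ p 1 + (1 - p) * elemScore θ p 0
          = p * elemScore θ x 1 + (1 - p) * elemScore θ x 0) := by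
  obtain ⟨h0, h1⟩ := hθ
  have key : ∀ p x : ℝ, p * elemScore θ x 1 + (1 - p) * elemScore θ x 0
      = if x < θ then 2 * (1 - θ) * p else if x = θ then 2 * θ * (1 - θ)
        else 2 * θ * (1 - p) := by
    intro p x
    unfold elemScore
    rcases lt_trichotomy x θ with h | h | h
    · simp [h, h.ne, h.le, not_lt.mpr h.le]; ring
    · subst h; simp; ring
    · simp [h, h.ne', not_lt.mpr h.le]; ring
  refine ⟨?_, 0, by simp, θ / 2, ⟨by linarith, by linarith⟩, by intro h; linarith, ?_⟩
  · rintro p ⟨hp0, hp1⟩ x ⟨hx0, hx1⟩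
    rw [key, key]
    split_ifs with a b c d e f g <;> first | nlinarith | skip
    all_goals
      have : θ < p := lt_of_le_of_ne (not_lt.mp a) (Ne.symm ‹¬ p = θ›)
      nlinarith
  · rw [key, key, if_pos h0, if_pos (by linarith)]
end

section
/- The Brier score arises from the mixture representation with uniform mixing measure over the elementary scores: for every x ∈ [0,1] and y ∈ {0,1}, ∫₀¹ S_θ(x,y) dθ = (x − y)². -/
theorem piece_aux (f g : ℝ → ℝ) (a b c : ℝ) (hab : a ≤ b) (hg : Continuous g)
    (h : ∀ t, a ≤ t → t ≤ b → t ≠ c → f t = g t) :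
    IntervalIntegrable f MeasureTheory.volume a b ∧ ∫ t in a..b, f t = ∫ t in a..b, g t := by
  have hae : ∀ᵐ t ∂(MeasureTheory.volume : MeasureTheory.Measure ℝ), t ∈ Set.uIoc a b → g t = f t := by
    have : ∀ᵐ t ∂(MeasureTheory.volume : MeasureTheory.Measure ℝ), t ≠ c := by
      simp [MeasureTheory.ae_iff]
    filter_upwards [this] with t ht hm
    rw [Set.uIoc_of_le hab] at hm
    exact (h t hm.1.le hm.2 ht).symm
  refine ⟨(hg.intervalIntegrable a b).congr_ae ?_, (intervalIntegral.integral_congr_ae hae).symm⟩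
  exact (MeasureTheory.ae_restrict_iff' measurableSet_uIoc).2 hae

/-- The Brier score is the mixture of the elementary scores with uniform mixing
measure: `∫₀¹ S_θ(x,y) dθ = (x − y)²` for `x ∈ [0,1]` and `y ∈ {0,1}`. -/
theorem brier_score_mixture_representation
    (x : ℝ) (hx : x ∈ Set.Icc (0:ℝ) 1) (y : ℝ) (hy : y = 0 ∨ y = 1) :
    (∫ θ in (0:ℝ)..1, elemScore θ x y) = (x - y) ^ 2 := by
  obtain ⟨h0, h1⟩ := hx
  rcases hy with rfl | rfl
  · have A := piece_aux (fun θ => elemScore θ x 0) (fun t => 2 * t) 0 x x h0 (by fun_prop) (by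
      intro t _ h2 h3
      have : t < x := lt_of_le_of_ne h2 h3
      simp [elemScore, this, h3.symm])
    have B := piece_aux (fun θ => elemScore θ x 0) (fun t => 0) x 1 x h1 (by fun_prop) (by
      intro t h2 _ h3
      simp [elemScore, not_lt.2 h2, h3.symm])
    rw [← intervalIntegral.integral_add_adjacent_intervals A.1 B.1, A.2, B.2]
    rw [intervalIntegral.integral_const_mul]
    simp
    ring
  · have A := piece_aux (fun θ => elemScore θ x 1) (fun t => 0) 0 x x h0 (by fun_prop) (by
      intro t _ h2 h3
      simp [elemScore, not_lt.2 h2, h3.symm])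
    have B := piece_aux (fun θ => elemScore θ x 1) (fun t => 2 * (1 - t)) x 1 x h1 (by fun_prop) (by
      intro t h2 _ h3
      have : x < t := lt_of_le_of_ne h2 h3.symm
      simp [elemScore, this, h3.symm])
    rw [← intervalIntegral.integral_add_adjacent_intervals A.1 B.1, A.2, B.2]
    rw [intervalIntegral.integral_const_mul, intervalIntegral.integral_sub (by simp) (by simp)]
    simp
    ring
end
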